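/- There exists a constant C > 0 depending only on n and σ with the following property: for every R > 0 and every function U that is nonnegative and continuous on {X = (x,t) : |X| ≤ 3R, t ≥ 0}, C² on 𝔅_{3R}^+, satisfies ΔU(X) + ((1−2σ)/t)·∂_t U(X) = 0 for all X ∈ 𝔅_{3R}^+, and satisfies lim_{t→0⁺} t^{1−2σ} ∂_t U(x,t) = −u(x)^{(n+2σ)/(n−2σ)} for every x ∈ B_{3R}, where u(x) := U(x,0), one has the Harnack-type inequality (max_{|x| ≤ R} u(x)) · (min_{|x| ≤ 2R} u(x)) ≤ C R^{2σ−n}. -/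

import Mathlib

open scoped Topology MeasureTheory RealInnerProductSpace
open Filter MeasureTheory

noncomputable section

/-- Points of `ℝ^{n+1}`, written `X = (x, t)` with `x ∈ ℝⁿ` and `t ∈ ℝ`. -/
abbrev Pt (n : ℕ) := EuclideanSpace ℝ (Fin n) × ℝ

/-- The Euclidean norm on `ℝ^{n+1} = ℝⁿ × ℝ`. -/
def enorm' {n : ℕ} (X : Pt n) : ℝ := Real.sqrt (‖X.1‖ ^ 2 + X.2 ^ 2)

/-- Partial derivative in the last (`t`) direction. -/
def dt {n : ℕ} (U : Pt n → ℝ) (X : Pt n) : ℝ := fderiv ℝ U X (0, 1)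

/-- Second derivative in the direction `v`. -/
def d2 {n : ℕ} (U : Pt n → ℝ) (X v : Pt n) : ℝ :=
  fderiv ℝ (fun Y => fderiv ℝ U Y v) X v

/-- The Laplacian on `ℝ^{n+1}`. -/
def lapl {n : ℕ} (U : Pt n → ℝ) (X : Pt n) : ℝ :=
  (∑ i : Fin n, d2 U X (EuclideanSpace.single i (1 : ℝ), (0 : ℝ))) + d2 U X (0, 1)

/-- `U` is a nonnegative solution of the extension problem on the punctured half-ball
`𝔅_R^+`: it is nonnegative and continuous on `{|X| ≤ R, t ≥ 0} \ {0}`, `C²` on `𝔅_R^+`,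
satisfies `ΔU + ((1-2σ)/t) ∂_t U = 0` there, and satisfies the nonlinear Neumann condition
`lim_{t→0⁺} t^{1-2σ} ∂_t U(x,t) = -u(x)^{(n+2σ)/(n-2σ)}` for `x ∈ B_R \ {0}`. -/
def ExtSol (n : ℕ) (σ R : ℝ) (U : Pt n → ℝ) : Prop :=
  (∀ X : Pt n, enorm' X ≤ R → 0 ≤ X.2 → X ≠ 0 → 0 ≤ U X) ∧
  ContinuousOn U ({X : Pt n | enorm' X ≤ R ∧ 0 ≤ X.2} \ {0}) ∧
  ContDiffOn ℝ 2 U {X : Pt n | enorm' X < R ∧ 0 < X.2} ∧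
  (∀ X : Pt n, enorm' X < R → 0 < X.2 →
    lapl U X + ((1 - 2 * σ) / X.2) * dt U X = 0) ∧
  (∀ x : EuclideanSpace ℝ (Fin n), ‖x‖ < R → x ≠ 0 →
    Tendsto (fun t : ℝ => t ^ (1 - 2 * σ) * dt U (x, t)) (𝓝[>] 0)
      (𝓝 (-(U (x, 0) ^ (((n : ℝ) + 2 * σ) / ((n : ℝ) - 2 * σ))))))

namespace HarnackExt

/-! ### Second order derivatives along curves -/

/-- `f` has first derivative `f1` and second derivative `f2` at `0`. -/
def HasSnd {F : Type*} [NormedAddCommGroup F] [NormedSpace ℝ F] (f : ℝ → F) (f1 f2 : F) : Prop :=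
  ∃ f' : ℝ → F, (∀ᶠ s in 𝓝 (0 : ℝ), HasDerivAt f (f' s) s) ∧ f' 0 = f1 ∧ HasDerivAt f' f2 0

section HasSnd

variable {F : Type*} [NormedAddCommGroup F] [NormedSpace ℝ F]
variable {G : Type*} [NormedAddCommGroup G] [NormedSpace ℝ G]

theorem HasSnd.unique {f : ℝ → F} {a b a' b' : F} (h : HasSnd f a b) (h' : HasSnd f a' b') :
    a = a' ∧ b = b' := by
  obtain ⟨u, hu, rfl, hb⟩ := h
  obtain ⟨v, hv, rfl, hb'⟩ := h'
  have huv : u =ᶠ[𝓝 0] v := by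
    filter_upwards [hu, hv] with s h1 h2 using h1.unique h2
  exact ⟨huv.self_of_nhds, (hb.congr_of_eventuallyEq huv.symm).unique hb'⟩

theorem HasSnd.congr_val {f : ℝ → F} {a b a' b' : F} (h : HasSnd f a b) (ha : a = a')
    (hb : b = b') : HasSnd f a' b' := ha ▸ hb ▸ h

theorem hasSnd_const (c : F) : HasSnd (fun _ => c) 0 0 :=
  ⟨fun _ => 0, Eventually.of_forall fun s => hasDerivAt_const s c, rfl, hasDerivAt_const 0 0⟩

theorem hasSnd_line (c v : F) : HasSnd (fun s => c + s • v) v 0 := by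
  refine ⟨fun _ => v, Eventually.of_forall fun s => ?_, rfl, hasDerivAt_const 0 v⟩
  simpa using ((hasDerivAt_id s).smul_const v).const_add c

theorem HasSnd.add {f g : ℝ → F} {a b a' b' : F} (h : HasSnd f a b) (h' : HasSnd g a' b') :
    HasSnd (fun s => f s + g s) (a + a') (b + b') := by
  obtain ⟨u, hu, rfl, hb⟩ := h
  obtain ⟨v, hv, rfl, hb'⟩ := h'
  refine ⟨fun s => u s + v s, ?_, rfl, hb.add hb'⟩
  filter_upwards [hu, hv] with s h1 h2 using h1.add h2

theorem HasSnd.smul {f : ℝ → ℝ} {g : ℝ → F} {a b : ℝ} {a' b' : F} (h : HasSnd f a b)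
    (h' : HasSnd g a' b') :
    HasSnd (fun s => f s • g s) (f 0 • a' + a • g 0) (f 0 • b' + (2 * a) • a' + b • g 0) := by
  obtain ⟨u, hu, rfl, hb⟩ := h
  obtain ⟨v, hv, rfl, hb'⟩ := h'
  refine ⟨fun s => f s • v s + u s • g s, ?_, rfl, ?_⟩
  · filter_upwards [hu, hv] with s h1 h2 using h1.smul h2
  · have h1 := (hu.self_of_nhds.smul hb').add (hb.smul hv.self_of_nhds)
    refine h1.congr_deriv ?_
    module

theorem HasSnd.mul {f g : ℝ → ℝ} {a b a' b' : ℝ} (h : HasSnd f a b) (h' : HasSnd g a' b') :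
    HasSnd (fun s => f s * g s) (f 0 * a' + a * g 0) (f 0 * b' + 2 * a * a' + b * g 0) :=
  h.smul h'

theorem HasSnd.scomp {f : ℝ → ℝ} {a b : ℝ} {P P' : ℝ → ℝ} {P2 : ℝ} (h : HasSnd f a b)
    (hP : ∀ᶠ u in 𝓝 (f 0), HasDerivAt P (P' u) u) (hP' : HasDerivAt P' P2 (f 0)) :
    HasSnd (fun s => P (f s)) (P' (f 0) * a) (P2 * a ^ 2 + P' (f 0) * b) := by
  obtain ⟨u, hu, rfl, hb⟩ := h
  have hc : ContinuousAt f 0 := hu.self_of_nhds.continuousAt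
  refine ⟨fun s => P' (f s) * u s, ?_, rfl, ?_⟩
  · filter_upwards [hu, hc.eventually hP] with s h1 h2 using h2.comp s h1
  · have h1 := (hP'.comp 0 hu.self_of_nhds).mul hb
    refine h1.congr_deriv ?_
    simp only [Function.comp_apply]
    ring

theorem hasFDerivAt_of_contDiffAt_two {V : G → F} {X : G} (hV : ContDiffAt ℝ 2 V X) :
    (∀ᶠ Y in 𝓝 X, HasFDerivAt V (fderiv ℝ V Y) Y) ∧
      HasFDerivAt (fderiv ℝ V) (fderiv ℝ (fderiv ℝ V) X) X := by
  constructor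
  · filter_upwards [hV.eventually (by simp)] with Y hY
    exact (hY.differentiableAt (by simp)).hasFDerivAt
  · have : ContDiffAt ℝ 1 (fderiv ℝ V) X := hV.fderiv_right (by norm_num)
    exact (this.differentiableAt (by simp)).hasFDerivAt

theorem HasSnd.comp_contDiffAt {c : ℝ → G} {a b : G} (h : HasSnd c a b) {V : G → F}
    (hV : ContDiffAt ℝ 2 V (c 0)) :
    HasSnd (fun s => V (c s)) (fderiv ℝ V (c 0) a)
      (fderiv ℝ (fderiv ℝ V) (c 0) a a + fderiv ℝ V (c 0) b) := by
  obtain ⟨u, hu, rfl, hb⟩ := h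
  have hc : ContinuousAt c 0 := hu.self_of_nhds.continuousAt
  obtain ⟨h1, h2⟩ := hasFDerivAt_of_contDiffAt_two hV
  refine ⟨fun s => fderiv ℝ V (c s) (u s), ?_, rfl, ?_⟩
  · filter_upwards [hu, hc.eventually h1] with s h3 h4 using h4.comp_hasDerivAt s h3
  · exact (h2.comp_hasDerivAt 0 hu.self_of_nhds).clm_apply hb

end HasSnd

/-! ### The degenerate operator -/

/-- The operator `Δ + ((1 - 2σ)/t) ∂_t`. -/
def LL {n : ℕ} (σ : ℝ) (U : Pt n → ℝ) (X : Pt n) : ℝ :=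
  lapl U X + ((1 - 2 * σ) / X.2) * dt U X

/-- Horizontal coordinate vectors. -/
def eh {n : ℕ} (i : Fin n) : Pt n := (EuclideanSpace.single i (1 : ℝ), (0 : ℝ))

/-- The vertical coordinate vector. -/
def ev {n : ℕ} : Pt n := (0, 1)

theorem d2_eq {n : ℕ} {f : Pt n → ℝ} {X : Pt n} (hf : ContDiffAt ℝ 2 f X) (v : Pt n) :
    d2 f X v = fderiv ℝ (fderiv ℝ f) X v v := by
  have h := (hasFDerivAt_of_contDiffAt_two hf).2
  have h2 : HasFDerivAt (fun Y => fderiv ℝ f Y v) _ X :=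
    h.clm_apply (hasFDerivAt_const v X)
  rw [d2, h2.fderiv]
  simp

theorem LL_eq {n : ℕ} {σ : ℝ} {f : Pt n → ℝ} {X : Pt n} (hf : ContDiffAt ℝ 2 f X) :
    LL σ f X = (∑ i, fderiv ℝ (fderiv ℝ f) X (eh i) (eh i)) +
      fderiv ℝ (fderiv ℝ f) X ev ev + ((1 - 2 * σ) / X.2) * fderiv ℝ f X ev := by
  simp only [LL, lapl, dt, d2_eq hf, eh, ev]

theorem fderiv_of_hasSnd {n : ℕ} {f : Pt n → ℝ} {X v : Pt n} (hf : ContDiffAt ℝ 2 f X) {a b : ℝ}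
    (h : HasSnd (fun s => f (X + s • v)) a b) :
    fderiv ℝ f X v = a ∧ fderiv ℝ (fderiv ℝ f) X v v = b := by
  have h1 := (hasSnd_line X v).comp_contDiffAt (V := f) (by simpa using hf)
  have h2 := h1.unique h
  simpa using h2

theorem hasSnd_line_of_contDiffAt {n : ℕ} {f : Pt n → ℝ} {X : Pt n} (hf : ContDiffAt ℝ 2 f X)
    (v : Pt n) : HasSnd (fun s => f (X + s • v)) (fderiv ℝ f X v)
      (fderiv ℝ (fderiv ℝ f) X v v) := by
  have h1 := (hasSnd_line X v).comp_contDiffAt (V := f) (by simpa using hf)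
  simpa using h1

theorem LL_of_hasSnd {n : ℕ} {σ : ℝ} {f : Pt n → ℝ} {X : Pt n} (hf : ContDiffAt ℝ 2 f X)
    {a A : Fin n → ℝ} {b c : ℝ} (hi : ∀ i, HasSnd (fun s => f (X + s • eh i)) (a i) (A i))
    (ht : HasSnd (fun s => f (X + s • ev)) b c) :
    LL σ f X = (∑ i, A i) + c + ((1 - 2 * σ) / X.2) * b := by
  rw [LL_eq hf, (fderiv_of_hasSnd hf ht).1, (fderiv_of_hasSnd hf ht).2]
  simp only [fun i => (fderiv_of_hasSnd hf (hi i)).2]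

theorem LL_congr {n : ℕ} {σ : ℝ} {f g : Pt n → ℝ} {X : Pt n} (hf : ContDiffAt ℝ 2 f X)
    (h : f =ᶠ[𝓝 X] g) : LL σ f X = LL σ g X := by
  have hg : ContDiffAt ℝ 2 g X := hf.congr_of_eventuallyEq h.symm
  rw [LL_eq hf, LL_eq hg, h.fderiv_eq, h.fderiv.fderiv_eq]

theorem LL_add {n : ℕ} {σ : ℝ} {f g : Pt n → ℝ} {X : Pt n} (hf : ContDiffAt ℝ 2 f X)
    (hg : ContDiffAt ℝ 2 g X) : LL σ (fun Y => f Y + g Y) X = LL σ f X + LL σ g X := by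
  rw [LL_of_hasSnd (hf.add hg)
    (fun i => (hasSnd_line_of_contDiffAt hf (eh i)).add (hasSnd_line_of_contDiffAt hg (eh i)))
    ((hasSnd_line_of_contDiffAt hf ev).add (hasSnd_line_of_contDiffAt hg ev)),
    LL_eq hf, LL_eq hg, Finset.sum_add_distrib]
  ring

theorem LL_const {n : ℕ} {σ : ℝ} (c : ℝ) (X : Pt n) : LL σ (fun _ => c) X = 0 := by
  rw [LL_of_hasSnd contDiffAt_const (fun i => hasSnd_const c) (hasSnd_const c)]
  simp

theorem LL_const_mul {n : ℕ} {σ : ℝ} {f : Pt n → ℝ} {X : Pt n} (c : ℝ)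
    (hf : ContDiffAt ℝ 2 f X) : LL σ (fun Y => c * f Y) X = c * LL σ f X := by
  rw [LL_of_hasSnd (contDiffAt_const.mul hf)
    (fun i => (hasSnd_const c).mul (hasSnd_line_of_contDiffAt hf (eh i)))
    ((hasSnd_const c).mul (hasSnd_line_of_contDiffAt hf ev)), LL_eq hf]
  simp only [mul_zero, zero_mul, add_zero, ← Finset.mul_sum]
  ring

theorem LL_neg {n : ℕ} {σ : ℝ} {f : Pt n → ℝ} {X : Pt n}
    (hf : ContDiffAt ℝ 2 f X) : LL σ (fun Y => - f Y) X = - LL σ f X := by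
  simpa using LL_const_mul (σ := σ) (-1) hf

theorem LL_sub {n : ℕ} {σ : ℝ} {f g : Pt n → ℝ} {X : Pt n} (hf : ContDiffAt ℝ 2 f X)
    (hg : ContDiffAt ℝ 2 g X) : LL σ (fun Y => f Y - g Y) X = LL σ f X - LL σ g X := by
  simp only [sub_eq_add_neg]
  rw [LL_add hf hg.neg, LL_neg hg]

/-- `f` is twice continuously differentiable at `X` and `LL σ f X = c`. -/
def HasLL {n : ℕ} (σ : ℝ) (f : Pt n → ℝ) (X : Pt n) (c : ℝ) : Prop :=
  ContDiffAt ℝ 2 f X ∧ LL σ f X = c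

namespace HasLL

variable {n : ℕ} {σ : ℝ} {f g : Pt n → ℝ} {X : Pt n} {a b : ℝ}

theorem congr_val (h : HasLL σ f X a) (hab : a = b) : HasLL σ f X b := hab ▸ h

theorem congr (h : HasLL σ f X a) (hfg : f =ᶠ[𝓝 X] g) : HasLL σ g X a :=
  ⟨h.1.congr_of_eventuallyEq hfg.symm, (LL_congr h.1 hfg) ▸ h.2⟩

theorem add (hf : HasLL σ f X a) (hg : HasLL σ g X b) :
    HasLL σ (fun Y => f Y + g Y) X (a + b) :=
  ⟨hf.1.add hg.1, by rw [LL_add hf.1 hg.1, hf.2, hg.2]⟩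

theorem sub (hf : HasLL σ f X a) (hg : HasLL σ g X b) :
    HasLL σ (fun Y => f Y - g Y) X (a - b) :=
  ⟨hf.1.sub hg.1, by rw [LL_sub hf.1 hg.1, hf.2, hg.2]⟩

theorem const_mul (c : ℝ) (hf : HasLL σ f X a) : HasLL σ (fun Y => c * f Y) X (c * a) :=
  ⟨contDiffAt_const.mul hf.1, by rw [LL_const_mul c hf.1, hf.2]⟩

end HasLL

theorem hasLL_const {n : ℕ} {σ : ℝ} (c : ℝ) (X : Pt n) : HasLL σ (fun _ => c) X 0 :=
  ⟨contDiffAt_const, LL_const c X⟩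

/-! ### The Euclidean structure of `Pt n` -/

/-- Squared Euclidean norm. -/
def nsq {n : ℕ} (X : Pt n) : ℝ := ‖X.1‖ ^ 2 + X.2 ^ 2

/-- Euclidean inner product. -/
def pin {n : ℕ} (X Y : Pt n) : ℝ := ⟪X.1, Y.1⟫ + X.2 * Y.2

section euclid

variable {n : ℕ}

theorem nsq_nonneg (X : Pt n) : 0 ≤ nsq X := by unfold nsq; positivity

@[fun_prop]
theorem contDiff_nsq : ContDiff ℝ 2 (nsq : Pt n → ℝ) :=
  (contDiff_fst.norm_sq ℝ).add (contDiff_snd.pow 2)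

@[fun_prop]
theorem continuous_nsq : Continuous (nsq : Pt n → ℝ) := contDiff_nsq.continuous

theorem nsq_line (X v : Pt n) (s : ℝ) :
    nsq (X + s • v) = nsq X + 2 * s * pin X v + s ^ 2 * nsq v := by
  simp only [nsq, pin, Prod.fst_add, Prod.snd_add, Prod.smul_fst, Prod.smul_snd, norm_add_sq_real,
    inner_smul_right, norm_smul, Real.norm_eq_abs, mul_pow, sq_abs, smul_eq_mul]
  ring

theorem nsq_smul (c : ℝ) (X : Pt n) : nsq (c • X) = c ^ 2 * nsq X := by
  simp only [nsq, Prod.smul_fst, Prod.smul_snd, norm_smul, Real.norm_eq_abs, mul_pow, sq_abs,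
    smul_eq_mul]
  ring

theorem sq_le_nsq (X : Pt n) : X.2 ^ 2 ≤ nsq X := by
  unfold nsq; nlinarith [sq_nonneg ‖X.1‖]

theorem norm_sq_le_nsq (X : Pt n) : ‖X.1‖ ^ 2 ≤ nsq X := by
  unfold nsq; nlinarith [sq_nonneg X.2]

theorem nsq_pos {X : Pt n} (h : 0 < X.2) : 0 < nsq X :=
  lt_of_lt_of_le (by positivity) (sq_le_nsq X)

@[simp] theorem pin_eh (X : Pt n) (i : Fin n) : pin X (eh i) = X.1 i := by
  simp [pin, eh, EuclideanSpace.inner_single_right]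

@[simp] theorem pin_ev (X : Pt n) : pin X ev = X.2 := by simp [pin, ev]

@[simp] theorem nsq_eh (i : Fin n) : nsq (eh i) = 1 := by simp [nsq, eh]

@[simp] theorem nsq_ev : nsq (ev : Pt n) = 1 := by simp [nsq, ev]

theorem sum_sq (x : EuclideanSpace ℝ (Fin n)) : ∑ i, x i ^ 2 = ‖x‖ ^ 2 := by
  rw [EuclideanSpace.norm_sq_eq]; simp

theorem sum_eh (X : Pt n) : (∑ i, X.1 i • (eh i : Pt n)) + X.2 • (ev : Pt n) = X := by
  ext1
  · ext j
    simp [eh, ev, Prod.fst_sum, Finset.sum_apply, Pi.single_apply]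
  · simp [eh, ev, Prod.snd_sum]

theorem hasSnd_quad (a b c : ℝ) : HasSnd (fun s : ℝ => a + 2 * s * b + s ^ 2 * c) (2 * b) (2 * c) := by
  refine ⟨fun s => 2 * b + 2 * s * c, Eventually.of_forall fun s => ?_, by ring, ?_⟩
  · have := ((((hasDerivAt_id s).const_mul 2).mul_const b).const_add a).add
      (((hasDerivAt_id s).pow 2).mul_const c)
    refine this.congr_deriv ?_
    simp
  · have := (((hasDerivAt_id (0 : ℝ)).const_mul 2).mul_const c).const_add (2 * b)
    refine this.congr_deriv ?_
    simp

theorem hasSnd_nsq (X v : Pt n) :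
    HasSnd (fun s : ℝ => nsq (X + s • v)) (2 * pin X v) (2 * nsq v) := by
  simp only [nsq_line]
  exact hasSnd_quad _ _ _

/-- The trace of a bilinear form is invariant under the orthogonal reflection in `Xᗮ`. -/
theorem trace_reflect (B : Pt n →L[ℝ] Pt n →L[ℝ] ℝ) (X : Pt n) {q : ℝ} (hq : q ≠ 0)
    (hX : nsq X = q) :
    (∑ i, B (eh i - (2 * pin X (eh i) / q) • X) (eh i - (2 * pin X (eh i) / q) • X)) +
      B (ev - (2 * pin X ev / q) • X) (ev - (2 * pin X ev / q) • X) =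
    (∑ i, B (eh i) (eh i)) + B ev ev := by
  have key : ∀ v : Pt n, B (v - (2 * pin X v / q) • X) (v - (2 * pin X v / q) • X) =
      B v v - (2 / q) * B (pin X v • v) X - (2 / q) * B X (pin X v • v) +
        (4 / q ^ 2) * pin X v ^ 2 * B X X := by
    intro v
    simp only [map_sub, map_smul, sub_apply, smul_apply,
      smul_eq_mul]
    field_simp
    ring
  have h1 : (∑ i, B (pin X (eh i) • eh i) X) + B (pin X ev • ev) X = B X X := by
    have := congrArg (fun Y => B Y X) (sum_eh X)
    simpa using this
  have h2 : (∑ i, B X (pin X (eh i) • eh i)) + B X (pin X ev • ev) = B X X := by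
    have := congrArg (fun Y => B X Y) (sum_eh X)
    simpa using this
  have h3 : (∑ i, pin X (eh i) ^ 2) + pin X ev ^ 2 = q := by
    simp only [pin_eh, pin_ev, sum_sq]
    exact hX
  simp only [key, Finset.sum_add_distrib, Finset.sum_sub_distrib, ← Finset.mul_sum,
    ← Finset.sum_mul]
  have e1 := eq_sub_of_add_eq h1
  have e2 := eq_sub_of_add_eq h2
  have e3 := eq_sub_of_add_eq h3
  rw [e1, e2, e3]
  field_simp
  ring

end euclid

/-! ### Explicit evaluations of the operator -/

section explicit

variable {n : ℕ} {σ : ℝ}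

theorem hasLL_comp_qd (F F' : ℝ → ℝ) (F2 : ℝ) (X0 X : Pt n)
    (hF : ContDiffAt ℝ 2 F (nsq (X - X0)))
    (h1 : ∀ᶠ u in 𝓝 (nsq (X - X0)), HasDerivAt F (F' u) u)
    (h2 : HasDerivAt F' F2 (nsq (X - X0))) :
    HasLL σ (fun Y => F (nsq (Y - X0))) X
      (F' (nsq (X - X0)) * (2 * n + 2 + 2 * ((1 - 2 * σ) / X.2) * (X.2 - X0.2)) +
        4 * nsq (X - X0) * F2) := by
  have hc : ContDiffAt ℝ 2 (fun Y : Pt n => F (nsq (Y - X0))) X := by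
    refine ContDiffAt.comp X hF ?_
    exact (contDiff_nsq.comp (contDiff_id.sub contDiff_const)).contDiffAt
  refine ⟨hc, ?_⟩
  have hs : ∀ v : Pt n, HasSnd (fun s : ℝ => F (nsq (X + s • v - X0)))
      (F' (nsq (X - X0)) * (2 * pin (X - X0) v))
      (F2 * (2 * pin (X - X0) v) ^ 2 + F' (nsq (X - X0)) * (2 * nsq v)) := by
    intro v
    have h := (hasSnd_nsq (X - X0) v).scomp (P := F) (P' := F') (P2 := F2)
      (by simpa using h1) (by simpa using h2)
    simp only [zero_smul, add_zero] at h
    convert h using 4 with s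
    abel
  rw [LL_of_hasSnd hc (fun i => hs (eh i)) (hs ev)]
  simp only [pin_eh, pin_ev, nsq_eh, nsq_ev, mul_pow, Finset.sum_add_distrib, ← Finset.mul_sum,
    sum_sq, Finset.sum_const, Finset.card_univ, Fintype.card_fin, nsmul_eq_mul]
  have : nsq (X - X0) = ‖(X - X0).1‖ ^ 2 + (X.2 - X0.2) ^ 2 := rfl
  rw [show ‖(X - X0).1‖ ^ 2 = nsq (X - X0) - (X.2 - X0.2) ^ 2 by rw [this]; ring]
  simp only [Prod.snd_sub]
  ring

theorem hasLL_qd (X0 X : Pt n) :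
    HasLL σ (fun Y => nsq (Y - X0)) X
      (2 * n + 2 + 2 * ((1 - 2 * σ) / X.2) * (X.2 - X0.2)) := by
  refine (hasLL_comp_qd (fun u => u) (fun _ => 1) 0 X0 X contDiffAt_id
    (Eventually.of_forall fun u => hasDerivAt_id u) (hasDerivAt_const _ _)).congr_val ?_
  ring

theorem hasLL_comp_snd (F F' : ℝ → ℝ) (F2 : ℝ) (X : Pt n)
    (hF : ContDiffAt ℝ 2 F X.2)
    (h1 : ∀ᶠ u in 𝓝 X.2, HasDerivAt F (F' u) u)
    (h2 : HasDerivAt F' F2 X.2) :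
    HasLL σ (fun Y => F Y.2) X (F2 + ((1 - 2 * σ) / X.2) * F' X.2) := by
  have hc : ContDiffAt ℝ 2 (fun Y : Pt n => F Y.2) X :=
    ContDiffAt.comp X hF contDiff_snd.contDiffAt
  refine ⟨hc, ?_⟩
  have hs : ∀ v : Pt n, HasSnd (fun s : ℝ => F (X + s • v).2)
      (F' X.2 * v.2) (F2 * v.2 ^ 2 + F' X.2 * 0) := by
    intro v
    have h := (hasSnd_line X.2 v.2).scomp (P := F) (P' := F') (P2 := F2)
      (by simpa using h1) (by simpa using h2)
    simpa using h
  rw [LL_of_hasSnd hc (fun i => hs (eh i)) (hs ev)]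
  simp [eh, ev]

theorem hasLL_comp_inner (F F' : ℝ → ℝ) (F2 : ℝ) (x0 e : EuclideanSpace ℝ (Fin n)) (X : Pt n)
    (hF : ContDiffAt ℝ 2 F ⟪X.1 - x0, e⟫)
    (h1 : ∀ᶠ u in 𝓝 ⟪X.1 - x0, e⟫, HasDerivAt F (F' u) u)
    (h2 : HasDerivAt F' F2 ⟪X.1 - x0, e⟫) :
    HasLL σ (fun Y => F ⟪Y.1 - x0, e⟫) X (F2 * ‖e‖ ^ 2) := by
  have hc : ContDiffAt ℝ 2 (fun Y : Pt n => F ⟪Y.1 - x0, e⟫) X := by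
    refine ContDiffAt.comp X hF ?_
    exact ((contDiff_fst.sub contDiff_const).inner ℝ contDiff_const).contDiffAt
  refine ⟨hc, ?_⟩
  have hs : ∀ v : Pt n, HasSnd (fun s : ℝ => F ⟪(X + s • v).1 - x0, e⟫)
      (F' ⟪X.1 - x0, e⟫ * ⟪v.1, e⟫) (F2 * ⟪v.1, e⟫ ^ 2 + F' ⟪X.1 - x0, e⟫ * 0) := by
    intro v
    have h := (hasSnd_line ⟪X.1 - x0, e⟫ ⟪v.1, e⟫).scomp (P := F) (P' := F') (P2 := F2)
      (by simpa using h1) (by simpa using h2)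
    simp only [zero_smul, add_zero] at h
    convert h using 3 with s
    simp only [Prod.fst_add, Prod.smul_fst, add_sub_right_comm, inner_add_left, inner_smul_left,
      smul_eq_mul]
    simp
  rw [LL_of_hasSnd hc (fun i => hs (eh i)) (hs ev)]
  simp only [eh, ev, inner_zero_left, EuclideanSpace.inner_single_left, mul_zero, add_zero,
    ← Finset.mul_sum]
  simp [sum_sq]

theorem hasLL_rpow_snd {X : Pt n} (hX : 0 < X.2) :
    HasLL σ (fun Y => Y.2 ^ (2 * σ)) X 0 := by
  have h := hasLL_comp_snd (σ := σ) (fun u : ℝ => u ^ (2 * σ)) (fun u => 2 * σ * u ^ (2 * σ - 1))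
    (2 * σ * ((2 * σ - 1) * X.2 ^ (2 * σ - 1 - 1))) X
    (Real.contDiffAt_rpow_const_of_ne hX.ne') ?_ ?_
  · refine h.congr_val ?_
    rw [Real.rpow_sub_one hX.ne' (2 * σ - 1)]
    field_simp
    ring
  · filter_upwards [lt_mem_nhds hX] with u hu
    exact Real.hasDerivAt_rpow_const (Or.inl hu.ne')
  · exact (Real.hasDerivAt_rpow_const (Or.inl hX.ne')).const_mul _

theorem hasLL_sq_snd {X : Pt n} (hX : 0 < X.2) :
    HasLL σ (fun Y => Y.2 ^ 2) X (4 - 4 * σ) := by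
  have h := hasLL_comp_snd (σ := σ) (fun u : ℝ => u ^ 2) (fun u => 2 * u) 2 X
    (contDiffAt_id.pow 2) (Eventually.of_forall fun u => by simpa using hasDerivAt_pow 2 u)
    (by simpa using (hasDerivAt_id X.2).const_mul 2)
  refine h.congr_val ?_
  field_simp
  ring

theorem hasLL_qd_flat (x0 : EuclideanSpace ℝ (Fin n)) {X : Pt n} (hX : 0 < X.2) :
    HasLL σ (fun Y => ‖Y.1 - x0‖ ^ 2) X (2 * n) := by
  have h := (hasLL_qd (σ := σ) (x0, 0) X).sub (hasLL_sq_snd hX)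
  simp only [nsq, Prod.fst_sub, Prod.snd_sub, sub_zero, add_sub_cancel_right] at h
  refine h.congr_val ?_
  field_simp
  ring

end explicit

section transform

variable {n : ℕ} {σ : ℝ}

theorem hasLL_affine {V : Pt n → ℝ} {c : ℝ} (hc : c ≠ 0) (x0 : EuclideanSpace ℝ (Fin n))
    {X : Pt n} {a : ℝ} (h : HasLL σ V (c • X + (x0, 0)) a) :
    HasLL σ (fun Y => V (c • Y + (x0, 0))) X (c ^ 2 * a) := by
  have hC : ContDiffAt ℝ 2 (fun Y : Pt n => V (c • Y + (x0, 0))) X := by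
    refine ContDiffAt.comp X h.1 ?_
    exact ((contDiff_const_smul c).add contDiff_const).contDiffAt
  refine ⟨hC, ?_⟩
  have hs : ∀ v : Pt n, HasSnd (fun s : ℝ => V (c • (X + s • v) + (x0, 0)))
      (fderiv ℝ V (c • X + (x0, 0)) (c • v))
      (fderiv ℝ (fderiv ℝ V) (c • X + (x0, 0)) (c • v) (c • v)) := by
    intro v
    have h2 := hasSnd_line_of_contDiffAt h.1 (c • v)
    convert h2 using 3 with s
    rw [smul_add, smul_comm c s v]
    abel
  rw [LL_of_hasSnd hC (fun i => hs (eh i)) (hs ev), ← h.2, LL_eq h.1]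
  simp only [map_smul, smul_apply, smul_eq_mul, Prod.snd_add, Prod.smul_snd,
    add_zero, ← Finset.mul_sum]
  field_simp

/-- Reflection across the vertical hyperplane through `x0` orthogonal to `e`. -/
def refl (x0 e : EuclideanSpace ℝ (Fin n)) (X : Pt n) : Pt n :=
  (X.1 - (2 * ⟪X.1 - x0, e⟫) • e, X.2)

theorem hasLL_refl {V : Pt n → ℝ} {x0 e : EuclideanSpace ℝ (Fin n)} (he : ‖e‖ = 1)
    {X : Pt n} {a : ℝ} (h : HasLL σ V (refl x0 e X) a) :
    HasLL σ (fun Y => V (refl x0 e Y)) X a := by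
  have hC : ContDiffAt ℝ 2 (fun Y : Pt n => V (refl x0 e Y)) X := by
    refine ContDiffAt.comp X h.1 (ContDiff.contDiffAt ?_)
    unfold refl
    exact (contDiff_fst.sub ((contDiff_const.mul ((contDiff_fst.sub contDiff_const).inner ℝ
      contDiff_const)).smul contDiff_const)).prodMk contDiff_snd
  refine ⟨hC, ?_⟩
  set E : Pt n := (e, 0) with hE
  have hE1 : nsq E = 1 := by simp [nsq, hE, he]
  have hs : ∀ v : Pt n, HasSnd (fun s : ℝ => V (refl x0 e (X + s • v)))
      (fderiv ℝ V (refl x0 e X) (v - (2 * pin E v / 1) • E))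
      (fderiv ℝ (fderiv ℝ V) (refl x0 e X) (v - (2 * pin E v / 1) • E)
        (v - (2 * pin E v / 1) • E)) := by
    intro v
    have h2 := hasSnd_line_of_contDiffAt h.1 (v - (2 * pin E v / 1) • E)
    convert h2 using 3 with s
    have hp : pin E v = ⟪v.1, e⟫ := by simp [pin, hE, real_inner_comm]
    rw [hp]
    ext1
    · simp only [refl, hE, Prod.fst_add, Prod.smul_fst, Prod.fst_sub, add_sub_right_comm X.1,
        inner_add_left, inner_smul_left, conj_trivial]
      module
    · simp [refl, hE]
  rw [LL_of_hasSnd hC (fun i => hs (eh i)) (hs ev), ← h.2, LL_eq h.1,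
    trace_reflect _ E one_ne_zero hE1]
  simp [refl, hE, pin, ev]

/-- The Kelvin transform with respect to the sphere of radius `√l` centred at the origin. -/
def kel (σ : ℝ) (l : ℝ) (V : Pt n → ℝ) (Y : Pt n) : ℝ :=
  (l / nsq Y) ^ ((n - 2 * σ) / 2) * V ((l / nsq Y) • Y)

theorem hasLL_kel {V : Pt n → ℝ} {l : ℝ} (hl : 0 < l) {X : Pt n} (hX : 0 < X.2)
    (h : HasLL σ V ((l / nsq X) • X) 0) : HasLL σ (kel σ l V) X 0 := by
  have hq : 0 < nsq X := nsq_pos hX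
  have hr : 0 < l / nsq X := div_pos hl hq
  have hR : ContDiffAt ℝ 2 (fun Y : Pt n => l / nsq Y) X :=
    contDiffAt_const.div contDiff_nsq.contDiffAt hq.ne'
  have hC : ContDiffAt ℝ 2 (kel σ l V) X := by
    refine ContDiffAt.mul (hR.rpow_const_of_ne hr.ne') ?_
    exact ContDiffAt.comp X h.1 (hR.smul contDiffAt_id)
  refine ⟨hC, ?_⟩
  set q := nsq X with hqd
  set r := l / q with hrd
  set α : ℝ := (n - 2 * σ) / 2 with hα
  set H := r ^ α with hH
  set D := fderiv ℝ V (r • X) with hD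
  set B := fderiv ℝ (fderiv ℝ V) (r • X) with hB
  have hs : ∀ v : Pt n, HasSnd (fun s : ℝ => kel σ l V (X + s • v))
      (H * (r * (D v - 2 * pin X v / q * D X)) - 2 * α * H * (pin X v / q) * V (r • X))
      (H * r ^ 2 * B (v - (2 * pin X v / q) • X) (v - (2 * pin X v / q) • X) +
        H * r * (-4 * (1 + α) / q * D (pin X v • v) + (8 * (1 + α) * pin X v ^ 2 / q ^ 2 -
          2 * nsq v / q) * D X) +
        α * H * (4 * (α + 1) * pin X v ^ 2 / q ^ 2 - 2 * nsq v / q) * V (r • X)) := by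
    intro v
    have h1 : HasSnd (fun s : ℝ => l / nsq (X + s • v)) (r * (-2 * pin X v / q))
        (r * (8 * pin X v ^ 2 / q ^ 2 - 2 * nsq v / q)) := by
      have := (hasSnd_nsq X v).scomp (P := fun u => l / u) (P' := fun u => - l / u ^ 2)
        (P2 := 2 * l / q ^ 3) ?_ ?_
      · refine this.congr_val ?_ ?_
        · simp only [zero_smul, add_zero, ← hqd, hrd]; field_simp
        · simp only [zero_smul, add_zero, ← hqd, hrd]; field_simp; ring
      · simp only [zero_smul, add_zero, ← hqd]
        filter_upwards [lt_mem_nhds hq] with u hu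
        have := (hasDerivAt_inv hu.ne').const_mul l
        refine (this.congr_deriv ?_).congr_of_eventuallyEq
          (Eventually.of_forall fun w => div_eq_mul_inv _ _)
        field_simp
      · simp only [zero_smul, add_zero, ← hqd]
        have := ((hasDerivAt_pow 2 q).inv (by positivity)).const_mul (-l)
        refine (this.congr_deriv ?_).congr_of_eventuallyEq
          (Eventually.of_forall fun w => div_eq_mul_inv _ _)
        field_simp
        push_cast
        ring
    have h2 : HasSnd (fun s : ℝ => (l / nsq (X + s • v)) ^ α) (-2 * α * H * (pin X v / q))
        (α * H * (4 * (α + 1) * pin X v ^ 2 / q ^ 2 - 2 * nsq v / q)) := by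
      have := h1.scomp (P := fun u => u ^ α) (P' := fun u => α * u ^ (α - 1))
        (P2 := α * ((α - 1) * r ^ (α - 1 - 1))) ?_ ?_
      · simp only [zero_smul, add_zero, ← hqd, ← hrd] at this
        rw [Real.rpow_sub_one hr.ne' (α - 1), Real.rpow_sub_one hr.ne', ← hH] at this
        refine this.congr_val ?_ ?_
        · field_simp
        · field_simp; ring
      · simp only [zero_smul, add_zero, ← hqd, ← hrd]
        filter_upwards [lt_mem_nhds hr] with u hu
        exact Real.hasDerivAt_rpow_const (Or.inl hu.ne')
      · simp only [zero_smul, add_zero, ← hqd, ← hrd]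
        exact (Real.hasDerivAt_rpow_const (Or.inl hr.ne')).const_mul _
    have h3 := h1.smul (hasSnd_line X v)
    simp only [zero_smul, add_zero, smul_zero, zero_add, ← hqd, ← hrd] at h3
    have h4 := h3.comp_contDiffAt (V := V) (by simpa using h.1)
    simp only [zero_smul, add_zero, ← hqd, ← hrd, ← hD, ← hB] at h4
    have h5 := h2.mul h4
    simp only [zero_smul, add_zero, ← hqd, ← hrd, ← hH] at h5
    have e1 : r • v + (r * (-2 * pin X v / q)) • X = r • (v - (2 * pin X v / q) • X) := by
      module
    rw [e1] at h5
    refine h5.congr_val ?_ ?_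
    · simp only [map_smul, map_sub, smul_eq_mul]
      ring
    · simp only [map_smul, map_sub, map_add, smul_apply, sub_apply,
        smul_eq_mul]
      field_simp
      ring
  have t1 := trace_reflect B X hq.ne' rfl
  have t2 : (∑ i, D (pin X (eh i) • eh i)) + D (pin X ev • ev) = D X := by
    have := congrArg D (sum_eh X)
    simpa using this
  have t3 : (∑ i, pin X (eh i) ^ 2) + pin X ev ^ 2 = q := by
    simp only [pin_eh, pin_ev, sum_sq]
    rfl
  have t4 : (∑ i : Fin n, nsq (eh i : Pt n)) = n := by simp
  have t5 := h.2
  rw [LL_eq h.1, ← hD, ← hB] at t5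
  rw [LL_of_hasSnd hC (fun i => hs (eh i)) (hs ev)]
  simp only [Finset.sum_add_distrib, ← Finset.mul_sum, ← Finset.sum_mul, sub_mul, mul_sub,
    Finset.sum_sub_distrib, ← Finset.sum_div] at *
  rw [eq_sub_of_add_eq t1, eq_sub_of_add_eq t2, eq_sub_of_add_eq t3, t4]
  simp only [Prod.smul_snd, smul_eq_mul] at t5
  rw [nsq_ev, pin_ev]
  have t6 : (∑ i, B (eh i) (eh i)) + B ev ev = - ((1 - 2 * σ) / (r * X.2) * D ev) := by
    linarith [t5]
  rw [t6, hα]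
  simp only [map_smul, smul_eq_mul]
  field_simp
  ring

theorem hasLL_fund {X : Pt n} (hX : 0 < X.2) :
    HasLL σ (fun Y => (nsq Y) ^ (-((n - 2 * σ) / 2))) X 0 := by
  have hq : 0 < nsq X := nsq_pos hX
  set α : ℝ := -((n - 2 * σ) / 2) with hα
  have h := hasLL_comp_qd (σ := σ) (fun u : ℝ => u ^ α) (fun u => α * u ^ (α - 1))
    (α * ((α - 1) * nsq X ^ (α - 1 - 1))) 0 X
  simp only [sub_zero] at h
  refine (h (Real.contDiffAt_rpow_const_of_ne hq.ne') ?_ ?_).congr_val ?_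
  · filter_upwards [lt_mem_nhds hq] with u hu
    exact Real.hasDerivAt_rpow_const (Or.inl hu.ne')
  · exact (Real.hasDerivAt_rpow_const (Or.inl hq.ne')).const_mul _
  · rw [Real.rpow_sub_one hq.ne' (α - 1)]
    simp only [Prod.snd_zero, sub_zero]
    rw [hα]
    field_simp
    ring

end transform

/-! ### Maximum principles -/

/-- The weighted Neumann condition `-lim (V(x,t) - V(x,0)) / t^{2σ} = g` on the flat boundary. -/
def Flux {n : ℕ} (σ : ℝ) (V : Pt n → ℝ) (x : EuclideanSpace ℝ (Fin n)) (g : ℝ) : Prop :=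
  Tendsto (fun t : ℝ => (V (x, t) - V (x, 0)) / t ^ (2 * σ)) (𝓝[>] 0) (𝓝 (-g))

/-- The closed upper half-space. -/
def HS (n : ℕ) : Set (Pt n) := {X | 0 ≤ X.2}

section

variable {n : ℕ} {σ : ℝ}

theorem isClosed_HS : IsClosed (HS n) := isClosed_le continuous_const continuous_snd

namespace Flux

variable {V W : Pt n → ℝ} {x : EuclideanSpace ℝ (Fin n)} {g h : ℝ}

theorem congr_val (hV : Flux σ V x g) (hgh : g = h) : Flux σ V x h := hgh ▸ hV

theorem add (hV : Flux σ V x g) (hW : Flux σ W x h) :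
    Flux σ (fun Y => V Y + W Y) x (g + h) := by
  unfold Flux at *
  have := Tendsto.add hV hW
  rw [neg_add]
  refine this.congr fun t => ?_
  ring

theorem const_mul (c : ℝ) (hV : Flux σ V x g) : Flux σ (fun Y => c * V Y) x (c * g) := by
  unfold Flux at *
  have := Tendsto.const_mul c hV
  rw [← mul_neg]
  refine this.congr fun t => ?_
  ring

theorem neg (hV : Flux σ V x g) : Flux σ (fun Y => - V Y) x (-g) := by
  simpa using hV.const_mul (-1)

theorem sub (hV : Flux σ V x g) (hW : Flux σ W x h) :
    Flux σ (fun Y => V Y - W Y) x (g - h) := by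
  simpa [sub_eq_add_neg] using hV.add hW.neg

end Flux

theorem flux_const (c : ℝ) (x : EuclideanSpace ℝ (Fin n)) : Flux σ (fun _ => c) x 0 := by
  simp [Flux]

theorem flux_of_fst (F : EuclideanSpace ℝ (Fin n) → ℝ) (x : EuclideanSpace ℝ (Fin n)) :
    Flux σ (fun Y => F Y.1) x 0 := by
  simp [Flux]

theorem flux_rpow (hσ : σ ≠ 0) (x : EuclideanSpace ℝ (Fin n)) :
    Flux σ (fun Y => Y.2 ^ (2 * σ)) x (-1) := by
  unfold Flux
  rw [neg_neg]
  refine tendsto_const_nhds.congr' ?_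
  filter_upwards [self_mem_nhdsWithin] with t ht
  have ht : (0 : ℝ) < t := ht
  have : t ^ (2 * σ) ≠ 0 := (Real.rpow_pos_of_pos ht _).ne'
  rw [Real.zero_rpow (by simpa using hσ), sub_zero, div_self this]

theorem flux_of_sq (hσ1 : σ < 1) {V : Pt n → ℝ} {x : EuclideanSpace ℝ (Fin n)} {F : ℝ → ℝ} {b : ℝ}
    (hF : HasDerivAt F b 0) (h : ∀ᶠ t in 𝓝[>] (0 : ℝ), V (x, t) = F (t ^ 2))
    (h0 : V (x, 0) = F 0) : Flux σ V x 0 := by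
  unfold Flux
  have h1 : Tendsto (fun t : ℝ => t ^ 2) (𝓝[>] 0) (𝓝[≠] 0) := by
    refine tendsto_nhdsWithin_iff.2 ⟨?_, ?_⟩
    · have : Tendsto (fun t : ℝ => t ^ 2) (𝓝 0) (𝓝 (0 ^ 2)) := (continuous_pow 2).tendsto 0
      simpa using this.mono_left nhdsWithin_le_nhds
    · filter_upwards [self_mem_nhdsWithin] with t ht
      exact pow_ne_zero 2 (ne_of_gt ht)
  have h2 := (hasDerivAt_iff_tendsto_slope.1 hF).comp h1
  have h3 : Tendsto (fun t : ℝ => t ^ (2 - 2 * σ)) (𝓝[>] 0) (𝓝 0) := by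
    have : Tendsto (fun t : ℝ => t ^ (2 - 2 * σ)) (𝓝 0) (𝓝 (0 ^ (2 - 2 * σ))) :=
      (Real.continuousAt_rpow_const 0 _ (Or.inr (by linarith))).tendsto
    rw [Real.zero_rpow (by linarith)] at this
    exact this.mono_left nhdsWithin_le_nhds
  have h4 := h2.mul h3
  rw [mul_zero] at h4
  rw [neg_zero]
  refine h4.congr' ?_
  filter_upwards [self_mem_nhdsWithin, h] with t ht hV
  have ht : (0 : ℝ) < t := ht
  rw [hV, h0]
  simp only [Function.comp_apply, slope_def_field, sub_zero]
  rw [Real.rpow_sub ht, Real.rpow_two]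
  field_simp

theorem flux_sq (hσ1 : σ < 1) (x : EuclideanSpace ℝ (Fin n)) :
    Flux σ (fun Y => Y.2 ^ 2) x 0 :=
  flux_of_sq hσ1 (F := fun u => u) (hasDerivAt_id 0) (Eventually.of_forall fun t => rfl) (by simp)

theorem flux_lt {z : Pt n → ℝ} {x : EuclideanSpace ℝ (Fin n)} {g : ℝ} (h : Flux σ z x g)
    (hg : 0 < g) : ∀ᶠ t in 𝓝[>] (0 : ℝ), z (x, t) < z (x, 0) := by
  have := h.eventually (gt_mem_nhds (show -g < 0 by linarith))
  filter_upwards [this, self_mem_nhdsWithin] with t ht ht0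
  have h1 : (0 : ℝ) < t ^ (2 * σ) := Real.rpow_pos_of_pos ht0 _
  rcases div_neg_iff.1 ht with h2 | h2 <;> linarith [h2.1, h2.2]

theorem HasSnd.nonneg_of_isLocalMin {f : ℝ → ℝ} {a b : ℝ} (h : HasSnd f a b)
    (hm : IsLocalMin f 0) : a = 0 ∧ 0 ≤ b := by
  have h' := h
  obtain ⟨u, hu, rfl, hb⟩ := h'
  have h0 : u 0 = 0 := hm.hasDerivAt_eq_zero hu.self_of_nhds
  refine ⟨h0, ?_⟩
  by_contra! hneg
  have hd : deriv f =ᶠ[𝓝 0] u := by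
    filter_upwards [hu] with s hs using hs.deriv
  have hM : IsLocalMax f 0 := by
    refine isLocalMax_of_deriv_deriv_neg ?_ ?_ hu.self_of_nhds.continuousAt
    · rw [hd.deriv_eq, hb.deriv]; exact hneg
    · rw [hd.self_of_nhds, h0]
  have hc : f =ᶠ[𝓝 0] fun _ => f 0 := by
    filter_upwards [hm, hM] with s h1 h2 using le_antisymm h2 h1
  have hc' : deriv f =ᶠ[𝓝 0] fun _ => 0 := by
    have := hc.deriv
    simpa using this
  have := (hb.congr_of_eventuallyEq hd).unique
    ((hasDerivAt_const (0 : ℝ) (0 : ℝ)).congr_of_eventuallyEq hc')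
  linarith

theorem LL_nonneg_of_isLocalMin {z : Pt n → ℝ} {X : Pt n} {c : ℝ} (h : HasLL σ z X c)
    (hm : IsLocalMin z X) : 0 ≤ c := by
  have key : ∀ v : Pt n, fderiv ℝ z X v = 0 ∧ 0 ≤ fderiv ℝ (fderiv ℝ z) X v v := by
    intro v
    refine (hasSnd_line_of_contDiffAt h.1 v).nonneg_of_isLocalMin ?_
    have hc : Tendsto (fun s : ℝ => X + s • v) (𝓝 0) (𝓝 X) := by
      have : Continuous fun s : ℝ => X + s • v := by fun_prop
      simpa using this.tendsto 0
    have := hc.eventually hm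
    filter_upwards [this] with s hs
    simpa using hs
  rw [← h.2, LL_eq h.1, (key ev).1, mul_zero, add_zero]
  exact add_nonneg (Finset.sum_nonneg fun i _ => (key _).2) (key _).2

/-- Minimum principle relative to a positive supersolution `φ`. -/
theorem robin_min_principle {S : Set (Pt n)} (hS : IsCompact S) {w φ : Pt n → ℝ}
    (hw : ContinuousOn w S) (hφ : ContinuousOn φ S) (hpos : ∀ X ∈ S, 0 < φ X)
    (H : ∀ X ∈ S, w X < 0 → S ∈ 𝓝[HS n] X ∧
      ((0 < X.2 ∧ ∃ a b, HasLL σ w X a ∧ HasLL σ φ X b ∧ a ≤ 0 ∧ b < 0) ∨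
      (X.2 = 0 ∧ ∃ a b, Flux σ w X.1 a ∧ Flux σ φ X.1 b ∧ 0 < a + (-w X / φ X) * b))) :
    ∀ X ∈ S, 0 ≤ w X := by
  by_contra! hcon
  obtain ⟨X0, hX0, hX0w⟩ := hcon
  obtain ⟨X, hX, hmin⟩ := hS.exists_isMinOn ⟨X0, hX0⟩
    (hw.div hφ fun X hX => (hpos X hX).ne')
  have hmin' : ∀ Y ∈ S, w X / φ X ≤ w Y / φ Y := fun Y hY => hmin hY
  have hXneg : w X / φ X < 0 :=
    lt_of_le_of_lt (hmin' X0 hX0) (div_neg_of_neg_of_pos hX0w (hpos _ hX0))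
  have hwX : w X < 0 := by
    by_contra! h
    exact absurd (div_nonneg h (hpos X hX).le) (not_le.2 hXneg)
  set μ := -w X / φ X with hμ
  have hμ0 : 0 < μ := div_pos (by linarith) (hpos X hX)
  have hz : ∀ Y ∈ S, w X + μ * φ X ≤ w Y + μ * φ Y := by
    intro Y hY
    have h1 : w X + μ * φ X = 0 := by
      rw [hμ]; field_simp [(hpos X hX).ne']; ring
    rw [h1]
    have h2 := hmin' Y hY
    have h3 : -μ ≤ w Y / φ Y := by
      rw [hμ, neg_div, neg_neg]; exact h2
    have := (le_div_iff₀ (hpos Y hY)).1 h3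
    linarith
  obtain ⟨hnh, h | h⟩ := H X hX hwX
  · obtain ⟨ht, a, b, ha, hb, ha0, hb0⟩ := h
    have hS' : S ∈ 𝓝 X := by
      rwa [nhdsWithin_eq_nhds.2] at hnh
      exact mem_of_superset ((isOpen_lt continuous_const continuous_snd).mem_nhds ht)
        fun Y (hY : 0 < Y.2) => hY.le
    have := LL_nonneg_of_isLocalMin (ha.add (hb.const_mul μ)) (by
      filter_upwards [hS'] with Y hY using hz Y hY)
    nlinarith
  · obtain ⟨ht, a, b, ha, hb, hab⟩ := h
    have hXe : X = (X.1, 0) := by rw [← ht]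
    have h1 := flux_lt (ha.add (hb.const_mul μ)) hab
    have h2 : ∀ᶠ s in 𝓝[>] (0 : ℝ), ((X.1, s) : Pt n) ∈ S := by
      have hc : Tendsto (fun s : ℝ => ((X.1, s) : Pt n)) (𝓝[>] 0) (𝓝[HS n] X) := by
        refine tendsto_nhdsWithin_iff.2 ⟨?_, ?_⟩
        · have : Continuous fun s : ℝ => ((X.1, s) : Pt n) := by fun_prop
          have := this.tendsto 0
          rw [← hXe] at this
          exact this.mono_left nhdsWithin_le_nhds
        · filter_upwards [self_mem_nhdsWithin] with s hs
          exact le_of_lt (Set.mem_Ioi.1 hs)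
      exact hc.eventually hnh
    obtain ⟨s, hs1, hs2⟩ := (h1.and h2).exists
    have := hz _ hs2
    rw [← hXe] at hs1
    linarith

theorem norm_sq_barrier_hasLL (C : ℝ) {X : Pt n} (hX : 0 < X.2) :
    HasLL σ (fun Y => C - Y.2 ^ (2 * σ) - ‖Y.1‖ ^ 2) X (-(2 * n)) := by
  have := ((hasLL_const (σ := σ) C X).sub (hasLL_rpow_snd hX)).sub (hasLL_qd_flat 0 hX)
  simpa using this

/-- Weak minimum principle. -/
theorem weak_min_principle (hn : 0 < n) (hσ : σ ∈ Set.Ioo (0 : ℝ) 1) {S : Set (Pt n)}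
    (hS : IsCompact S) {w : Pt n → ℝ} (hw : ContinuousOn w S)
    (H : ∀ X ∈ S, w X < 0 → S ∈ 𝓝[HS n] X ∧
      ((0 < X.2 ∧ ∃ a, HasLL σ w X a ∧ a ≤ 0) ∨ (X.2 = 0 ∧ ∃ a, Flux σ w X.1 a ∧ 0 ≤ a))) :
    ∀ X ∈ S, 0 ≤ w X := by
  have hcont : ContinuousOn (fun Y : Pt n => Y.2 ^ (2 * σ) + ‖Y.1‖ ^ 2) S := by
    have : Continuous fun Y : Pt n => Y.2 ^ (2 * σ) + ‖Y.1‖ ^ 2 := by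
      refine Continuous.add ?_ (by fun_prop)
      exact continuous_snd.rpow_const fun _ => Or.inr (by linarith [hσ.1])
    exact this.continuousOn
  obtain ⟨C, hC⟩ := (hS.image_of_continuousOn hcont).bddAbove
  have hC' : ∀ X ∈ S, X.2 ^ (2 * σ) + ‖X.1‖ ^ 2 ≤ C := fun X hX => hC ⟨X, hX, rfl⟩
  have hpos : ∀ X ∈ S, 0 < (C + 1) - X.2 ^ (2 * σ) - ‖X.1‖ ^ 2 := fun X hX => by
    linarith [hC' X hX]
  refine robin_min_principle (σ := σ) (φ := fun X => (C + 1) - X.2 ^ (2 * σ) - ‖X.1‖ ^ 2) hS hw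
    ?_ hpos ?_
  · have := (continuousOn_const (c := C + 1)).sub hcont
    refine this.congr fun X _ => ?_
    simp only [Pi.sub_apply]
    ring
  · intro X hX hwX
    obtain ⟨h1, h2⟩ := H X hX hwX
    refine ⟨h1, ?_⟩
    rcases h2 with ⟨ht, a, ha, ha0⟩ | ⟨ht, a, ha, ha0⟩
    · refine Or.inl ⟨ht, a, _, ha, norm_sq_barrier_hasLL _ ht, ha0, ?_⟩
      have : (0 : ℝ) < n := by exact_mod_cast hn
      linarith
    · refine Or.inr ⟨ht, a, 1, ha, ?_, ?_⟩
      · have := ((flux_const (σ := σ) (C + 1) X.1).sub (flux_rpow hσ.1.ne' X.1)).sub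
          (flux_of_fst (fun y => ‖y‖ ^ 2) X.1)
        simpa using this
      · rw [mul_one]
        exact add_pos_of_nonneg_of_pos ha0 (div_pos (by linarith) (hpos X hX))

theorem exists_barrier_const (hσ : σ ∈ Set.Ioo (0 : ℝ) 1) {B : ℝ} (hB : 0 < B) :
    ∃ D : ℝ, 0 < D ∧ ∀ t : ℝ, 0 ≤ t → 1 / 2 ≤ 1 - B * t ^ (2 * σ) + D * t ^ 2 := by
  have hs : 0 < 2 * σ := by linarith [hσ.1]
  set t0 : ℝ := (1 / (2 * B)) ^ (1 / (2 * σ)) with ht0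
  have ht0p : 0 < t0 := by positivity
  have h1 : t0 ^ (2 * σ) = 1 / (2 * B) := by
    rw [ht0, ← Real.rpow_mul (by positivity), one_div_mul_cancel hs.ne', Real.rpow_one]
  refine ⟨B * t0 ^ (2 * σ) / t0 ^ 2, by positivity, fun t ht => ?_⟩
  rcases le_total t t0 with h | h
  · have h2 : t ^ (2 * σ) ≤ 1 / (2 * B) := h1 ▸ Real.rpow_le_rpow ht h hs.le
    have h3 : B * t ^ (2 * σ) ≤ 1 / 2 := by
      calc B * t ^ (2 * σ) ≤ B * (1 / (2 * B)) := by gcongr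
        _ = 1 / 2 := by field_simp
    have : 0 ≤ B * t0 ^ (2 * σ) / t0 ^ 2 * t ^ 2 := by positivity
    linarith
  · have hr : 1 ≤ t / t0 := (one_le_div ht0p).2 h
    have h2 : (t / t0) ^ (2 * σ) ≤ (t / t0) ^ 2 := by
      rw [← Real.rpow_two]
      exact Real.rpow_le_rpow_of_exponent_le hr (by linarith [hσ.2])
    rw [Real.div_rpow ht ht0p.le, div_pow] at h2
    have h3 : t ^ (2 * σ) ≤ t0 ^ (2 * σ) / t0 ^ 2 * t ^ 2 := by
      rw [div_le_iff₀ (by positivity)] at h2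
      calc _ ≤ _ := h2
        _ = _ := by ring
    have h4 : B * t ^ (2 * σ) ≤ B * (t0 ^ (2 * σ) / t0 ^ 2 * t ^ 2) := by gcongr
    have h5 : B * (t0 ^ (2 * σ) / t0 ^ 2 * t ^ 2) = B * t0 ^ (2 * σ) / t0 ^ 2 * t ^ 2 := by ring
    linarith

theorem mem_nhdsWithin_HS {S : Set (Pt n)} {X : Pt n} {O : Set (Pt n)} (hO : IsOpen O) (hX : X ∈ O)
    (h : ∀ Y ∈ O, 0 ≤ Y.2 → Y ∈ S) : S ∈ 𝓝[HS n] X := by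
  filter_upwards [self_mem_nhdsWithin, mem_nhdsWithin_of_mem_nhds (hO.mem_nhds hX)] with Y h1 h2
  exact h Y h2 h1

end

/-! ### Nonnegative solutions with prescribed Neumann data -/

section

variable {n : ℕ} {σ : ℝ}

theorem enorm'_eq_norm (X : Pt n) : enorm' X = ‖WithLp.toLp 2 X‖ := by
  rw [WithLp.prod_norm_eq_of_L2]
  simp [enorm']

theorem enorm'_nonneg (X : Pt n) : 0 ≤ enorm' X := Real.sqrt_nonneg _

theorem sq_enorm' (X : Pt n) : enorm' X ^ 2 = nsq X := Real.sq_sqrt (nsq_nonneg X)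

theorem nsq_le_sq_iff {X : Pt n} {r : ℝ} (hr : 0 ≤ r) : nsq X ≤ r ^ 2 ↔ enorm' X ≤ r := by
  rw [← sq_enorm', sq_le_sq₀ (enorm'_nonneg X) hr]

theorem nsq_lt_sq_iff {X : Pt n} {r : ℝ} (hr : 0 ≤ r) : nsq X < r ^ 2 ↔ enorm' X < r := by
  rw [← sq_enorm', sq_lt_sq₀ (enorm'_nonneg X) hr]

theorem enorm'_add_le (X Y : Pt n) : enorm' (X + Y) ≤ enorm' X + enorm' Y := by
  simp only [enorm'_eq_norm, WithLp.toLp_add]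
  exact norm_add_le _ _

theorem enorm'_flat (x : EuclideanSpace ℝ (Fin n)) : enorm' (x, 0) = ‖x‖ := by
  simp [enorm']

theorem enorm'_smul {c : ℝ} (hc : 0 ≤ c) (X : Pt n) : enorm' (c • X) = c * enorm' X := by
  simp only [enorm'_eq_norm, WithLp.toLp_smul, norm_smul, Real.norm_eq_abs, abs_of_nonneg hc]

theorem continuous_enorm' : Continuous (enorm' : Pt n → ℝ) :=
  Real.continuous_sqrt.comp continuous_nsq

/-- The closed half-ball of radius `r`. -/
def HB (n : ℕ) (r : ℝ) : Set (Pt n) := {X | nsq X ≤ r ^ 2 ∧ 0 ≤ X.2}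

theorem isClosed_HB (r : ℝ) : IsClosed (HB n r) :=
  (isClosed_le continuous_nsq continuous_const).inter isClosed_HS

theorem HB_mono {r s : ℝ} (hr : 0 ≤ r) (h : r ≤ s) : HB n r ⊆ HB n s := fun _ hX =>
  ⟨hX.1.trans (by gcongr), hX.2⟩

theorem isCompact_HB (r : ℝ) : IsCompact (HB n r) := by
  refine Metric.isCompact_of_isClosed_isBounded (isClosed_HB r) ?_
  refine (Metric.isBounded_closedBall (x := (0 : Pt n)) (r := |r|)).subset fun X hX => ?_
  rw [mem_closedBall_zero_iff, Prod.norm_def, sup_le_iff, Real.norm_eq_abs]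
  have h1 := hX.1
  constructor
  · exact abs_le_of_sq_le_sq' (by nlinarith [norm_sq_le_nsq X, sq_abs r]) (abs_nonneg r) |>.2
  · exact sq_le_sq.1 ((sq_le_nsq X).trans hX.1)

/-- `V` is a nonnegative solution on the half-ball of radius `r` with Neumann data `g`. -/
structure Sol (σ r : ℝ) (g : EuclideanSpace ℝ (Fin n) → ℝ) (V : Pt n → ℝ) : Prop where
  nonneg : ∀ X ∈ HB n r, 0 ≤ V X
  cont : ContinuousOn V (HB n r)
  eqn : ∀ X : Pt n, nsq X < r ^ 2 → 0 < X.2 → HasLL σ V X 0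
  flux : ∀ x : EuclideanSpace ℝ (Fin n), ‖x‖ < r → Flux σ V x (g x)

theorem Flux.affine {V : Pt n → ℝ} {c : ℝ} (hc : 0 < c) {x0 x : EuclideanSpace ℝ (Fin n)} {g : ℝ}
    (h : Flux σ V (c • x + x0) g) :
    Flux σ (fun Y => V (c • Y + (x0, 0))) x (c ^ (2 * σ) * g) := by
  unfold Flux at *
  have h1 : Tendsto (fun t : ℝ => c * t) (𝓝[>] 0) (𝓝[>] 0) := by
    refine tendsto_nhdsWithin_iff.2 ⟨?_, ?_⟩
    · have : Tendsto (fun t : ℝ => c * t) (𝓝 0) (𝓝 (c * 0)) := (continuous_const_mul c).tendsto 0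
      rw [mul_zero] at this
      exact this.mono_left nhdsWithin_le_nhds
    · filter_upwards [self_mem_nhdsWithin] with t ht
      exact mul_pos hc ht
  have h2 := (h.comp h1).const_mul (c ^ (2 * σ))
  rw [mul_neg] at h2
  refine h2.congr' ?_
  filter_upwards [self_mem_nhdsWithin] with t ht
  have ht : (0 : ℝ) < t := ht
  have := (Real.rpow_pos_of_pos hc (2 * σ)).ne'
  simp only [Function.comp_apply, Real.mul_rpow hc.le ht.le, Prod.smul_mk, Prod.mk_add_mk, smul_eq_mul,
    add_zero, mul_zero]
  field_simp

theorem nsq_affine_le {c r r' : ℝ} (hc : 0 < c) (hr' : 0 ≤ r') {x0 : EuclideanSpace ℝ (Fin n)}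
    (h : ‖x0‖ + c * r' ≤ r) {X : Pt n} (hX : nsq X ≤ r' ^ 2) :
    nsq (c • X + (x0, 0)) ≤ r ^ 2 := by
  have hr : 0 ≤ r := le_trans (by positivity) h
  rw [nsq_le_sq_iff hr]
  rw [nsq_le_sq_iff hr'] at hX
  have h1 := enorm'_add_le (c • X) (x0, 0)
  rw [enorm'_smul hc.le, enorm'_flat] at h1
  nlinarith

theorem nsq_affine_lt {c r r' : ℝ} (hc : 0 < c) (hr' : 0 ≤ r') {x0 : EuclideanSpace ℝ (Fin n)}
    (h : ‖x0‖ + c * r' ≤ r) {X : Pt n} (hX : nsq X < r' ^ 2) :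
    nsq (c • X + (x0, 0)) < r ^ 2 := by
  have hr : 0 ≤ r := le_trans (by positivity) h
  rw [nsq_lt_sq_iff hr]
  rw [nsq_lt_sq_iff hr'] at hX
  have h1 := enorm'_add_le (c • X) (x0, 0)
  rw [enorm'_smul hc.le, enorm'_flat] at h1
  nlinarith

theorem Sol.affine {r r' c : ℝ} {g : EuclideanSpace ℝ (Fin n) → ℝ} {V : Pt n → ℝ}
    (hV : Sol σ r g V) (hc : 0 < c) (hr' : 0 ≤ r') {x0 : EuclideanSpace ℝ (Fin n)}
    (h : ‖x0‖ + c * r' ≤ r) :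
    Sol σ r' (fun x => c ^ (2 * σ) * g (c • x + x0)) (fun Y => V (c • Y + (x0, 0))) := by
  have hmaps : ∀ X ∈ HB n r', c • X + (x0, 0) ∈ HB n r := fun X hX =>
    ⟨nsq_affine_le hc hr' h hX.1, by simpa using mul_nonneg hc.le hX.2⟩
  refine ⟨fun X hX => hV.nonneg _ (hmaps X hX), ?_, fun X hX ht => ?_, fun x hx => ?_⟩
  · refine hV.cont.comp (Continuous.continuousOn ?_) hmaps
    fun_prop
  · refine (hasLL_affine hc.ne' x0 (hV.eqn _ (nsq_affine_lt hc hr' h hX) ?_)).congr_val (mul_zero _)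
    simpa using mul_pos hc ht
  · refine Flux.affine hc (hV.flux _ ?_)
    calc ‖c • x + x0‖ ≤ ‖c • x‖ + ‖x0‖ := norm_add_le _ _
      _ = c * ‖x‖ + ‖x0‖ := by rw [norm_smul, Real.norm_eq_abs, abs_of_pos hc]
      _ < r := by nlinarith

theorem Sol.mono {r r' : ℝ} {g : EuclideanSpace ℝ (Fin n) → ℝ} {V : Pt n → ℝ}
    (hV : Sol σ r g V) (hr' : 0 ≤ r') (h : r' ≤ r) : Sol σ r' g V := by
  refine ⟨fun X hX => hV.nonneg X (HB_mono hr' h hX), hV.cont.mono (HB_mono hr' h),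
    fun X hX ht => hV.eqn X (hX.trans_le (by gcongr)) ht, fun x hx => hV.flux x (hx.trans_le h)⟩

/-- Curvature constant of the cylinder barrier. -/
def cylD (n : ℕ) (σ : ℝ) : ℝ := n / (1 - σ)

/-- Neumann constant of the cylinder barrier. -/
def cylB (n : ℕ) (σ : ℝ) : ℝ := 1 + cylD n σ

theorem cylD_nonneg (hσ : σ ∈ Set.Ioo (0 : ℝ) 1) : 0 ≤ cylD n σ :=
  div_nonneg (Nat.cast_nonneg n) (by linarith [hσ.2])

theorem cylB_pos (hσ : σ ∈ Set.Ioo (0 : ℝ) 1) : 0 < cylB n σ := by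
  have := cylD_nonneg (n := n) hσ
  unfold cylB; linarith

/-- Comparison with the barrier `1 - B t^{2σ} + D t² - 2 |x|²` on the unit cylinder. -/
theorem Sol.cylinder_lower_bound (hn : 0 < n) (hσ : σ ∈ Set.Ioo (0 : ℝ) 1)
    {g : EuclideanSpace ℝ (Fin n) → ℝ} {V : Pt n → ℝ} (hV : Sol σ 2 g V) {K : ℝ} (hK : 0 ≤ K)
    (H : ∀ x : EuclideanSpace ℝ (Fin n), ‖x‖ < 1 → V (x, 0) < K * (1 - 2 * ‖x‖ ^ 2) →
      K * cylB n σ ≤ g x) {X : Pt n} (hX1 : ‖X.1‖ ≤ 1) (hX2 : 0 ≤ X.2) (hX3 : X.2 ≤ 1) :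
    K * (1 - cylB n σ * X.2 ^ (2 * σ) + cylD n σ * X.2 ^ 2 - 2 * ‖X.1‖ ^ 2) ≤ V X := by
  set B := cylB n σ with hB
  set D := cylD n σ with hD
  have hD0 : 0 ≤ D := cylD_nonneg hσ
  have hBD : B = 1 + D := rfl
  set S : Set (Pt n) := {X | ‖X.1‖ ≤ 1 ∧ 0 ≤ X.2 ∧ X.2 ≤ 1} with hSdef
  have hS2 : S ⊆ HB n 2 := by
    rintro X ⟨h1, h2, h3⟩
    refine ⟨?_, h2⟩
    unfold nsq
    nlinarith [norm_nonneg X.1]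
  have hSc : IsCompact S := by
    refine (isCompact_HB 2).of_isClosed_subset ?_ hS2
    exact (isClosed_le continuous_fst.norm continuous_const).inter
      ((isClosed_le continuous_const continuous_snd).inter
        (isClosed_le continuous_snd continuous_const))
  set ψ : Pt n → ℝ := fun X => 1 - B * X.2 ^ (2 * σ) + D * X.2 ^ 2 - 2 * ‖X.1‖ ^ 2 with hψ
  have hψc : Continuous ψ := by
    have : Continuous fun X : Pt n => X.2 ^ (2 * σ) :=
      continuous_snd.rpow_const fun _ => Or.inr (by linarith [hσ.1])
    fun_prop
  have key := weak_min_principle (w := fun X => V X - K * ψ X) hn hσ hSc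
    ((hV.cont.mono hS2).sub (hψc.const_smul K).continuousOn) ?_ X ⟨hX1, hX2, hX3⟩
  · linarith [key]
  · rintro X hX hneg
    obtain ⟨h1, h2, h3⟩ := hX
    have hVX := hV.nonneg X (hS2 ⟨h1, h2, h3⟩)
    have hψX : 0 < ψ X := by
      by_contra! hle
      have := mul_nonpos_of_nonneg_of_nonpos hK hle
      nlinarith
    have hpow : X.2 ^ 2 ≤ X.2 ^ (2 * σ) := by
      rw [← Real.rpow_two]
      exact Real.rpow_le_rpow_of_exponent_ge' h2 h3 (by linarith [hσ.1]) (by linarith [hσ.2])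
    have hDB : D * X.2 ^ 2 ≤ B * X.2 ^ (2 * σ) := by
      have : 0 ≤ X.2 ^ (2 * σ) := Real.rpow_nonneg h2 _
      nlinarith
    simp only [hψ] at hψX
    have h1' : ‖X.1‖ < 1 := by
      refine lt_of_le_of_ne h1 fun h => ?_
      rw [h] at hψX
      linarith
    have h3' : X.2 < 1 := by
      refine lt_of_le_of_ne h3 fun h => ?_
      rw [h, Real.one_rpow] at hψX
      nlinarith [sq_nonneg ‖X.1‖]
    refine ⟨mem_nhdsWithin_HS (O := {Y | ‖Y.1‖ < 1 ∧ Y.2 < 1}) ?_ ⟨h1', h3'⟩ ?_, ?_⟩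
    · exact (isOpen_lt continuous_fst.norm continuous_const).inter
        (isOpen_lt continuous_snd continuous_const)
    · rintro Y ⟨hY1, hY2⟩ hY3
      exact ⟨hY1.le, hY3, hY2.le⟩
    · rcases h2.eq_or_lt with h | h
      · refine Or.inr ⟨h.symm, _, (hV.flux X.1 (by linarith)).sub
          (((((flux_const 1 X.1).sub ((flux_rpow hσ.1.ne' X.1).const_mul B)).add
          ((flux_sq hσ.2 X.1).const_mul D)).sub
          ((flux_of_fst (fun y => ‖y‖ ^ 2) X.1).const_mul 2)).const_mul K), ?_⟩
        have hXe : X = (X.1, 0) := by rw [h]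
        have := H X.1 h1' (by
          rw [← hXe]
          simp only [hψ, ← h] at hneg
          rw [Real.zero_rpow (by linarith [hσ.1])] at hneg
          nlinarith)
        linarith
      · refine Or.inl ⟨h, _, (hV.eqn X ?_ h).sub
          (((((hasLL_const 1 X).sub ((hasLL_rpow_snd h).const_mul B)).add
          ((hasLL_sq_snd h).const_mul D)).sub
          ((hasLL_qd_flat 0 h).const_mul 2)).const_mul K |>.congr ?_), ?_⟩
        · have := norm_nonneg X.1
          unfold nsq
          nlinarith
        · exact Eventually.of_forall fun Y => by simp [hψ]
        · have : D * (4 - 4 * σ) = 4 * n := by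
            rw [hD, cylD]
            have : 1 - σ ≠ 0 := by linarith [hσ.2]
            field_simp
          rw [this]
          nlinarith

theorem exists_half_ball_lower_bound (hn : 0 < n) (hσ : σ ∈ Set.Ioo (0 : ℝ) 1) :
    ∃ ε : ℝ, 0 < ε ∧ ε ≤ 1 ∧ ∀ (r : ℝ) (g : EuclideanSpace ℝ (Fin n) → ℝ) (V : Pt n → ℝ),
      Sol σ r g V → ∀ (x0 : EuclideanSpace ℝ (Fin n)) (ρ m : ℝ), 0 < ρ → 0 ≤ m →
      ‖x0‖ + 2 * ρ ≤ r → (∀ x, ‖x - x0‖ ≤ ρ → m ≤ V (x, 0)) →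
      ∀ Y : Pt n, nsq Y ≤ (ε * ρ) ^ 2 → 0 ≤ Y.2 → m / 4 ≤ V (Y + (x0, 0)) := by
  set B := cylB n σ with hB
  have hB0 : 0 < B := cylB_pos hσ
  have hs : 0 < 2 * σ := by linarith [hσ.1]
  set ε : ℝ := min (1 / 4) ((1 / (2 * B)) ^ (1 / (2 * σ))) with hε
  have hε0 : 0 < ε := by positivity
  have hε1 : ε ≤ 1 / 4 := min_le_left _ _
  have hε2 : B * ε ^ (2 * σ) ≤ 1 / 2 := by
    have : ε ^ (2 * σ) ≤ ((1 / (2 * B)) ^ (1 / (2 * σ))) ^ (2 * σ) :=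
      Real.rpow_le_rpow hε0.le (min_le_right _ _) hs.le
    rw [← Real.rpow_mul (by positivity), one_div_mul_cancel hs.ne', Real.rpow_one] at this
    calc B * ε ^ (2 * σ) ≤ B * (1 / (2 * B)) := by gcongr
      _ = 1 / 2 := by field_simp
  refine ⟨ε, hε0, by linarith, fun r g V hV x0 ρ m hρ hm hr hVm Y hY hY2 => ?_⟩
  have hW := hV.affine hρ (r' := 2) zero_le_two (x0 := x0) (by linarith)
  set Z : Pt n := ρ⁻¹ • Y with hZ
  have hZn : nsq Z ≤ ε ^ 2 := by
    rw [hZ, nsq_smul]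
    calc ρ⁻¹ ^ 2 * nsq Y ≤ ρ⁻¹ ^ 2 * (ε * ρ) ^ 2 := by gcongr
      _ = ε ^ 2 := by field_simp
  have hZ2 : 0 ≤ Z.2 := by simpa [hZ] using mul_nonneg (inv_nonneg.2 hρ.le) hY2
  have hZ2' : Z.2 ≤ ε := abs_le_of_sq_le_sq' ((sq_le_nsq Z).trans hZn) hε0.le |>.2
  have hZ1' : ‖Z.1‖ ≤ ε := abs_le_of_sq_le_sq' ((norm_sq_le_nsq Z).trans hZn) hε0.le |>.2
  have := hW.cylinder_lower_bound hn hσ hm (X := Z) (fun x hx hlt => ?_) (by linarith) hZ2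
    (by linarith)
  · have e1 : ρ • Z = Y := by rw [hZ, smul_inv_smul₀ hρ.ne']
    rw [e1] at this
    refine le_trans ?_ this
    have h1 : B * Z.2 ^ (2 * σ) ≤ 1 / 2 := by
      refine le_trans ?_ hε2
      gcongr
    have h2 : 0 ≤ cylD n σ * Z.2 ^ 2 := mul_nonneg (cylD_nonneg hσ) (sq_nonneg _)
    have h3 : ‖Z.1‖ ^ 2 ≤ 1 / 16 := by nlinarith [norm_nonneg Z.1]
    have : (1 / 4 : ℝ) ≤ 1 - cylB n σ * Z.2 ^ (2 * σ) + cylD n σ * Z.2 ^ 2 - 2 * ‖Z.1‖ ^ 2 := by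
      rw [← hB]; linarith
    calc m / 4 = m * (1 / 4) := by ring
      _ ≤ _ := by gcongr
  · exfalso
    have h1 := hVm (ρ • x + x0) (by
      rw [add_sub_cancel_right, norm_smul, Real.norm_eq_abs, abs_of_pos hρ]; nlinarith)
    have h2 : ((ρ • (x, 0) + (x0, 0) : Pt n)) = (ρ • x + x0, 0) := by simp
    rw [h2] at hlt
    nlinarith [sq_nonneg ‖x‖]

theorem Sol.le_of_flux_ge (hn : 0 < n) (hσ : σ ∈ Set.Ioo (0 : ℝ) 1) {r : ℝ}
    {g : EuclideanSpace ℝ (Fin n) → ℝ} {V : Pt n → ℝ} (hV : Sol σ r g V)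
    {x0 : EuclideanSpace ℝ (Fin n)} {ρ c : ℝ} (hρ : 0 < ρ) (hc : 0 ≤ c) (hr : ‖x0‖ + 2 * ρ ≤ r)
    (hg : ∀ x, ‖x - x0‖ < ρ → c ≤ g x) : ρ ^ (2 * σ) * c / cylB n σ ≤ V (x0, 0) := by
  have hB0 : 0 < cylB n σ := cylB_pos hσ
  have hW := hV.affine hρ (r' := 2) zero_le_two (x0 := x0) (by linarith)
  have := hW.cylinder_lower_bound hn hσ (K := ρ ^ (2 * σ) * c / cylB n σ) (by positivity) (X := 0)
    (fun x hx hlt => ?_) (by simp) (by simp) (by simp)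
  · have hs : 2 * σ ≠ 0 := by linarith [hσ.1]
    simpa [Real.zero_rpow hs] using this
  · rw [div_mul_cancel₀ _ hB0.ne']
    gcongr
    refine hg _ ?_
    rw [add_sub_cancel_right, norm_smul, Real.norm_eq_abs, abs_of_pos hρ]; nlinarith

end

/-! ### Interior estimates -/

section

variable {n : ℕ} {σ : ℝ}

theorem isCompact_nsq_sub_le (X0 : Pt n) (r : ℝ) : IsCompact {X : Pt n | nsq (X - X0) ≤ r ^ 2} := by
  refine Metric.isCompact_of_isClosed_isBounded
    (isClosed_le (continuous_nsq.comp (continuous_id.sub continuous_const)) continuous_const) ?_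
  refine (Metric.isBounded_closedBall (x := X0) (r := |r|)).subset fun X hX => ?_
  rw [mem_closedBall_iff_norm, Prod.norm_def, sup_le_iff, Real.norm_eq_abs]
  have h1 : nsq (X - X0) ≤ r ^ 2 := hX
  constructor
  · rw [← abs_norm]
    exact sq_le_sq.1 ((norm_sq_le_nsq (X - X0)).trans h1)
  · exact sq_le_sq.1 ((sq_le_nsq (X - X0)).trans h1)

theorem isOpen_nsq_sub_lt (X0 : Pt n) (c : ℝ) : IsOpen {X : Pt n | nsq (X - X0) < c} :=
  isOpen_lt (f := fun X : Pt n => nsq (X - X0)) (by fun_prop) continuous_const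

theorem continuousOn_of_hasLL {V : Pt n → ℝ} {K : Set (Pt n)} (h : ∀ X ∈ K, HasLL σ V X 0) :
    ContinuousOn V K := fun X hX => (h X hX).1.continuousAt.continuousWithinAt

theorem nsq_refl_sub {x0 e : EuclideanSpace ℝ (Fin n)} (he : ‖e‖ = 1) (X : Pt n) (t0 : ℝ) :
    nsq (refl x0 e X - (x0, t0)) = nsq (X - (x0, t0)) := by
  simp only [nsq, refl, Prod.fst_sub, Prod.snd_sub]
  congr 1
  rw [sub_right_comm, norm_sub_sq_real, inner_smul_right, norm_smul, he]
  simp only [Real.norm_eq_abs, mul_one, sq_abs]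
  ring

theorem continuous_refl (x0 e : EuclideanSpace ℝ (Fin n)) : Continuous (refl x0 e) := by
  unfold refl
  fun_prop

theorem refl_of_inner_eq_zero {x0 e : EuclideanSpace ℝ (Fin n)} {X : Pt n}
    (h : ⟪X.1 - x0, e⟫ = 0) : refl x0 e X = X := by
  simp [refl, h]

theorem inner_le_of_nsq {x0 e : EuclideanSpace ℝ (Fin n)} (he : ‖e‖ = 1) {X : Pt n} {t0 r : ℝ}
    (hr : 0 ≤ r) (h : nsq (X - (x0, t0)) ≤ r ^ 2) : ⟪X.1 - x0, e⟫ ≤ r := by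
  have h1 : ‖X.1 - x0‖ ^ 2 ≤ r ^ 2 := by simpa using (norm_sq_le_nsq (X - (x0, t0))).trans h
  have h2 : ‖X.1 - x0‖ ≤ r := (sq_le_sq₀ (norm_nonneg _) hr).1 h1
  have h3 := real_inner_le_norm (X.1 - x0) e
  rw [he, mul_one] at h3
  linarith

theorem abs_snd_sub_le_of_nsq {X X0 : Pt n} {r : ℝ} (hr : 0 ≤ r) (h : nsq (X - X0) ≤ r ^ 2) :
    |X.2 - X0.2| ≤ r := by
  have h1 : (X.2 - X0.2) ^ 2 ≤ r ^ 2 := by simpa using (sq_le_nsq (X - X0)).trans h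
  rw [← abs_of_nonneg hr]
  exact sq_le_sq.1 h1

theorem norm_fst_sub_le_of_nsq {X X0 : Pt n} {r : ℝ} (hr : 0 ≤ r) (h : nsq (X - X0) ≤ r ^ 2) :
    ‖X.1 - X0.1‖ ≤ r := by
  have h1 : ‖X.1 - X0.1‖ ^ 2 ≤ r ^ 2 := by simpa using (norm_sq_le_nsq (X - X0)).trans h
  exact (sq_le_sq₀ (norm_nonneg _) hr).1 h1

/-- Horizontal Lipschitz estimate for bounded solutions. -/
theorem interior_horizontal_lipschitz (hn : 0 < n) (hσ : σ ∈ Set.Ioo (0 : ℝ) 1) {V : Pt n → ℝ}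
    {X1 : Pt n} {r A : ℝ} (hr : 0 < r) (hrt : 2 * r ≤ X1.2)
    (hV : ∀ X : Pt n, nsq (X - X1) ≤ r ^ 2 → HasLL σ V X 0 ∧ 0 ≤ V X ∧ V X ≤ A)
    {y : EuclideanSpace ℝ (Fin n)} (hy : ‖y‖ ≤ r / 4) :
    V X1 - (4 * n + 8) * A * ‖y‖ / r ≤ V (X1 + (y, 0)) := by
  rcases eq_or_ne y 0 with rfl | hy0
  · rw [show ((0 : EuclideanSpace ℝ (Fin n)), (0 : ℝ)) = 0 from rfl]
    simp
  have hA : 0 ≤ A := by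
    obtain ⟨-, h1, h2⟩ := hV X1 (by simp [nsq]; positivity)
    linarith
  set s := ‖y‖ with hs
  have hs0 : 0 < s := norm_pos_iff.2 hy0
  set e := s⁻¹ • y with he
  have he1 : ‖e‖ = 1 := by rw [he, norm_smul, norm_inv, Real.norm_eq_abs, abs_of_pos hs0, ← hs,
    inv_mul_cancel₀ hs0.ne']
  have hye : y = s • e := by rw [he, smul_inv_smul₀ hs0.ne']
  set xm := X1.1 + (s / 2) • e with hxm
  set Xm : Pt n := (xm, X1.2) with hXm
  set M : ℝ := 4 * n + 8 with hM
  set S : Set (Pt n) := {X | nsq (X - Xm) ≤ (r / 2) ^ 2 ∧ 0 ≤ ⟪X.1 - xm, e⟫} with hS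
  have hSc : IsCompact S := by
    refine (isCompact_nsq_sub_le Xm (r / 2)).of_isClosed_subset ?_ fun X hX => hX.1
    exact (isCompact_nsq_sub_le Xm (r / 2)).isClosed.inter
      (isClosed_le (g := fun X : Pt n => ⟪X.1 - xm, e⟫) continuous_const (by fun_prop))
  have hball : ∀ X : Pt n, nsq (X - Xm) ≤ (r / 2) ^ 2 → nsq (X - X1) ≤ r ^ 2 := by
    intro X hX
    rw [nsq_le_sq_iff hr.le]
    rw [nsq_le_sq_iff (by positivity)] at hX
    have h1 : X - X1 = (X - Xm) + ((s / 2) • e, 0) := by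
      ext1
      · simp only [hXm, hxm, Prod.fst_sub, Prod.fst_add]; module
      · simp [hXm]
    rw [h1]
    refine (enorm'_add_le _ _).trans ?_
    rw [enorm'_flat, norm_smul, he1, Real.norm_eq_abs, abs_of_pos (by positivity)]
    linarith
  have hVr : ∀ X ∈ S, HasLL σ V X 0 ∧ 0 ≤ V X ∧ V X ≤ A := fun X hX => hV X (hball X hX.1)
  have hVr' : ∀ X ∈ S, HasLL σ V (refl xm e X) 0 ∧ 0 ≤ V (refl xm e X) ∧ V (refl xm e X) ≤ A :=
    fun X hX => hV _ (hball _ (by rw [hXm, nsq_refl_sub he1]; exact hX.1))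
  set w : Pt n → ℝ := fun X => V X - V (refl xm e X) +
    (4 * A / r ^ 2 * nsq (X - Xm) + A * M * (⟪X.1 - xm, e⟫ / r - ⟪X.1 - xm, e⟫ ^ 2 / r ^ 2)) with hw
  have hwc : ContinuousOn w S := by
    refine ((continuousOn_of_hasLL fun X hX => (hVr X hX).1).sub
      (continuousOn_of_hasLL fun X hX => hasLL_refl he1 (hVr' X hX).1)).add
      (Continuous.continuousOn ?_)
    fun_prop
  have hin : ∀ X ∈ S, ⟪X.1 - xm, e⟫ ≤ r / 2 := fun X hX => inner_le_of_nsq he1 (by positivity) hX.1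
  have hpar : ∀ X ∈ S, 0 ≤ A * M * (⟪X.1 - xm, e⟫ / r - ⟪X.1 - xm, e⟫ ^ 2 / r ^ 2) := by
    intro X hX
    have h1 := hX.2
    have h2 := hin X hX
    have : ⟪X.1 - xm, e⟫ / r - ⟪X.1 - xm, e⟫ ^ 2 / r ^ 2 =
      ⟪X.1 - xm, e⟫ * (r - ⟪X.1 - xm, e⟫) / r ^ 2 := by field_simp
    rw [this]
    have : 0 ≤ r - ⟪X.1 - xm, e⟫ := by linarith
    positivity
  have key := weak_min_principle (w := w) hn hσ hSc hwc ?_ (X1 + (y, 0)) ?_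
  · have e1 : (X1 + (y, 0)).1 - xm = (s / 2) • e := by
      rw [hxm, hye]; simp only [Prod.fst_add]; module
    have e2 : refl xm e (X1 + (y, 0)) = X1 := by
      unfold refl
      rw [e1, inner_smul_left, real_inner_self_eq_norm_sq, he1, hye]
      ext1
      · simp only [Prod.fst_add, conj_trivial]; module
      · simp
    have e3 : nsq (X1 + (y, 0) - Xm) = s ^ 2 / 4 := by
      have : X1 + (y, 0) - Xm = ((s / 2) • e, 0) := by
        ext1
        · exact e1
        · simp [hXm]
      rw [this, nsq, norm_smul, he1, Real.norm_eq_abs, abs_of_pos (by positivity)]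
      ring
    simp only [hw] at key
    rw [e2, e3, e1, inner_smul_left, real_inner_self_eq_norm_sq, he1, conj_trivial] at key
    have h1 : 4 * A / r ^ 2 * (s ^ 2 / 4) = A * (s / r) ^ 2 := by field_simp
    have h2 : A * M * (s / 2 * 1 ^ 2 / r - (s / 2 * 1 ^ 2) ^ 2 / r ^ 2) ≤ A * M * (s / r) / 2 := by
      have : A * M * (s / r) / 2 - A * M * (s / 2 * 1 ^ 2 / r - (s / 2 * 1 ^ 2) ^ 2 / r ^ 2) =
        A * M * (s / r) ^ 2 / 4 := by field_simp; ring
      have h3 : 0 ≤ A * M * (s / r) ^ 2 / 4 := by positivity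
      linarith
    have h3 : (s / r) ≤ 1 := (div_le_one hr).2 (by linarith)
    have h4 : A * (s / r) ^ 2 ≤ A * (s / r) := by
      have : 0 ≤ s / r := by positivity
      gcongr; nlinarith
    have h5 : A * (s / r) * 2 ≤ A * (s / r) * M := by
      have : (0:ℝ) ≤ n := Nat.cast_nonneg n
      gcongr; linarith
    have h6 : M * A * s / r = A * M * (s / r) := by field_simp
    rw [h6]
    linarith
  · intro X hX hneg
    obtain ⟨hL, hV0, hVA⟩ := hVr X hX
    obtain ⟨hL', hV0', hVA'⟩ := hVr' X hX
    have hp := hpar X hX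
    have hq0 : 0 ≤ 4 * A / r ^ 2 * nsq (X - Xm) := by have := nsq_nonneg (X - Xm); positivity
    have hin1 : nsq (X - Xm) < (r / 2) ^ 2 := by
      refine lt_of_le_of_ne hX.1 fun h => ?_
      simp only [hw] at hneg
      rw [h] at hneg
      have : 4 * A / r ^ 2 * (r / 2) ^ 2 = A := by field_simp; ring
      linarith
    have hin2 : 0 < ⟪X.1 - xm, e⟫ := by
      refine lt_of_le_of_ne hX.2 fun h => ?_
      simp only [hw] at hneg
      rw [refl_of_inner_eq_zero h.symm] at hneg
      linarith
    have htm := abs_le.1 (abs_snd_sub_le_of_nsq (by positivity) hX.1)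
    simp only [hXm] at htm
    have ht : 0 < X.2 := by linarith [htm.1]
    refine ⟨mem_nhdsWithin_HS (O := {Y | nsq (Y - Xm) < (r / 2) ^ 2 ∧ 0 < ⟪Y.1 - xm, e⟫}) ?_
      ⟨hin1, hin2⟩ fun Y hY _ => ⟨hY.1.le, hY.2.le⟩, Or.inl ⟨ht,
      0 - 0 + (4 * A / r ^ 2 * (2 * n + 2 + 2 * ((1 - 2 * σ) / X.2) * (X.2 - Xm.2)) +
        A * M * (- 2 / r ^ 2 * ‖e‖ ^ 2)), ?_, ?_⟩⟩
    · exact (isOpen_nsq_sub_lt Xm _).inter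
        (isOpen_lt (g := fun Y : Pt n => ⟪Y.1 - xm, e⟫) continuous_const (by fun_prop))
    · refine (hL.sub (hasLL_refl he1 hL')).add (((hasLL_qd Xm X).const_mul _).add
        (HasLL.const_mul _ (hasLL_comp_inner (fun u => u / r - u ^ 2 / r ^ 2)
          (fun u => 1 / r - 2 * u / r ^ 2) _ xm e X ?_ ?_ ?_)))
      · fun_prop
      · refine Eventually.of_forall fun u => ?_
        refine (((hasDerivAt_id u).div_const r).sub
          ((hasDerivAt_pow 2 u).div_const (r ^ 2))).congr_deriv ?_
        simp
      · have := ((hasDerivAt_const (⟪X.1 - xm, e⟫) (1 / r)).sub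
          (((hasDerivAt_id (⟪X.1 - xm, e⟫)).const_mul 2).div_const (r ^ 2)))
        refine this.congr_deriv ?_
        ring
    · rw [he1]
      have hb : ((1 - 2 * σ) / X.2) * (X.2 - Xm.2) ≤ 1 := by
        rw [div_mul_eq_mul_div, div_le_one ht]
        have : |(1 - 2 * σ) * (X.2 - Xm.2)| ≤ 1 * (r / 2) := by
          rw [abs_mul]
          refine mul_le_mul ?_ (abs_snd_sub_le_of_nsq (by positivity) hX.1) (abs_nonneg _) zero_le_one
          rw [abs_le]; constructor <;> linarith [hσ.1, hσ.2]
        have := (abs_le.1 this).2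
        linarith [htm.1]
      have : 0 - 0 + (4 * A / r ^ 2 * (2 * n + 2 + 2 * ((1 - 2 * σ) / X.2) * (X.2 - Xm.2)) +
        A * M * (- 2 / r ^ 2 * 1 ^ 2)) = (A / r ^ 2) *
          (4 * (2 * n + 2 + 2 * (((1 - 2 * σ) / X.2) * (X.2 - Xm.2))) - 2 * M) := by ring
      rw [this]
      refine mul_nonpos_of_nonneg_of_nonpos (by positivity) ?_
      rw [hM]; linarith
  · constructor
    · have : X1 + (y, 0) - Xm = ((s / 2) • e, 0) := by
        ext1
        · rw [hXm, hxm, hye]; simp only [Prod.fst_add, Prod.fst_sub]; module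
        · simp [hXm]
      rw [this, nsq, norm_smul, he1, Real.norm_eq_abs, abs_of_pos (by positivity)]
      nlinarith
    · have e1 : (X1 + (y, 0)).1 - xm = (s / 2) • e := by
        rw [hxm, hye]; simp only [Prod.fst_add]; module
      rw [e1, inner_smul_left, real_inner_self_eq_norm_sq, he1, conj_trivial]
      positivity

end

section

variable {n : ℕ} {σ : ℝ}

/-- Propagation of a lower bound from a horizontal disc to a ball above it. -/
theorem ball_lower_bound_of_disc (hn : 0 < n) (hσ : σ ∈ Set.Ioo (0 : ℝ) 1) {V : Pt n → ℝ}
    {X1 : Pt n} {ρ v : ℝ} (hρ : 0 < ρ) (hρt : ρ ≤ X1.2) (hv : 0 ≤ v)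
    (hV : ∀ X : Pt n, ‖X.1 - X1.1‖ ≤ ρ → X1.2 ≤ X.2 → X.2 ≤ X1.2 + ρ → HasLL σ V X 0 ∧ 0 ≤ V X)
    (hdisc : ∀ X : Pt n, ‖X.1 - X1.1‖ ≤ ρ → X.2 = X1.2 → v ≤ V X) {X : Pt n}
    (hX : nsq (X - (X1 + (0, ρ / (4 * (4 * n + 2))))) ≤ (ρ / (4 * (4 * n + 2))) ^ 2) :
    v / 4 ≤ V X := by
  set B : ℝ := 4 * n + 2 with hB
  set D : ℝ := 4 * n + 1 with hD
  have hn0 : (0 : ℝ) ≤ n := Nat.cast_nonneg n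
  have hB2 : 2 ≤ B := by linarith
  set S : Set (Pt n) := {X | ‖X.1 - X1.1‖ ≤ ρ ∧ X1.2 ≤ X.2 ∧ X.2 ≤ X1.2 + ρ} with hS
  have hSc : IsCompact S := by
    refine (isCompact_nsq_sub_le X1 (2 * ρ)).of_isClosed_subset ?_ ?_
    · exact (isClosed_le (f := fun X : Pt n => ‖X.1 - X1.1‖) (by fun_prop) continuous_const).inter
        ((isClosed_le continuous_const continuous_snd).inter
          (isClosed_le continuous_snd continuous_const))
    · rintro X ⟨h1, h2, h3⟩
      simp only [nsq, Set.mem_ofPred_eq, Prod.fst_sub, Prod.snd_sub]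
      nlinarith [norm_nonneg (X.1 - X1.1)]
  set F : ℝ → ℝ := fun u => 1 - B * ((u - X1.2) / ρ) + D * ((u - X1.2) / ρ) ^ 2 with hF
  have hFc : ContDiff ℝ 2 F := by fun_prop
  have hFv : Continuous F := hFc.continuous
  set ψ : Pt n → ℝ := fun X => F X.2 - 2 / ρ ^ 2 * ‖X.1 - X1.1‖ ^ 2 with hψ
  have hψc : Continuous ψ := by fun_prop
  have key : ∀ X ∈ S, 0 ≤ V X - v * ψ X := by
    refine weak_min_principle hn hσ hSc
      ((continuousOn_of_hasLL fun X hX => (hV X hX.1 hX.2.1 hX.2.2).1).sub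
        (continuous_const.mul hψc).continuousOn) ?_
    rintro X ⟨h1, h2, h3⟩ hneg
    obtain ⟨hL, hV0⟩ := hV X h1 h2 h3
    have hψX : 0 < ψ X := by
      by_contra! hle
      have := mul_nonpos_of_nonneg_of_nonpos hv hle
      linarith
    have hτ0 : 0 ≤ (X.2 - X1.2) / ρ := div_nonneg (by linarith) hρ.le
    have hτ1 : (X.2 - X1.2) / ρ ≤ 1 := (div_le_one hρ).2 (by linarith)
    have hlat : 0 ≤ 2 / ρ ^ 2 * ‖X.1 - X1.1‖ ^ 2 := by positivity
    have h1' : ‖X.1 - X1.1‖ < ρ := by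
      refine lt_of_le_of_ne h1 fun h => ?_
      simp only [hψ, hF] at hψX
      rw [h, div_mul_cancel₀ _ (by positivity)] at hψX
      have h4 : ((X.2 - X1.2) / ρ) ^ 2 ≤ (X.2 - X1.2) / ρ := by nlinarith
      have h5 : D * ((X.2 - X1.2) / ρ) ^ 2 ≤ D * ((X.2 - X1.2) / ρ) :=
        mul_le_mul_of_nonneg_left h4 (by linarith)
      have h6 : D * ((X.2 - X1.2) / ρ) ≤ B * ((X.2 - X1.2) / ρ) := by gcongr; linarith
      linarith
    have h2' : X1.2 < X.2 := by
      refine lt_of_le_of_ne h2 fun h => ?_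
      have h4 := hdisc X h1 h.symm
      have h5 : ψ X ≤ 1 := by
        simp only [hψ, hF]
        rw [← h, sub_self, zero_div]
        linarith
      nlinarith
    have h3' : X.2 < X1.2 + ρ := by
      refine lt_of_le_of_ne h3 fun h => ?_
      simp only [hψ, hF] at hψX
      rw [h, add_sub_cancel_left, div_self hρ.ne'] at hψX
      linarith
    have ht : 0 < X.2 := by linarith
    refine ⟨mem_nhdsWithin_HS
      (O := {Y | ‖Y.1 - X1.1‖ < ρ ∧ X1.2 < Y.2 ∧ Y.2 < X1.2 + ρ}) ?_ ⟨h1', h2', h3'⟩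
      fun Y hY _ => ⟨hY.1.le, hY.2.1.le, hY.2.2.le⟩, Or.inl ⟨ht,
      0 - v * ((2 * D / ρ ^ 2 + ((1 - 2 * σ) / X.2) * (-B / ρ + 2 * D * (X.2 - X1.2) / ρ ^ 2)) -
        2 / ρ ^ 2 * (2 * n)), ?_, ?_⟩⟩
    · exact (isOpen_lt (f := fun X : Pt n => ‖X.1 - X1.1‖) (by fun_prop) continuous_const).inter
        ((isOpen_lt continuous_const continuous_snd).inter
          (isOpen_lt continuous_snd continuous_const))
    · refine hL.sub (HasLL.const_mul v (HasLL.sub (hasLL_comp_snd F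
        (fun u => -B / ρ + 2 * D * (u - X1.2) / ρ ^ 2) _ X hFc.contDiffAt ?_ ?_)
        ((hasLL_qd_flat X1.1 ht).const_mul _)))
      · refine Eventually.of_forall fun u => ?_
        have h0 : HasDerivAt (fun u => (u - X1.2) / ρ) (1 / ρ) u :=
          ((hasDerivAt_id u).sub_const _).div_const _
        refine (((h0.const_mul B).const_sub 1).add ((h0.pow 2).const_mul D)).congr_deriv ?_
        norm_num
        field_simp
      · have h0 : HasDerivAt (fun u => u - X1.2) 1 X.2 := (hasDerivAt_id X.2).sub_const _
        refine (((h0.const_mul (2 * D)).div_const (ρ ^ 2)).const_add (-B / ρ)).congr_deriv ?_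
        ring
    · have hb : -(D + 1) ≤ ((1 - 2 * σ) * (ρ / X.2)) * (-B + 2 * D * ((X.2 - X1.2) / ρ)) := by
        have a1 : |(1 - 2 * σ) * (ρ / X.2)| ≤ 1 * 1 := by
          rw [abs_mul]
          refine mul_le_mul ?_ ?_ (abs_nonneg _) zero_le_one
          · rw [abs_le]; constructor <;> linarith [hσ.1, hσ.2]
          · rw [abs_of_pos (by positivity), div_le_one ht]; linarith
        have a2 : |(-B + 2 * D * ((X.2 - X1.2) / ρ))| ≤ D + 1 := by
          rw [abs_le]; constructor <;> nlinarith
        have a3 : |((1 - 2 * σ) * (ρ / X.2)) * (-B + 2 * D * ((X.2 - X1.2) / ρ))| ≤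
            1 * 1 * (D + 1) := by
          rw [abs_mul]
          exact mul_le_mul a1 a2 (abs_nonneg _) (by norm_num)
        linarith [(abs_le.1 a3).1]
      have e1 : 0 - v * ((2 * D / ρ ^ 2 + ((1 - 2 * σ) / X.2) *
          (-B / ρ + 2 * D * (X.2 - X1.2) / ρ ^ 2)) - 2 / ρ ^ 2 * (2 * n)) =
          -(v / ρ ^ 2 * (2 * D - 4 * n +
            ((1 - 2 * σ) * (ρ / X.2)) * (-B + 2 * D * ((X.2 - X1.2) / ρ)))) := by
        field_simp
        ring
      rw [e1, neg_nonpos]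
      refine mul_nonneg (by positivity) ?_
      linarith
  set δ := ρ / (4 * B) with hδ
  have hδ0 : 0 < δ := by positivity
  have hδρ : B * δ = ρ / 4 := by rw [hδ]; field_simp
  have ht := abs_le.1 (abs_snd_sub_le_of_nsq hδ0.le hX)
  have hx := norm_fst_sub_le_of_nsq hδ0.le hX
  simp only [Prod.fst_add, Prod.snd_add, add_zero] at ht hx
  have hδ8 : δ ≤ ρ / 8 := by nlinarith
  have h := key X ⟨by linarith, by linarith [ht.1], by linarith [ht.2]⟩
  have h1 : 1 / 4 ≤ ψ X := by
    simp only [hψ, hF]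
    have a1 : B * ((X.2 - X1.2) / ρ) ≤ 1 / 2 := by
      rw [← mul_div_assoc, div_le_iff₀ hρ]
      have : B * (X.2 - X1.2) ≤ B * (2 * δ) := by gcongr; linarith [ht.2]
      linarith
    have a2 : 0 ≤ D * ((X.2 - X1.2) / ρ) ^ 2 := by positivity
    have a3 : 2 / ρ ^ 2 * ‖X.1 - X1.1‖ ^ 2 ≤ 1 / 4 := by
      calc 2 / ρ ^ 2 * ‖X.1 - X1.1‖ ^ 2 ≤ 2 / ρ ^ 2 * (ρ / 8) ^ 2 := by gcongr; linarith
        _ ≤ 1 / 4 := by field_simp; norm_num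
    linarith
  have : v * (1 / 4) ≤ v * ψ X := by gcongr
  linarith

/-- Propagation of a lower bound from a ball to a concentric larger ball. -/
theorem power_lower_bound (hn : 0 < n) (hσ : σ ∈ Set.Ioo (0 : ℝ) 1) {V : Pt n → ℝ}
    {X2 : Pt n} {ρ L τ q v : ℝ} (hρ : 0 < ρ) (hτ : 0 < τ) (hL : 0 < L) (hLt : L + τ ≤ X2.2)
    (hv : 0 ≤ v) (hq : 2 * n + 2 + 2 * L / τ ≤ 4 * q)
    (hV : ∀ X : Pt n, nsq (X - X2) ≤ L ^ 2 → HasLL σ V X 0 ∧ 0 ≤ V X)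
    (hball : ∀ X : Pt n, nsq (X - X2) ≤ ρ ^ 2 → v ≤ V X) {X : Pt n}
    (hX : nsq (X - X2) ≤ L ^ 2) (hX' : ρ ^ 2 ≤ nsq (X - X2)) :
    v * (ρ ^ 2) ^ q * (nsq (X - X2) ^ (-q) - (L ^ 2) ^ (-q)) ≤ V X := by
  have hq0 : 0 < q := by
    have : 0 < 2 * L / τ := by positivity
    have : (0 : ℝ) ≤ n := Nat.cast_nonneg n
    linarith
  set S : Set (Pt n) := {X | nsq (X - X2) ≤ L ^ 2 ∧ ρ ^ 2 ≤ nsq (X - X2)} with hS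
  have hSc : IsCompact S := by
    refine (isCompact_nsq_sub_le X2 L).of_isClosed_subset ?_ fun X hX => hX.1
    exact (isCompact_nsq_sub_le X2 L).isClosed.inter
      (isClosed_le (g := fun X : Pt n => nsq (X - X2)) continuous_const (by fun_prop))
  set K := v * (ρ ^ 2) ^ q with hK
  have hK0 : 0 ≤ K := by positivity
  have hu0 : ∀ X ∈ S, 0 < nsq (X - X2) := fun X hX => lt_of_lt_of_le (by positivity) hX.2
  have key : ∀ X ∈ S, 0 ≤ V X - K * (nsq (X - X2) ^ (-q) - (L ^ 2) ^ (-q)) := by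
    refine weak_min_principle hn hσ hSc
      ((continuousOn_of_hasLL fun X hX => (hV X hX.1).1).sub (continuousOn_const.mul
        ((ContinuousOn.rpow_const (Continuous.continuousOn (by fun_prop)) fun X hX =>
          Or.inl (hu0 X hX).ne').sub continuousOn_const))) ?_
    intro X hX hneg
    obtain ⟨hLL, hV0⟩ := hV X hX.1
    have hu := hu0 X hX
    have h1 : nsq (X - X2) < L ^ 2 := by
      refine lt_of_le_of_ne hX.1 fun h => ?_
      rw [h, sub_self, mul_zero] at hneg
      linarith
    have h2 : ρ ^ 2 < nsq (X - X2) := by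
      refine lt_of_le_of_ne hX.2 fun h => ?_
      have h3 := hball X h.symm.le
      have h4 : K * nsq (X - X2) ^ (-q) = v := by
        rw [← h, hK, mul_assoc, ← Real.rpow_add (by positivity)]
        simp
      have h5 : 0 ≤ K * (L ^ 2) ^ (-q) := by positivity
      rw [mul_sub, h4] at hneg
      linarith
    have htm := abs_le.1 (abs_snd_sub_le_of_nsq hL.le hX.1)
    have htτ : τ ≤ X.2 := by linarith [htm.1]
    have ht : 0 < X.2 := by linarith
    refine ⟨mem_nhdsWithin_HS (O := {Y | nsq (Y - X2) < L ^ 2 ∧ ρ ^ 2 < nsq (Y - X2)}) ?_ ⟨h1, h2⟩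
      fun Y hY _ => ⟨hY.1.le, hY.2.le⟩, Or.inl ⟨ht, _, hLL.sub (HasLL.const_mul K (HasLL.sub
        (hasLL_comp_qd (fun u => u ^ (-q)) (fun u => -q * u ^ (-q - 1))
          (-q * ((-q - 1) * nsq (X - X2) ^ (-q - 1 - 1))) X2 X
          (Real.contDiffAt_rpow_const_of_ne hu.ne') ?_ ?_) (hasLL_const _ X))), ?_⟩⟩
    · exact (isOpen_nsq_sub_lt X2 _).inter
        (isOpen_lt (g := fun X : Pt n => nsq (X - X2)) continuous_const (by fun_prop))
    · filter_upwards [lt_mem_nhds hu] with u hu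
      exact Real.hasDerivAt_rpow_const (Or.inl hu.ne')
    · exact (Real.hasDerivAt_rpow_const (Or.inl hu.ne')).const_mul _
    · rw [Real.rpow_sub_one hu.ne' (-q - 1)]
      have hb : ((1 - 2 * σ) / X.2) * (X.2 - X2.2) ≤ L / τ := by
        have a1 : |(1 - 2 * σ) / X.2 * (X.2 - X2.2)| ≤ 1 / τ * L := by
          rw [abs_mul, abs_div, abs_of_pos ht]
          refine mul_le_mul ?_ (abs_snd_sub_le_of_nsq hL.le hX.1) (abs_nonneg _) (by positivity)
          refine div_le_div₀ zero_le_one ?_ hτ htτ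
          rw [abs_le]; constructor <;> linarith [hσ.1, hσ.2]
        calc _ ≤ _ := (abs_le.1 a1).2
          _ = L / τ := by ring
      set U := nsq (X - X2) with hU
      set P := U ^ (-q - 1) with hP
      have hP0 : 0 < P := Real.rpow_pos_of_pos hu _
      have e1 : 0 - K * (-q * P * (2 * n + 2 + 2 * ((1 - 2 * σ) / X.2) * (X.2 - X2.2)) +
          4 * U * (-q * ((-q - 1) * (P / U))) - 0) =
          -(K * q * P * (4 * (q + 1) - (2 * n + 2 + 2 * ((1 - 2 * σ) / X.2 * (X.2 - X2.2))))) := by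
        field_simp
        ring
      rw [e1, neg_nonpos]
      refine mul_nonneg (by positivity) ?_
      have : 2 * L / τ = 2 * (L / τ) := by ring
      linarith
  have := key X ⟨hX, hX'⟩
  linarith

/-- Propagation of a lower bound from a horizontal disc down to the flat boundary. -/
theorem Sol.flat_lower_bound (hn : 0 < n) (hσ : σ ∈ Set.Ioo (0 : ℝ) 1)
    {g : EuclideanSpace ℝ (Fin n) → ℝ} {V : Pt n → ℝ} (hV : Sol σ 2 g V)
    (hg : ∀ x, ‖x‖ < 2 → 0 ≤ g x) {h r v : ℝ} (hh : 0 < h) (hh1 : h ≤ 1) (hr : 0 < r) (hr1 : r ≤ 1)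
    (hrh : (1 - σ) / n * r ^ 2 = 3 * h ^ 2) (hv : 0 ≤ v)
    (htop : ∀ X : Pt n, ‖X.1‖ ≤ r → X.2 = h → v ≤ V X) : v / 3 ≤ V 0 := by
  have hn0 : (0 : ℝ) < n := by exact_mod_cast hn
  set κ := (1 - σ) / n with hκ
  have hκ0 : 0 < κ := div_pos (by linarith [hσ.2]) hn0
  set S : Set (Pt n) := {X | ‖X.1‖ ≤ r ∧ 0 ≤ X.2 ∧ X.2 ≤ h} with hSdef
  have hS2 : S ⊆ HB n 2 := by
    rintro X ⟨h1, h2, h3⟩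
    refine ⟨?_, h2⟩
    unfold nsq
    nlinarith [norm_nonneg X.1]
  have hSc : IsCompact S := by
    refine (isCompact_HB 2).of_isClosed_subset ?_ hS2
    exact (isClosed_le continuous_fst.norm continuous_const).inter
      ((isClosed_le continuous_const continuous_snd).inter
        (isClosed_le continuous_snd continuous_const))
  set b := h ^ (2 - 2 * σ) with hb
  have hb0 : 0 < b := Real.rpow_pos_of_pos hh _
  have hbh : b * h ^ (2 * σ) = h ^ 2 := by
    rw [hb, ← Real.rpow_add hh]; simp
  set ψ : Pt n → ℝ := fun X => X.2 ^ 2 - κ * ‖X.1‖ ^ 2 + b * X.2 ^ (2 * σ) + h ^ 2 with hψ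
  have hψc : Continuous ψ := by
    have : Continuous fun X : Pt n => X.2 ^ (2 * σ) :=
      continuous_snd.rpow_const fun _ => Or.inr (by linarith [hσ.1])
    fun_prop
  set K := v / (3 * h ^ 2) with hK
  have hK0 : 0 ≤ K := by positivity
  have key := weak_min_principle (w := fun X => V X - K * ψ X) hn hσ hSc
    ((hV.cont.mono hS2).sub (continuous_const.mul hψc).continuousOn) ?_ 0
    ⟨by simpa using hr.le, le_rfl, hh.le⟩
  · have hs : 2 * σ ≠ 0 := by linarith [hσ.1]
    have h1 : ψ 0 = h ^ 2 := by simp [hψ, Real.zero_rpow hs]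
    rw [h1, hK] at key
    have : v / (3 * h ^ 2) * h ^ 2 = v / 3 := by field_simp
    linarith
  · rintro X hX hneg
    obtain ⟨h1, h2, h3⟩ := hX
    have hVX := hV.nonneg X (hS2 ⟨h1, h2, h3⟩)
    have hψX : 0 < ψ X := by
      by_contra! hle
      have := mul_nonpos_of_nonneg_of_nonpos hK0 hle
      linarith
    have hp1 : X.2 ^ (2 * σ) ≤ h ^ (2 * σ) := Real.rpow_le_rpow h2 h3 (by linarith [hσ.1])
    have hp2 : b * X.2 ^ (2 * σ) ≤ h ^ 2 := by rw [← hbh]; gcongr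
    have hp3 : X.2 ^ 2 ≤ h ^ 2 := by gcongr
    have h1' : ‖X.1‖ < r := by
      refine lt_of_le_of_ne h1 fun h => ?_
      simp only [hψ] at hψX
      rw [h] at hψX
      linarith
    have h3' : X.2 < h := by
      refine lt_of_le_of_ne h3 fun h4 => ?_
      have h5 := htop X h1 h4
      have h6 : ψ X ≤ 3 * h ^ 2 := by
        simp only [hψ]
        have : 0 ≤ κ * ‖X.1‖ ^ 2 := by positivity
        linarith
      have : K * ψ X ≤ K * (3 * h ^ 2) := by gcongr
      rw [hK, div_mul_cancel₀ _ (by positivity)] at this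
      rw [hK] at hneg
      linarith
    refine ⟨mem_nhdsWithin_HS (O := {Y | ‖Y.1‖ < r ∧ Y.2 < h}) ?_ ⟨h1', h3'⟩ ?_, ?_⟩
    · exact (isOpen_lt continuous_fst.norm continuous_const).inter
        (isOpen_lt continuous_snd continuous_const)
    · rintro Y ⟨hY1, hY2⟩ hY3
      exact ⟨hY1.le, hY3, hY2.le⟩
    · rcases h2.eq_or_lt with h | h
      · refine Or.inr ⟨h.symm, _, (hV.flux X.1 (by linarith)).sub
          (((((flux_sq hσ.2 X.1).sub ((flux_of_fst (fun y => ‖y‖ ^ 2) X.1).const_mul κ)).add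
          ((flux_rpow hσ.1.ne' X.1).const_mul b)).add (flux_const _ X.1)).const_mul K), ?_⟩
        have := hg X.1 (by linarith)
        have : 0 ≤ K * b := by positivity
        linarith
      · have hq := (hasLL_qd_flat (σ := σ) 0 h).const_mul κ
        simp only [sub_zero] at hq
        refine Or.inl ⟨h, _, (hV.eqn X ?_ h).sub (((((hasLL_sq_snd h).sub hq).add
          ((hasLL_rpow_snd h).const_mul b)).add (hasLL_const _ X)).const_mul K), ?_⟩
        · have := norm_nonneg X.1
          unfold nsq
          nlinarith
        · have : κ * (2 * n) = 2 * (1 - σ) := by rw [hκ]; field_simp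
          rw [this]
          have := hσ.2
          have : 0 ≤ K * (2 - 2 * σ) := mul_nonneg hK0 (by linarith)
          linarith

end

section

variable {n : ℕ} {σ : ℝ}

theorem enorm'_sub_comm (X Y : Pt n) : enorm' (X - Y) = enorm' (Y - X) := by
  simp only [enorm'_eq_norm, WithLp.toLp_sub]
  exact norm_sub_rev _ _

theorem enorm'_sub_le (X Y Z : Pt n) : enorm' (X - Z) ≤ enorm' (X - Y) + enorm' (Y - Z) := by
  have := enorm'_add_le (X - Y) (Y - Z)
  rwa [sub_add_sub_cancel] at this

/-- A positive solution is comparable, on a small ball, to its value at the centre of a larger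
ball, with a controlled loss. -/
theorem exists_ball_lower_bound (hn : 0 < n) (hσ : σ ∈ Set.Ioo (0 : ℝ) 1) {q η : ℝ} (hq : 0 < q)
    (hη : 0 < η) (hη1 : η ≤ 1 / 8) :
    ∃ c : ℝ, 0 < c ∧ c ≤ 1 ∧ ∀ V : Pt n → ℝ,
      (∀ X : Pt n, nsq (X - (0, 1)) ≤ (1 / 2) ^ 2 → HasLL σ V X 0 ∧ 0 ≤ V X) → 0 < V (0, 1) →
      ∃ (X2 : Pt n) (d v : ℝ), 0 < d ∧ d ≤ η ∧ 0 < v ∧ enorm' (X2 - (0, 1)) ≤ η ∧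
        V (0, 1) * η ^ (2 * q) ≤ 8 * v * d ^ (2 * q) ∧
        ∀ X, nsq (X - X2) ≤ (c * d) ^ 2 → v ≤ V X := by
  have hn0 : (0 : ℝ) ≤ n := Nat.cast_nonneg n
  set M : ℝ := 2 ^ (2 * q) with hM
  have hM1 : 1 ≤ M := Real.one_le_rpow (by norm_num) (by positivity)
  set c1 : ℝ := 1 / ((8 * n + 16) * M) with hc1
  have hc10 : 0 < c1 := by positivity
  have hc14 : c1 ≤ 1 / 16 := by
    rw [hc1]
    refine one_div_le_one_div_of_le (by norm_num) ?_
    nlinarith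
  set B : ℝ := 4 * (4 * n + 2) with hB
  have hB8 : 8 ≤ B := by linarith
  refine ⟨c1 / 2 / B, by positivity, ?_, fun V hV hE => ?_⟩
  · rw [div_le_one (by positivity)]; linarith
  set E : Pt n := (0, 1) with hEdef
  have hcont : ContinuousOn (fun X => V X * (η - enorm' (X - E)) ^ (2 * q))
      {X : Pt n | nsq (X - E) ≤ η ^ 2} := by
    have hi : Continuous fun X : Pt n => (η - enorm' (X - E)) ^ (2 * q) := by
      refine Continuous.rpow_const ?_ fun _ => Or.inr (by positivity)
      exact continuous_const.sub (continuous_enorm'.comp (continuous_id.sub continuous_const))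
    refine ContinuousOn.mul (continuousOn_of_hasLL fun X hX => (hV X ?_).1) hi.continuousOn
    exact le_trans hX (by gcongr; linarith)
  have hE0 : nsq (E - E) = 0 := by simp [nsq]
  obtain ⟨X1, hX1, hmax⟩ := (isCompact_nsq_sub_le E η).exists_isMaxOn
    ⟨E, by change nsq (E - E) ≤ _; rw [hE0]; positivity⟩ hcont
  have hX1' : enorm' (X1 - E) ≤ η := (nsq_le_sq_iff hη.le).1 hX1
  have hmaxE := hmax (show E ∈ {X : Pt n | nsq (X - E) ≤ η ^ 2} by
    change nsq (E - E) ≤ _; rw [hE0]; positivity)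
  change V E * (η - enorm' (E - E)) ^ (2 * q) ≤ V X1 * (η - enorm' (X1 - E)) ^ (2 * q) at hmaxE
  have hEE : enorm' (E - E) = 0 := by simp [enorm']
  rw [hEE, sub_zero] at hmaxE
  set d := η - enorm' (X1 - E) with hd
  have hd0' : 0 ≤ d := by linarith
  have hpos : 0 < V E * η ^ (2 * q) := by positivity
  have hd0 : 0 < d := by
    refine lt_of_le_of_ne hd0' fun h => ?_
    rw [← h, Real.zero_rpow (by positivity), mul_zero] at hmaxE
    linarith
  have hdη : d ≤ η := by linarith [enorm'_nonneg (X1 - E)]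
  have hdp : 0 < d ^ (2 * q) := Real.rpow_pos_of_pos hd0 _
  have hV1 : 0 < V X1 := by
    by_contra! hle
    have := mul_nonpos_of_nonpos_of_nonneg hle hdp.le
    linarith
  have hX12 := abs_le.1 (abs_snd_sub_le_of_nsq hη.le hX1)
  have hX11 := norm_fst_sub_le_of_nsq hη.le hX1
  simp only [hEdef, sub_zero] at hX12 hX11
  have hlip : ∀ y : EuclideanSpace ℝ (Fin n), ‖y‖ ≤ c1 * (d / 2) →
      V X1 / 2 ≤ V (X1 + (y, 0)) := by
    intro y hy
    have := interior_horizontal_lipschitz (A := M * V X1) hn hσ (half_pos hd0) (X1 := X1) (V := V)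
      (by linarith [hX12.1]) (fun X hX => ?_) (y := y) (by nlinarith)
    · refine le_trans ?_ this
      have h1 : (4 * n + 8) * (M * V X1) * ‖y‖ / (d / 2) ≤
          (4 * n + 8) * (M * V X1) * (c1 * (d / 2)) / (d / 2) := by gcongr
      have h2 : (4 * n + 8) * (M * V X1) * (c1 * (d / 2)) / (d / 2) = V X1 / 2 := by
        rw [hc1]; field_simp; ring
      linarith
    · have h1 : enorm' (X - X1) ≤ d / 2 := (nsq_le_sq_iff (by positivity)).1 hX
      have h2 := enorm'_sub_le X X1 E
      have h3 : enorm' (X - E) ≤ η - d / 2 := by linarith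
      have h4 : nsq (X - E) ≤ η ^ 2 := (nsq_le_sq_iff hη.le).2 (by linarith)
      obtain ⟨h5, h6⟩ := hV X (h4.trans (by gcongr; linarith))
      refine ⟨h5, h6, ?_⟩
      have h7 : V X * (η - enorm' (X - E)) ^ (2 * q) ≤ V X1 * d ^ (2 * q) := hmax h4
      have h8 : (d / 2) ^ (2 * q) ≤ (η - enorm' (X - E)) ^ (2 * q) :=
        Real.rpow_le_rpow (by positivity) (by linarith) (by positivity)
      have h9 : V X * (d / 2) ^ (2 * q) ≤ V X1 * d ^ (2 * q) :=
        (mul_le_mul_of_nonneg_left h8 h6).trans h7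
      rw [Real.div_rpow hd0.le zero_le_two, ← hM, ← mul_div_assoc, div_le_iff₀ (by positivity)] at h9
      have h10 : V X * d ^ (2 * q) ≤ (M * V X1) * d ^ (2 * q) := by linarith
      exact le_of_mul_le_mul_right h10 hdp
  set ρ := c1 * (d / 2) with hρ
  have hρ0 : 0 < ρ := by positivity
  have hρd : ρ ≤ 1 / 64 := by nlinarith
  have hρB : ρ / B ≤ d / 2 := by
    rw [div_le_iff₀ (by positivity)]; nlinarith
  refine ⟨X1 + (0, ρ / B), d, V X1 / 2 / 4, hd0, hdη, by positivity, ?_, ?_, fun X hX => ?_⟩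
  · have h1 := enorm'_add_le (X1 - E) (0, ρ / B)
    have h2 : enorm' ((0, ρ / B) : Pt n) = ρ / B := by
      simp [enorm', Real.sqrt_sq (show 0 ≤ ρ / B by positivity)]
    rw [h2] at h1
    rw [add_sub_right_comm]
    linarith
  · calc V E * η ^ (2 * q) ≤ V X1 * d ^ (2 * q) := hmaxE
      _ = 8 * (V X1 / 2 / 4) * d ^ (2 * q) := by ring
  · refine ball_lower_bound_of_disc hn hσ hρ0 (by linarith [hX12.1]) (by positivity)
      (X1 := X1) (fun X h1 h2 h3 => hV X ?_) (fun X h1 h2 => ?_) (X := X) ?_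
    · have h4 := norm_le_norm_add_norm_sub' X.1 X1.1
      simp only [nsq, hEdef, Prod.fst_sub, Prod.snd_sub, sub_zero]
      have h5 : ‖X.1‖ ≤ 1 / 4 := by linarith
      have h6 : |X.2 - 1| ≤ 1 / 4 := by rw [abs_le]; constructor <;> linarith [hX12.1, hX12.2]
      have h7 : (X.2 - 1) ^ 2 ≤ (1 / 4) ^ 2 := by
        rw [← sq_abs]; gcongr
      have h8 : ‖X.1‖ ^ 2 ≤ (1 / 4) ^ 2 := by gcongr
      linarith
    · have h3 : X = X1 + (X.1 - X1.1, 0) := by ext1 <;> simp [h2]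
      rw [h3]
      exact hlip _ h1
    · refine hX.trans_eq ?_
      rw [hρ]; ring

set_option maxHeartbeats 400000 in
/-- Harnack inequality comparing an interior value with a boundary value. -/
theorem exists_harnack_const (hn : 0 < n) (hσ : σ ∈ Set.Ioo (0 : ℝ) 1) :
    ∃ C : ℝ, 0 < C ∧ ∀ (g : EuclideanSpace ℝ (Fin n) → ℝ) (V : Pt n → ℝ), Sol σ 3 g V →
      (∀ x, ‖x‖ < 3 → 0 ≤ g x) → V (0, 1) ≤ C * V 0 := by
  have hn0 : (1 : ℝ) ≤ n := by exact_mod_cast hn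
  set κ := (1 - σ) / n with hκ
  have hκ0 : 0 < κ := div_pos (by linarith [hσ.2]) (by linarith)
  have hκ1 : κ ≤ 1 := by rw [hκ, div_le_one (by linarith)]; linarith [hσ.1]
  set h := κ / 8 with hh
  have hh0 : 0 < h := by positivity
  have hh1 : h ≤ 1 / 8 := by linarith
  set r0 := Real.sqrt (3 * h / 8) with hr0
  have hr0s : r0 ^ 2 = 3 * h / 8 := Real.sq_sqrt (by positivity)
  have hr00 : 0 < r0 := Real.sqrt_pos.2 (by positivity)
  have hr01 : r0 ≤ 1 := by nlinarith
  set q : ℝ := n + 2 / h with hq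
  have hq0 : 0 < q := by positivity
  set L : ℝ := 1 - h / 2 with hL
  set L' : ℝ := 1 - 5 * h / 8 with hL'
  have hL'0 : 0 < L' := by linarith
  have hLL : L' < L := by linarith
  obtain ⟨c, hc0, hc1, hcV⟩ := exists_ball_lower_bound hn hσ hq0 (η := h / 16) (by positivity)
    (by linarith)
  set η := h / 16 with hη
  have hη0 : 0 < η := by positivity
  set c2 := (L' ^ 2) ^ (-q) - (L ^ 2) ^ (-q) with hc2
  have hc20 : 0 < c2 := by
    refine sub_pos.2 (Real.rpow_lt_rpow_of_neg (by positivity) ?_ (by linarith))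
    gcongr
  set c4 := (η ^ (2 * q) / 8) * c ^ (2 * q) * c2 with hc4
  have hc40 : 0 < c4 := by positivity
  refine ⟨3 / c4, by positivity, fun g V hV hg => ?_⟩
  have h0 : 0 ≤ V 0 := hV.nonneg 0 ⟨by simp [nsq], le_rfl⟩
  rcases le_or_gt (V (0, 1)) 0 with hE | hE
  · exact hE.trans (by positivity)
  have hint : ∀ X : Pt n, nsq X < 3 ^ 2 → 0 < X.2 → HasLL σ V X 0 ∧ 0 ≤ V X := fun X h1 h2 =>
    ⟨hV.eqn X h1 h2, hV.nonneg X ⟨h1.le, h2.le⟩⟩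
  have hE1 : enorm' ((0, 1) : Pt n) = 1 := by simp [enorm']
  have hEint : ∀ X : Pt n, nsq (X - (0, 1)) ≤ (1 / 2) ^ 2 → HasLL σ V X 0 ∧ 0 ≤ V X := by
    intro X hX
    have h1 := abs_le.1 (abs_snd_sub_le_of_nsq (by norm_num) hX)
    refine hint X ?_ (by linarith [h1.1])
    rw [nsq_lt_sq_iff (by norm_num)]
    have h2 := (nsq_le_sq_iff (by norm_num)).1 hX
    have h3 := enorm'_add_le (X - (0, 1)) (0, 1)
    rw [sub_add_cancel, hE1] at h3
    linarith
  obtain ⟨X2, d, v, hd0, hdη, hv, hX2, hVE, hball⟩ := hcV V hEint hE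
  have hX2' := abs_le.1 (abs_snd_sub_le_of_nsq hη0.le ((nsq_le_sq_iff hη0.le).2 hX2))
  simp only at hX2'
  have hcd : 0 < c * d := by positivity
  have hcd' : c * d ≤ 1 / 8 := by nlinarith
  have htop : ∀ X : Pt n, ‖X.1‖ ≤ r0 → X.2 = h → c4 * V (0, 1) ≤ V X := by
    intro X h1 h2
    have a1 : enorm' (X - (0, 1)) ≤ 1 - 3 / 4 * h := by
      rw [← nsq_le_sq_iff (by linarith)]
      have : ‖X.1‖ ^ 2 ≤ r0 ^ 2 := by gcongr
      simp only [nsq, Prod.fst_sub, Prod.snd_sub, sub_zero, h2]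
      linarith [mul_nonneg hh0.le (sub_nonneg.2 hh1), sq_nonneg h]
    have a2 : enorm' (X - X2) ≤ L' := by
      have := enorm'_sub_le X (0, 1) X2
      rw [enorm'_sub_comm (0, 1) X2] at this
      linarith
    have a3 : nsq (X - X2) ≤ L' ^ 2 := (nsq_le_sq_iff hL'0.le).2 a2
    have a4 : (c * d) ^ 2 ≤ nsq (X - X2) := by
      refine le_trans ?_ (sq_le_nsq _)
      rw [← neg_sq (X - X2).2]
      refine pow_le_pow_left₀ hcd.le ?_ 2
      simp only [Prod.snd_sub, h2]
      linarith [hX2'.1]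
    have a5 := power_lower_bound (X2 := X2) (V := V) (ρ := c * d) (L := L) (τ := h / 4) (q := q)
      (v := v) hn hσ hcd (by positivity) (by linarith) (by linarith [hX2'.1]) hv.le ?_ ?_ hball
      (X := X) (a3.trans (by gcongr)) a4
    · refine le_trans ?_ a5
      have b1 : c2 ≤ nsq (X - X2) ^ (-q) - (L ^ 2) ^ (-q) := by
        refine sub_le_sub_right (Real.rpow_le_rpow_of_nonpos ?_ a3 (by linarith)) _
        exact lt_of_lt_of_le (by positivity) a4
      have b2 : ((c * d) ^ 2) ^ q = c ^ (2 * q) * d ^ (2 * q) := by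
        rw [← Real.rpow_natCast, ← Real.rpow_mul hcd.le, Real.mul_rpow hc0.le hd0.le]
        norm_num
      calc c4 * V (0, 1) = (V (0, 1) * η ^ (2 * q)) / 8 * c ^ (2 * q) * c2 := by rw [hc4]; ring
        _ ≤ (8 * v * d ^ (2 * q)) / 8 * c ^ (2 * q) * c2 := by gcongr
        _ = v * ((c * d) ^ 2) ^ q * c2 := by rw [b2]; ring
        _ ≤ _ := by gcongr
    · have : 2 * L / (h / 4) = 8 / h - 4 := by rw [hL]; field_simp; ring
      rw [this, hq]
      have : 4 * (n + 2 / h) = 4 * n + 8 / h := by ring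
      linarith
    · intro Y hY
      have hL0 : 0 ≤ L := by linarith
      have b1 := abs_le.1 (abs_snd_sub_le_of_nsq hL0 hY)
      refine hint Y ?_ (by linarith [hX2'.1, b1.1])
      rw [nsq_lt_sq_iff (by norm_num)]
      have b2 := (nsq_le_sq_iff hL0).1 hY
      have b3 := enorm'_sub_le Y X2 (0, 1)
      have b4 := enorm'_add_le (Y - (0, 1)) (0, 1)
      rw [sub_add_cancel, hE1] at b4
      linarith
  have := (hV.mono zero_le_two (by norm_num)).flat_lower_bound hn hσ (fun x hx => hg x (by linarith))
    hh0 (by linarith) hr00 hr01 (by rw [hr0s, ← hκ, hh]; ring) (by positivity) htop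
  rw [div_mul_eq_mul_div, le_div_iff₀ hc40]
  linarith

/-- Scaled form of the Harnack inequality. -/
theorem exists_harnack_const_scaled (hn : 0 < n) (hσ : σ ∈ Set.Ioo (0 : ℝ) 1) :
    ∃ C : ℝ, 1 ≤ C ∧ ∀ (r : ℝ) (g : EuclideanSpace ℝ (Fin n) → ℝ) (V : Pt n → ℝ), Sol σ r g V →
      (∀ x, ‖x‖ < r → 0 ≤ g x) → ∀ (x0 : EuclideanSpace ℝ (Fin n)) (ρ : ℝ), 0 ≤ ρ →
      ‖x0‖ + 3 * ρ ≤ r → V (x0, ρ) ≤ C * V (x0, 0) := by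
  obtain ⟨C, hC0, hC⟩ := exists_harnack_const hn hσ (n := n)
  refine ⟨max C 1, le_max_right _ _, fun r g V hV hg x0 ρ hρ hr => ?_⟩
  have h0 : 0 ≤ V (x0, 0) := hV.nonneg _ ⟨by
    rw [nsq_le_sq_iff (by linarith [norm_nonneg x0]), enorm'_flat]; linarith, le_rfl⟩
  rcases hρ.eq_or_lt with rfl | hρ
  · exact le_mul_of_one_le_left h0 (le_max_right _ _)
  have hW := hV.affine hρ (r' := 3) (by norm_num) (x0 := x0) (by linarith)
  have := hC _ _ hW fun x hx => mul_nonneg (by positivity) (hg _ ?_)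
  · simp only [Prod.smul_mk, smul_zero, Prod.mk_add_mk, zero_add, smul_eq_mul, mul_one, add_zero]
      at this
    refine this.trans ?_
    gcongr
    exact le_max_left _ _
  · have h1 := norm_add_le (ρ • x) x0
    rw [norm_smul, Real.norm_eq_abs, abs_of_pos hρ] at h1
    nlinarith

end

section

variable {n : ℕ} {σ : ℝ}

theorem flux_nsq_sub (hσ1 : σ < 1) (x0 x : EuclideanSpace ℝ (Fin n)) :
    Flux σ (fun Y => nsq (Y - (x0, 0))) x 0 := by
  have := (flux_of_fst (σ := σ) (fun y => ‖y - x0‖ ^ 2) x).add (flux_sq hσ1 x)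
  simpa [nsq] using this

theorem norm_fst_le_enorm' (X : Pt n) : ‖X.1‖ ≤ enorm' X :=
  Real.le_sqrt_of_sq_le (norm_sq_le_nsq X)

set_option maxHeartbeats 1000000 in
/-- Horizontal modulus of continuity near the flat boundary. -/
theorem Sol.sub_le_of_osc (hn : 0 < n) (hσ : σ ∈ Set.Ioo (0 : ℝ) 1)
    {r A δ ε τ : ℝ} {g : EuclideanSpace ℝ (Fin n) → ℝ} {V : Pt n → ℝ} (hV : Sol σ r g V)
    (hA : ∀ X ∈ HB n r, V X ≤ A) {Z p p' : EuclideanSpace ℝ (Fin n)} (hδ : 0 < δ)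
    (hr : ‖Z‖ + 2 * δ ≤ r) (hε : 0 < ε) (hosc : ∀ x, ‖x - Z‖ ≤ 2 * δ → |g x - g Z| ≤ ε / 2)
    (hp : ‖p - Z‖ ≤ δ / 2) (hp' : ‖p' - Z‖ ≤ δ / 2) (hne : p ≠ p') (hτ : 0 < τ) (hτδ : τ ≤ δ / 2) :
    V (p, τ) - V (p', τ) ≤ ε * (2 * τ ^ (2 * σ)) + A / δ ^ 2 * (‖p - p'‖ ^ 2 / 4 + τ ^ 2) +
      δ * (ε * τ ^ (2 * σ - 2) * (4 - 4 * σ) + A / δ ^ 2 * (2 * n + 4 - 4 * σ)) *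
        (‖p - p'‖ / 2) := by
  have hr0 : 0 ≤ r := by linarith [norm_nonneg Z]
  have hA0 : 0 ≤ A := (hV.nonneg 0 ⟨by simp [nsq, sq_nonneg], le_rfl⟩).trans
    (hA 0 ⟨by simp [nsq, sq_nonneg], le_rfl⟩)
  set s := ‖p - p'‖ with hs
  have hs0 : 0 < s := norm_pos_iff.2 (sub_ne_zero.2 hne)
  have hsδ : s ≤ δ := by
    have := norm_sub_le (p - Z) (p' - Z)
    rw [sub_sub_sub_cancel_right] at this
    linarith
  set e := s⁻¹ • (p - p') with he
  have he1 : ‖e‖ = 1 := by rw [he, norm_smul, norm_inv, Real.norm_eq_abs, abs_of_pos hs0, ← hs,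
    inv_mul_cancel₀ hs0.ne']
  have hye : p - p' = s • e := by rw [he, smul_inv_smul₀ hs0.ne']
  set xm := p' + (s / 2) • e with hxm
  have hxmp : p - xm = (s / 2) • e := by
    rw [hxm, ← sub_sub, hye]; module
  have hxmZ : ‖xm - Z‖ ≤ δ / 2 := by
    have h1 : xm - Z = (1 / 2 : ℝ) • (p - Z) + (1 / 2 : ℝ) • (p' - Z) := by
      have : xm - Z = (p' - Z) + (1 / 2 : ℝ) • (s • e) := by rw [hxm]; module
      rw [this, ← hye]; module
    rw [h1]
    refine (norm_add_le _ _).trans ?_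
    rw [norm_smul, norm_smul, Real.norm_eq_abs, abs_of_pos (by norm_num)]
    linarith
  set Xm : Pt n := (xm, 0) with hXm
  set S : Set (Pt n) := {X | nsq (X - Xm) ≤ δ ^ 2 ∧ 0 ≤ X.2 ∧ 0 ≤ ⟪X.1 - xm, e⟫} with hS
  have hSc : IsCompact S := by
    refine (isCompact_nsq_sub_le Xm δ).of_isClosed_subset ?_ fun X hX => hX.1
    exact (isCompact_nsq_sub_le Xm δ).isClosed.inter ((isClosed_le continuous_const
      continuous_snd).inter
      (isClosed_le (g := fun X : Pt n => ⟪X.1 - xm, e⟫) continuous_const (by fun_prop)))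
  have hball : ∀ X : Pt n, nsq (X - Xm) ≤ δ ^ 2 → nsq X < r ^ 2 ∧ ‖X.1 - Z‖ ≤ 2 * δ := by
    intro X hX
    have h2 := norm_fst_sub_le_of_nsq hδ.le hX
    rw [nsq_lt_sq_iff hr0]
    rw [nsq_le_sq_iff (by positivity)] at hX
    have h1 := enorm'_add_le (X - Xm) Xm
    rw [sub_add_cancel, hXm, enorm'_flat] at h1
    have h3 := norm_le_norm_add_norm_sub' xm Z
    have h4 := norm_add_le (X.1 - xm) (xm - Z)
    rw [sub_add_sub_cancel] at h4
    constructor <;> linarith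
  have hreflb : ∀ X : Pt n, nsq (X - Xm) ≤ δ ^ 2 → nsq (refl xm e X - Xm) ≤ δ ^ 2 := by
    intro X hX
    rwa [hXm, nsq_refl_sub he1]
  have hSHB : ∀ X ∈ S, X ∈ HB n r := fun X hX => ⟨(hball X hX.1).1.le, hX.2.1⟩
  have hSHB' : ∀ X ∈ S, refl xm e X ∈ HB n r :=
    fun X hX => ⟨(hball _ (hreflb X hX.1)).1.le, hX.2.1⟩
  set T := τ ^ (2 * σ) with hT
  set P := τ ^ (2 * σ - 2) with hP
  have hP0 : 0 < P := Real.rpow_pos_of_pos hτ _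
  have hPT : P * τ ^ 2 = T := by
    rw [hP, hT, Real.rpow_sub hτ]
    norm_cast
    field_simp
  have hTP : ∀ t : ℝ, 0 ≤ t → t ^ (2 * σ) ≤ T + P * t ^ 2 := by
    intro t ht
    rcases le_or_gt t τ with h | h
    · have : t ^ (2 * σ) ≤ T := Real.rpow_le_rpow ht h (by linarith [hσ.1])
      have : 0 ≤ P * t ^ 2 := by positivity
      linarith
    · have ht0 : 0 < t := hτ.trans h
      have h1 : t ^ (2 * σ - 2) ≤ P :=
        Real.rpow_le_rpow_of_nonpos hτ h.le (by linarith [hσ.2])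
      have h2 : t ^ (2 * σ) = t ^ (2 * σ - 2) * t ^ 2 := by
        rw [Real.rpow_sub ht0]
        norm_cast
        field_simp
      have h3 : t ^ (2 * σ - 2) * t ^ 2 ≤ P * t ^ 2 := by gcongr
      have : 0 ≤ T := by positivity
      linarith
  set M := δ * (ε * P * (4 - 4 * σ) + A / δ ^ 2 * (2 * n + 4 - 4 * σ)) with hM
  have hσ4 : 0 ≤ 4 - 4 * σ := by linarith [hσ.2]
  have hM0 : 0 ≤ M := by
    have : (0 : ℝ) ≤ 2 * n + 4 - 4 * σ := by
      have : (0 : ℝ) ≤ n := Nat.cast_nonneg n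
      linarith
    positivity
  set w : Pt n → ℝ := fun X => ε * (T - X.2 ^ (2 * σ) + P * X.2 ^ 2) + A / δ ^ 2 * nsq (X - Xm) +
    M * (⟪X.1 - xm, e⟫ - ⟪X.1 - xm, e⟫ ^ 2 / (2 * δ)) - (V X - V (refl xm e X)) with hw
  have hwc : ContinuousOn w S := by
    have h1 : Continuous fun X : Pt n => X.2 ^ (2 * σ) :=
      continuous_snd.rpow_const fun _ => Or.inr (by linarith [hσ.1])
    refine ContinuousOn.sub (Continuous.continuousOn (by fun_prop)) ((hV.cont.mono hSHB).sub
      (hV.cont.comp (continuous_refl xm e).continuousOn hSHB'))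
  have hpar : ∀ X ∈ S, 0 ≤ M * (⟪X.1 - xm, e⟫ - ⟪X.1 - xm, e⟫ ^ 2 / (2 * δ)) := by
    intro X hX
    have h1 := hX.2.2
    have h2 : ⟪X.1 - xm, e⟫ ≤ δ := inner_le_of_nsq he1 hδ.le hX.1
    refine mul_nonneg hM0 (sub_nonneg.2 ?_)
    rw [div_le_iff₀ (by positivity)]
    nlinarith
  have key := weak_min_principle (w := w) hn hσ hSc hwc ?_ (p, τ) ?_
  · have e2 : refl xm e (p, τ) = (p', τ) := by
      unfold refl
      simp only
      rw [hxmp, inner_smul_left, real_inner_self_eq_norm_sq, he1]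
      ext1
      · have : p = p' + s • e := by rw [← hye]; module
        rw [this]; simp only [conj_trivial]; module
      · simp
    have e3 : nsq ((p, τ) - Xm) = s ^ 2 / 4 + τ ^ 2 := by
      simp only [nsq, hXm, Prod.fst_sub, Prod.snd_sub, hxmp, sub_zero]
      rw [norm_smul, he1, Real.norm_eq_abs, abs_of_pos (by positivity)]
      ring
    simp only [hw] at key
    rw [e2, e3, hxmp, inner_smul_left, real_inner_self_eq_norm_sq, he1, conj_trivial, hPT] at key
    have h2 : 0 ≤ M * ((s / 2 * 1 ^ 2) ^ 2 / (2 * δ)) := by positivity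
    have h3 : 0 ≤ ε * T := by positivity
    linarith
  · intro X hX hneg
    have hV1 := hA X (hSHB X hX)
    have hV2 := hV.nonneg _ (hSHB' X hX)
    have hp := hpar X hX
    have hq0 : 0 ≤ A / δ ^ 2 * nsq (X - Xm) := by have := nsq_nonneg (X - Xm); positivity
    have hε0 : 0 ≤ ε * (T - X.2 ^ (2 * σ) + P * X.2 ^ 2) :=
      mul_nonneg hε.le (by linarith [hTP X.2 hX.2.1])
    have hin1 : nsq (X - Xm) < δ ^ 2 := by
      refine lt_of_le_of_ne hX.1 fun h => ?_
      simp only [hw] at hneg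
      rw [h, div_mul_cancel₀ _ (by positivity)] at hneg
      linarith
    have hin2 : 0 < ⟪X.1 - xm, e⟫ := by
      refine lt_of_le_of_ne hX.2.2 fun h => ?_
      simp only [hw] at hneg
      rw [refl_of_inner_eq_zero h.symm] at hneg
      linarith
    refine ⟨mem_nhdsWithin_HS (O := {Y | nsq (Y - Xm) < δ ^ 2 ∧ 0 < ⟪Y.1 - xm, e⟫}) ?_
      ⟨hin1, hin2⟩ fun Y hY hY0 => ⟨hY.1.le, hY0, hY.2.le⟩, ?_⟩
    · exact (isOpen_nsq_sub_lt Xm _).inter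
        (isOpen_lt (g := fun Y : Pt n => ⟪Y.1 - xm, e⟫) continuous_const (by fun_prop))
    obtain ⟨hXr, hXZ⟩ := hball X hX.1
    obtain ⟨hXr', hXZ'⟩ := hball _ (hreflb X hX.1)
    rcases hX.2.1.eq_or_lt with ht | ht
    · have hr1 : ∀ t : ℝ, refl xm e (X.1, t) = ((refl xm e X).1, t) := fun t => rfl
      have hfr : Flux σ (fun Y => V (refl xm e Y)) X.1 (g (refl xm e X).1) := by
        have : ‖(refl xm e X).1‖ < r := by
          rw [nsq_lt_sq_iff hr0] at hXr'
          exact (norm_fst_le_enorm' _).trans_lt hXr'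
        exact hV.flux _ this
      have hf : Flux σ V X.1 (g X.1) := by
        refine hV.flux _ ?_
        rw [nsq_lt_sq_iff hr0] at hXr
        exact (norm_fst_le_enorm' _).trans_lt hXr
      refine Or.inr ⟨ht.symm, _, (((((flux_const T X.1).sub (flux_rpow hσ.1.ne' X.1)).add
        ((flux_sq hσ.2 X.1).const_mul P)).const_mul ε |>.add
        ((flux_nsq_sub hσ.2 xm X.1).const_mul (A / δ ^ 2))).add
        (flux_of_fst (fun y => M * (⟪y - xm, e⟫ - ⟪y - xm, e⟫ ^ 2 / (2 * δ))) X.1)).sub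
        (hf.sub hfr), ?_⟩
      have h1 := abs_le.1 (hosc _ hXZ)
      have h2 := abs_le.1 (hosc _ hXZ')
      linarith [h1.2, h2.1]
    · have hx1 := hV.eqn X hXr ht
      have hx2 := hasLL_refl he1 (hV.eqn _ hXr' ht)
      have hi : HasLL σ (fun Y => ⟪Y.1 - xm, e⟫ - ⟪Y.1 - xm, e⟫ ^ 2 / (2 * δ)) X
          ((-1 / δ) * ‖e‖ ^ 2) := by
        refine hasLL_comp_inner (fun u => u - u ^ 2 / (2 * δ)) (fun u => 1 - u / δ) _ xm e X ?_ ?_ ?_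
        · fun_prop
        · refine Eventually.of_forall fun u => ?_
          refine ((hasDerivAt_id u).sub ((hasDerivAt_pow 2 u).div_const (2 * δ))).congr_deriv ?_
          norm_num
          field_simp
        · exact (((hasDerivAt_id (⟪X.1 - xm, e⟫)).div_const δ).const_sub 1).congr_deriv
            (by ring)
      refine Or.inl ⟨ht, _, (((((hasLL_const T X).sub (hasLL_rpow_snd ht)).add
        ((hasLL_sq_snd ht).const_mul P)).const_mul ε |>.add
        ((hasLL_qd Xm X).const_mul (A / δ ^ 2))).add (hi.const_mul M)).sub (hx1.sub hx2), ?_⟩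
      refine le_of_eq ?_
      rw [he1, hM, hXm]
      field_simp
      ring
  · refine ⟨?_, hτ.le, ?_⟩
    · simp only [nsq, hXm, Prod.fst_sub, Prod.snd_sub, hxmp, sub_zero]
      rw [norm_smul, he1, Real.norm_eq_abs, abs_of_pos (by positivity)]
      nlinarith
    · simp only [hxmp, inner_smul_left, real_inner_self_eq_norm_sq, he1, conj_trivial]
      positivity

end

section

variable {n : ℕ} {σ : ℝ}

theorem Sol.eventually_abs_sub_le (hn : 0 < n) (hσ : σ ∈ Set.Ioo (0 : ℝ) 1)
    {r C ε : ℝ} {g : EuclideanSpace ℝ (Fin n) → ℝ} {V : Pt n → ℝ} (hV : Sol σ r g V)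
    {Z : EuclideanSpace ℝ (Fin n)} (hZ : ‖Z‖ < r) (hg : ContinuousAt g Z) (hC : 0 ≤ C)
    (hε : 0 < ε) :
    ∀ᶠ τ in 𝓝[>] (0 : ℝ), ∀ y, ‖y - Z‖ ≤ C * τ ^ 2 → |V (y, τ) - V (Z, τ)| ≤ ε * τ ^ (2 * σ) := by
  obtain ⟨A, hA⟩ := (isCompact_HB r).bddAbove_image hV.cont
  have hA : ∀ X ∈ HB n r, V X ≤ A := fun X hX => hA ⟨X, hX, rfl⟩
  have hr0 : 0 < r := (norm_nonneg Z).trans_lt hZ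
  have hA0 : 0 ≤ A := (hV.nonneg 0 ⟨by simp [nsq, sq_nonneg], le_rfl⟩).trans
    (hA 0 ⟨by simp [nsq, sq_nonneg], le_rfl⟩)
  set ε' := ε / (4 + 4 * C) with hε'
  have hε0 : 0 < ε' := by positivity
  obtain ⟨δ0, hδ0, hosc⟩ := Metric.continuousAt_iff.1 hg (ε' / 2) (by positivity)
  set δ := min (min 1 (δ0 / 3)) ((r - ‖Z‖) / 2) with hδ
  have hδp : 0 < δ := by
    have : 0 < r - ‖Z‖ := by linarith
    positivity
  have hδ1 : δ ≤ 1 := (min_le_left _ _).trans (min_le_left _ _)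
  have hδ2 : δ ≤ δ0 / 3 := (min_le_left _ _).trans (min_le_right _ _)
  have hδ3 : δ ≤ (r - ‖Z‖) / 2 := min_le_right _ _
  have hosc' : ∀ x, ‖x - Z‖ ≤ 2 * δ → |g x - g Z| ≤ ε' / 2 := fun x hx => by
    have := hosc (x := x) (by rw [dist_eq_norm]; linarith)
    rw [Real.dist_eq] at this
    exact this.le
  have hσ4 : 0 ≤ 4 - 4 * σ := by linarith [hσ.2]
  set K := A / δ ^ 2 * (2 * n + 4 - 4 * σ) with hK
  have hK0 : 0 ≤ K := by
    have : (0 : ℝ) ≤ 2 * n + 4 - 4 * σ := by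
      have : (0 : ℝ) ≤ n := Nat.cast_nonneg n
      linarith
    positivity
  set K' := A / δ ^ 2 * (C ^ 2 / 4 + 1) + K * C / 2 with hK'
  have e1 : ∀ᶠ τ in 𝓝[>] (0 : ℝ), τ < min 1 (δ / 2) :=
    nhdsWithin_le_nhds (gt_mem_nhds (by positivity))
  have e2 : ∀ᶠ τ in 𝓝[>] (0 : ℝ), C * τ ^ 2 < δ / 2 := by
    have h : Tendsto (fun τ : ℝ => C * τ ^ 2) (𝓝 0) (𝓝 (C * 0 ^ 2)) :=
      (Continuous.tendsto (by fun_prop) 0)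
    refine nhdsWithin_le_nhds (h.eventually (gt_mem_nhds ?_))
    simp [hδp]
  have e3 : ∀ᶠ τ in 𝓝[>] (0 : ℝ), K' * τ ^ (2 - 2 * σ) < ε / 2 := by
    have h : Tendsto (fun τ : ℝ => K' * τ ^ (2 - 2 * σ)) (𝓝 0) (𝓝 (K' * 0 ^ (2 - 2 * σ))) := by
      refine (Continuous.tendsto ?_ 0)
      exact continuous_const.mul (continuous_id.rpow_const fun _ => Or.inr (by linarith [hσ.2]))
    refine nhdsWithin_le_nhds (h.eventually (gt_mem_nhds ?_))
    rw [Real.zero_rpow (by linarith [hσ.2])]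
    linarith
  filter_upwards [e1, e2, e3, self_mem_nhdsWithin] with τ h1 h2 h3 hτ y hy
  have hτ : 0 < τ := hτ
  have hτ1 : τ ≤ 1 := h1.le.trans (min_le_left _ _)
  have hτδ : τ ≤ δ / 2 := h1.le.trans (min_le_right _ _)
  have hyZ : ‖y - Z‖ ≤ δ / 2 := hy.trans h2.le
  rcases eq_or_ne y Z with rfl | hne
  · simp only [sub_self, abs_zero]; positivity
  have hZZ : ‖Z - Z‖ ≤ δ / 2 := by rw [sub_self, norm_zero]; positivity
  have a1 := hV.sub_le_of_osc hn hσ hA hδp (by linarith) hε0 hosc' hyZ hZZ hne hτ hτδ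
  have a2 := hV.sub_le_of_osc hn hσ hA hδp (by linarith) hε0 hosc' hZZ hyZ hne.symm hτ hτδ
  rw [norm_sub_rev Z y] at a2
  set s := ‖y - Z‖ with hs
  have hs0 : 0 ≤ s := norm_nonneg _
  set T := τ ^ (2 * σ) with hT
  have hT0 : 0 < T := Real.rpow_pos_of_pos hτ _
  set P := τ ^ (2 * σ - 2) with hP
  have hP0 : 0 < P := Real.rpow_pos_of_pos hτ _
  have hPT : P * τ ^ 2 = T := by
    rw [hP, hT, Real.rpow_sub hτ]
    norm_cast
    field_simp
  have hT2 : τ ^ (2 - 2 * σ) * T = τ ^ 2 := by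
    rw [hT, ← Real.rpow_add hτ]; simp
  have b1 : A / δ ^ 2 * (s ^ 2 / 4 + τ ^ 2) ≤ A / δ ^ 2 * (C ^ 2 / 4 + 1) * τ ^ 2 := by
    rw [mul_assoc]
    refine mul_le_mul_of_nonneg_left ?_ (by positivity)
    have : s ^ 2 ≤ (C * τ ^ 2) ^ 2 := by gcongr
    have h4 : τ ^ 2 ≤ 1 := pow_le_one₀ hτ.le hτ1
    have : (C * τ ^ 2) ^ 2 ≤ C ^ 2 * τ ^ 2 := by
      have : C ^ 2 * τ ^ 2 * τ ^ 2 ≤ C ^ 2 * τ ^ 2 * 1 := by gcongr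
      linarith
    linarith
  have b2 : δ * (ε' * P * (4 - 4 * σ) + K) * (s / 2) ≤ 1 * (ε' * P * 4 + K) * (C * τ ^ 2 / 2) := by
    gcongr
    linarith [hσ.1]
  have b3 : 1 * (ε' * P * 4 + K) * (C * τ ^ 2 / 2) = 2 * C * ε' * T + K * C / 2 * τ ^ 2 := by
    rw [← hPT]; ring
  have b4 : K' * τ ^ 2 ≤ ε / 2 * T := by
    rw [← hT2, ← mul_assoc]; gcongr
  have b5 : (2 + 2 * C) * ε' = ε / 2 := by rw [hε']; field_simp; ring
  have b6 : ε' * (2 * T) + 2 * C * ε' * T = ε / 2 * T := by rw [← b5]; ring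
  have b7 : K' * τ ^ 2 = A / δ ^ 2 * (C ^ 2 / 4 + 1) * τ ^ 2 + K * C / 2 * τ ^ 2 := by
    rw [hK']; ring
  rw [abs_le]
  constructor <;> linarith

theorem Sol.tendsto_flux (hn : 0 < n) (hσ : σ ∈ Set.Ioo (0 : ℝ) 1)
    {r C : ℝ} {g : EuclideanSpace ℝ (Fin n) → ℝ} {V : Pt n → ℝ} (hV : Sol σ r g V)
    {Z : EuclideanSpace ℝ (Fin n)} (hZ : ‖Z‖ < r) (hg : ContinuousAt g Z) (hC : 0 ≤ C)
    {l : Filter ℝ} {τ : ℝ → ℝ} (hτ : Tendsto τ l (𝓝[>] 0)) {z : ℝ → EuclideanSpace ℝ (Fin n)}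
    (hz : ∀ᶠ t in l, ‖z t - Z‖ ≤ C * τ t ^ 2) :
    Tendsto (fun t => (V (z t, τ t) - V (Z, 0)) / τ t ^ (2 * σ)) l (𝓝 (-g Z)) := by
  have h1 : Tendsto (fun t => (V (Z, τ t) - V (Z, 0)) / τ t ^ (2 * σ)) l (𝓝 (-g Z)) :=
    Tendsto.comp (hV.flux Z hZ) hτ
  have h2 : Tendsto (fun t => (V (z t, τ t) - V (Z, τ t)) / τ t ^ (2 * σ)) l (𝓝 0) := by
    rw [Metric.tendsto_nhds]
    intro ε hε
    have h3 := hτ.eventually (hV.eventually_abs_sub_le hn hσ hZ hg hC (half_pos hε))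
    filter_upwards [h3, hz, hτ.eventually self_mem_nhdsWithin] with t h4 h5 h6
    have hp : 0 < τ t ^ (2 * σ) := Real.rpow_pos_of_pos h6 _
    rw [dist_zero_right, Real.norm_eq_abs, abs_div, abs_of_pos hp, div_lt_iff₀ hp]
    refine (h4 _ h5).trans_lt ?_
    nlinarith
  have h3 := h1.add h2
  rw [add_zero] at h3
  refine h3.congr fun t => ?_
  ring

/-- Neumann data of the Kelvin transform. -/
theorem Sol.flux_kel (hn : 0 < n) (hσ : σ ∈ Set.Ioo (0 : ℝ) 1)
    {r l : ℝ} {g : EuclideanSpace ℝ (Fin n) → ℝ} {V : Pt n → ℝ} (hV : Sol σ r g V) (hl : 0 < l)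
    {y : EuclideanSpace ℝ (Fin n)} (hy : y ≠ 0) (hyr : ‖(l / ‖y‖ ^ 2) • y‖ < r)
    (hg : ContinuousAt g ((l / ‖y‖ ^ 2) • y)) :
    Flux σ (kel σ l V) y
      ((l / ‖y‖ ^ 2) ^ (((n : ℝ) - 2 * σ) / 2 + 2 * σ) * g ((l / ‖y‖ ^ 2) • y)) := by
  have hy0 : 0 < ‖y‖ := norm_pos_iff.2 hy
  set q0 := ‖y‖ ^ 2 with hq0
  have hq : 0 < q0 := by positivity
  set b : ℝ := ((n : ℝ) - 2 * σ) / 2 with hb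
  set r0 := l / q0 with hr0
  have hr0p : 0 < r0 := div_pos hl hq
  set R : ℝ → ℝ := fun t => l / (q0 + t ^ 2) with hR
  have hRp : ∀ t, 0 < R t := fun t => by positivity
  have hRc : Continuous R := by
    refine continuous_const.div (by fun_prop) fun t => ?_
    positivity
  have hR0 : R 0 = r0 := by simp [hR, hr0]
  have hkel : ∀ t, kel σ l V (y, t) = R t ^ b * V (R t • y, R t * t) := fun t => by
    simp [kel, nsq, hR, hq0, hb]
  have hτ : Tendsto (fun t => R t * t) (𝓝[>] 0) (𝓝[>] 0) := by
    refine tendsto_nhdsWithin_iff.2 ⟨?_, ?_⟩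
    · have : Tendsto (fun t : ℝ => R t * t) (𝓝 0) (𝓝 (R 0 * 0)) :=
        (hRc.mul continuous_id).tendsto 0
      rw [mul_zero] at this
      exact this.mono_left nhdsWithin_le_nhds
    · filter_upwards [self_mem_nhdsWithin] with t ht
      exact mul_pos (hRp t) ht
  have hz : ∀ᶠ t in 𝓝[>] (0 : ℝ), ‖R t • y - r0 • y‖ ≤ 2 * ‖y‖ / l * (R t * t) ^ 2 := by
    have : ∀ᶠ t in 𝓝[>] (0 : ℝ), t < ‖y‖ := nhdsWithin_le_nhds (gt_mem_nhds hy0)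
    filter_upwards [this, self_mem_nhdsWithin] with t h1 ht
    have ht : 0 < t := ht
    have h2 : t ^ 2 ≤ q0 := by rw [hq0]; gcongr
    have h3 : r0 - R t = l * t ^ 2 / (q0 * (q0 + t ^ 2)) := by
      rw [hr0, hR]; field_simp; ring
    have h4 : 0 ≤ r0 - R t := by rw [h3]; positivity
    rw [← sub_smul, norm_smul, norm_sub_rev, Real.norm_eq_abs, abs_of_nonneg h4, h3]
    have h5 : 2 * ‖y‖ / l * (R t * t) ^ 2 = l * t ^ 2 / (q0 + t ^ 2) ^ 2 * 2 * ‖y‖ := by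
      rw [hR]; field_simp
    rw [h5]
    gcongr
    rw [div_mul_eq_mul_div, div_le_div_iff₀ (by positivity) (by positivity)]
    have h6 : q0 + t ^ 2 ≤ 2 * q0 := by linarith
    calc l * t ^ 2 * (q0 + t ^ 2) ^ 2 = l * t ^ 2 * (q0 + t ^ 2) * (q0 + t ^ 2) := by ring
      _ ≤ l * t ^ 2 * (q0 + t ^ 2) * (2 * q0) := by gcongr
      _ = _ := by ring
  have h1 := hV.tendsto_flux hn hσ hyr hg (by positivity) hτ hz
  have h2 : Tendsto (fun t => R t ^ (b + 2 * σ)) (𝓝[>] 0) (𝓝 (r0 ^ (b + 2 * σ))) := by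
    have : Tendsto (fun t => R t ^ (b + 2 * σ)) (𝓝 0) (𝓝 (R 0 ^ (b + 2 * σ))) :=
      (hRc.rpow_const fun t => Or.inl (hRp t).ne').tendsto 0
    rw [hR0] at this
    exact this.mono_left nhdsWithin_le_nhds
  have h3 : Flux σ (fun Y : Pt n => (l / nsq Y) ^ b * V (r0 • y, 0)) y 0 := by
    have hd : HasDerivAt (fun u : ℝ => l / (q0 + u)) (-l / q0 ^ 2) 0 := by
      have := (((hasDerivAt_id (0 : ℝ)).const_add q0).inv (by simpa using hq.ne')).const_mul l
      refine (this.congr_deriv (by simp; field_simp)).congr_of_eventuallyEq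
        (Eventually.of_forall fun u => ?_)
      simp [div_eq_mul_inv]
    have hd2 := ((hd.rpow_const (p := b) (Or.inl (by rw [add_zero]; exact hr0p.ne'))).mul_const
      (V (r0 • y, 0)))
    refine flux_of_sq hσ.2 hd2 (Eventually.of_forall fun t => ?_) ?_
    · simp [nsq, hq0]
    · simp [nsq, hq0]
  have h4 := (h2.mul h1).add h3
  unfold Flux
  rw [neg_zero, add_zero, mul_neg] at h4
  refine h4.congr' ?_
  filter_upwards [self_mem_nhdsWithin] with t ht
  have ht : 0 < t := ht
  have hRt := hRp t
  have e1 : R t ^ (b + 2 * σ) = R t ^ b * R t ^ (2 * σ) := Real.rpow_add hRt _ _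
  have e2 : nsq ((y, t) : Pt n) = q0 + t ^ 2 := rfl
  have e3 : nsq ((y, 0) : Pt n) = q0 := by simp [nsq, hq0]
  have hp1 := Real.rpow_pos_of_pos hRt (2 * σ)
  have hp2 := Real.rpow_pos_of_pos ht (2 * σ)
  rw [hkel, hkel, hR0, mul_zero, Real.mul_rpow hRt.le ht.le, e1, e2, e3]
  change R t ^ b * R t ^ (2 * σ) * ((V (R t • y, R t * t) - V (r0 • y, 0)) /
    (R t ^ (2 * σ) * t ^ (2 * σ))) + (R t ^ b * V (r0 • y, 0) - r0 ^ b * V (r0 • y, 0)) /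
    t ^ (2 * σ) = _
  field_simp
  ring

end

/-! ### Moving spheres -/

/-- The critical exponent. -/
def critExp (n : ℕ) (σ : ℝ) : ℝ := ((n : ℝ) + 2 * σ) / ((n : ℝ) - 2 * σ)

section

variable {n : ℕ} {σ : ℝ}

theorem dim_sub_pos (hn : 2 ≤ n) (hσ : σ ∈ Set.Ioo (0 : ℝ) 1) : 0 < (n : ℝ) - 2 * σ := by
  have : (2 : ℝ) ≤ n := by exact_mod_cast hn
  linarith [hσ.2]

theorem one_lt_critExp (hn : 2 ≤ n) (hσ : σ ∈ Set.Ioo (0 : ℝ) 1) : 1 < critExp n σ := by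
  rw [critExp, lt_div_iff₀ (dim_sub_pos hn hσ)]
  linarith [hσ.1]

theorem critExp_mul (hn : 2 ≤ n) (hσ : σ ∈ Set.Ioo (0 : ℝ) 1) :
    ((n : ℝ) - 2 * σ) / 2 * critExp n σ = ((n : ℝ) - 2 * σ) / 2 + 2 * σ := by
  have := (dim_sub_pos hn hσ).ne'
  rw [critExp]
  field_simp
  ring

theorem kel_of_nsq_eq {V : Pt n → ℝ} {l : ℝ} (hl : 0 < l) {Y : Pt n} (hY : nsq Y = l) :
    kel σ l V Y = V Y := by
  rw [kel, hY, div_self hl.ne', Real.one_rpow, one_mul, one_smul]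

theorem nsq_inv_smul {l : ℝ} {Y : Pt n} (hY : 0 < nsq Y) :
    nsq ((l / nsq Y) • Y) = l ^ 2 / nsq Y := by
  rw [nsq_smul]; field_simp

theorem nsq_inv_smul_le {l : ℝ} (hl : 0 < l) {Y : Pt n} (hY : l ≤ nsq Y) :
    nsq ((l / nsq Y) • Y) ≤ nsq Y := by
  have hq : 0 < nsq Y := hl.trans_le hY
  rw [nsq_inv_smul hq, div_le_iff₀ hq, ← sq]
  gcongr

theorem inv_smul_mem_HB {l Λ : ℝ} (hl : 0 < l) {Y : Pt n} (hY : l ≤ nsq Y) (hYΛ : Y ∈ HB n Λ) :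
    (l / nsq Y) • Y ∈ HB n Λ :=
  ⟨(nsq_inv_smul_le hl hY).trans hYΛ.1, mul_nonneg (div_nonneg hl.le (nsq_nonneg Y)) hYΛ.2⟩

theorem continuousOn_kel {V : Pt n → ℝ} {Λ : ℝ} (hV : ContinuousOn V (HB n Λ)) :
    ContinuousOn (fun z : ℝ × Pt n => kel σ z.1 V z.2)
      {z | 0 < z.1 ∧ z.1 ≤ nsq z.2 ∧ z.2 ∈ HB n Λ} := by
  have hr : ContinuousOn (fun z : ℝ × Pt n => z.1 / nsq z.2)
      {z | 0 < z.1 ∧ z.1 ≤ nsq z.2 ∧ z.2 ∈ HB n Λ} :=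
    continuousOn_fst.div (Continuous.continuousOn (by fun_prop))
      fun z hz => (hz.1.trans_le hz.2.1).ne'
  refine ContinuousOn.mul (hr.rpow_const fun z hz => Or.inl
    (div_pos hz.1 (hz.1.trans_le hz.2.1)).ne') ?_
  exact hV.comp (hr.smul continuousOn_snd) fun z hz => inv_smul_mem_HB hz.1 hz.2.1 hz.2.2

theorem kel_nonneg {V : Pt n → ℝ} {l : ℝ} (hl : 0 < l) {Y : Pt n}
    (h : 0 ≤ V ((l / nsq Y) • Y)) : 0 ≤ kel σ l V Y :=
  mul_nonneg (Real.rpow_nonneg (div_nonneg hl.le (nsq_nonneg Y)) _) h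

variable {Λ : ℝ} {V : Pt n → ℝ}

theorem kel_le (hn : 2 ≤ n) (hσ : σ ∈ Set.Ioo (0 : ℝ) 1) {l A : ℝ} (hl : 0 < l) {Y : Pt n}
    (hY : l ≤ nsq Y) (hA0 : 0 ≤ A) (hA : V ((l / nsq Y) • Y) ≤ A) : kel σ l V Y ≤ A := by
  have hq : 0 < nsq Y := hl.trans_le hY
  have h1 : (l / nsq Y) ^ (((n : ℝ) - 2 * σ) / 2) ≤ 1 :=
    Real.rpow_le_one (by positivity) ((div_le_one hq).2 hY) (by linarith [dim_sub_pos hn hσ])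
  calc kel σ l V Y ≤ (l / nsq Y) ^ (((n : ℝ) - 2 * σ) / 2) * A := by unfold kel; gcongr
    _ ≤ 1 * A := by gcongr
    _ = A := one_mul A

theorem Sol.hasLL_sub_kel {g : EuclideanSpace ℝ (Fin n) → ℝ} (hV : Sol σ Λ g V) {l : ℝ}
    (hl : 0 < l) {X : Pt n} (h1 : l ≤ nsq X) (h2 : nsq X < Λ ^ 2) (ht : 0 < X.2) :
    HasLL σ (fun Y => V Y - kel σ l V Y) X 0 := by
  refine ((hV.eqn X h2 ht).sub (hasLL_kel hl ht (hV.eqn _ ?_ ?_))).congr_val (sub_zero 0)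
  · exact (nsq_inv_smul_le hl h1).trans_lt h2
  · exact mul_pos (div_pos hl (nsq_pos ht)) ht

theorem ContinuousOn.continuousAt_flat (hV : ContinuousOn V (HB n Λ)) {x : EuclideanSpace ℝ (Fin n)}
    (hx : ‖x‖ < Λ) : ContinuousAt (fun y => V (y, 0)) x := by
  have h1 : ContinuousWithinAt V (HB n Λ) (x, 0) :=
    hV _ ⟨by simp [nsq]; gcongr, le_rfl⟩
  refine h1.tendsto.comp (tendsto_nhdsWithin_iff.2 ⟨?_, ?_⟩)
  · exact Continuous.tendsto (by fun_prop) x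
  · have : ∀ᶠ y in 𝓝 x, ‖y‖ < Λ := continuous_norm.continuousAt.eventually (gt_mem_nhds hx)
    filter_upwards [this] with y hy
    exact ⟨by simp [nsq]; gcongr, le_rfl⟩

/-- Neumann data of the critical problem. -/
def critData (σ : ℝ) (V : Pt n → ℝ) (x : EuclideanSpace ℝ (Fin n)) : ℝ :=
  V (x, 0) ^ critExp n σ / (2 * σ)

theorem Sol.flux_sub_kel (hn : 2 ≤ n) (hσ : σ ∈ Set.Ioo (0 : ℝ) 1) (hV : Sol σ Λ (critData σ V) V)
    {l : ℝ} (hl : 0 < l) {X : Pt n} (h1 : l ≤ nsq X) (h2 : nsq X < Λ ^ 2) (ht : X.2 = 0)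
    (hΛ : 0 ≤ Λ) :
    Flux σ (fun Y => V Y - kel σ l V Y) X.1
      ((V X ^ critExp n σ - kel σ l V X ^ critExp n σ) / (2 * σ)) := by
  obtain ⟨y, t⟩ := X
  simp only at ht
  subst ht
  have hq : nsq ((y, 0) : Pt n) = ‖y‖ ^ 2 := by simp [nsq]
  have hq0 : 0 < nsq ((y, 0) : Pt n) := hl.trans_le h1
  have hy : y ≠ 0 := by
    rintro rfl
    simp [nsq] at hq0
  have h3 := (nsq_inv_smul_le hl h1).trans_lt h2
  rw [nsq_lt_sq_iff hΛ, hq, Prod.smul_mk, smul_zero, enorm'_flat] at h3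
  have h4 : ‖y‖ < Λ := by rwa [nsq_lt_sq_iff hΛ, enorm'_flat] at h2
  have hc : ContinuousAt (critData σ V) ((l / ‖y‖ ^ 2) • y) := by
    refine ((ContinuousOn.continuousAt_flat hV.cont h3).rpow_const (Or.inr ?_)).div_const _
    linarith [one_lt_critExp hn hσ]
  have h5 := hV.flux_kel (by omega) hσ hl hy h3 hc
  refine ((hV.flux y h4).sub h5).congr_val ?_
  have hr : 0 < l / ‖y‖ ^ 2 := by rw [← hq]; positivity
  have h6 : 0 ≤ V ((l / ‖y‖ ^ 2) • y, 0) := by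
    refine hV.nonneg _ ⟨?_, le_rfl⟩
    rw [nsq_le_sq_iff hΛ, enorm'_flat]; exact h3.le
  simp only [critData, kel, hq, Prod.smul_mk, smul_zero]
  rw [Real.mul_rpow (by positivity) h6, ← Real.rpow_mul hr.le, critExp_mul hn hσ]
  ring

/-- Lipschitz bound for powers on bounded intervals. -/
theorem rpow_sub_rpow_le {p M s t : ℝ} (hp : 1 ≤ p) (hs : 0 ≤ s) (hst : s ≤ t) (htM : t ≤ M) :
    t ^ p - s ^ p ≤ p * M ^ (p - 1) * (t - s) := by
  have h := Convex.norm_image_sub_le_of_norm_hasDerivWithin_le (f := fun x : ℝ => x ^ p)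
    (f' := fun x => p * x ^ (p - 1)) (s := Set.Icc 0 M) (C := p * M ^ (p - 1)) (x := s) (y := t)
    (fun x hx => (Real.hasDerivAt_rpow_const (Or.inr hp)).hasDerivWithinAt) (fun x hx => ?_)
    (convex_Icc 0 M) ⟨hs, hst.trans htM⟩ ⟨hs.trans hst, htM⟩
  · rw [Real.norm_eq_abs, Real.norm_eq_abs, abs_of_nonneg (sub_nonneg.2 hst)] at h
    exact (le_abs_self _).trans h
  · have : 0 ≤ x ^ (p - 1) := Real.rpow_nonneg hx.1 _
    rw [Real.norm_eq_abs, abs_of_nonneg (by positivity)]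
    have : x ^ (p - 1) ≤ M ^ (p - 1) := Real.rpow_le_rpow hx.1 hx.2 (by linarith)
    gcongr

/-- Comparison with the Kelvin transform in narrow shells. -/
theorem Sol.exists_narrow_const (hn : 2 ≤ n) (hσ : σ ∈ Set.Ioo (0 : ℝ) 1) (hΛ : 0 < Λ)
    (hV : Sol σ Λ (critData σ V) V) :
    ∃ D : ℝ, 0 < D ∧ ∀ l μ : ℝ, 0 < l → l ≤ μ → μ ≤ Λ ^ 2 → D * (μ - l) ^ 2 ≤ l →
      (∀ Y : Pt n, nsq Y = μ → 0 ≤ Y.2 → kel σ l V Y ≤ V Y) →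
      ∀ Y : Pt n, l ≤ nsq Y → nsq Y ≤ μ → 0 ≤ Y.2 → kel σ l V Y ≤ V Y := by
  obtain ⟨A, hA⟩ := (isCompact_HB Λ).bddAbove_image hV.cont
  have hA : ∀ X ∈ HB n Λ, V X ≤ A := fun X hX => hA ⟨X, hX, rfl⟩
  have hA0 : 0 ≤ A := (hV.nonneg 0 ⟨by simp [nsq, sq_nonneg], le_rfl⟩).trans
    (hA 0 ⟨by simp [nsq, sq_nonneg], le_rfl⟩)
  set p := critExp n σ with hp
  have hp1 : 1 < p := one_lt_critExp hn hσ
  set b : ℝ := p * A ^ (p - 1) / (2 * σ) with hb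
  have hσ0 := hσ.1
  have hb0 : 0 ≤ b := by positivity
  obtain ⟨D, hD0, hD⟩ := exists_barrier_const hσ (B := 2 * b + 1) (by positivity)
  refine ⟨D, hD0, fun l μ hl hlμ hμ hDμ hout Y hY1 hY2 hY3 => ?_⟩
  set B := 2 * b + 1 with hB
  set S : Set (Pt n) := {X | l ≤ nsq X ∧ nsq X ≤ μ ∧ 0 ≤ X.2} with hS
  have hSHB : S ⊆ HB n Λ := fun X hX => ⟨hX.2.1.trans hμ, hX.2.2⟩
  have hSc : IsCompact S := by
    refine (isCompact_HB Λ).of_isClosed_subset ?_ hSHB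
    exact (isClosed_le continuous_const continuous_nsq).inter
      ((isClosed_le continuous_nsq continuous_const).inter isClosed_HS)
  set φ : Pt n → ℝ := fun X => 1 - B * X.2 ^ (2 * σ) + D * X.2 ^ 2 +
    D / l * ((μ - l) ^ 2 - (nsq (X - 0) - l) ^ 2) with hφ
  have hφc : Continuous φ := by
    have h1 : Continuous fun X : Pt n => X.2 ^ (2 * σ) :=
      continuous_snd.rpow_const fun _ => Or.inr (by linarith)
    fun_prop
  have hsq : ∀ X ∈ S, (nsq (X - 0) - l) ^ 2 ≤ (μ - l) ^ 2 := by
    intro X hX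
    rw [sub_zero]
    have := hX.1
    have := hX.2.1
    have : 0 ≤ nsq X - l := by linarith
    gcongr
  have hkc : ContinuousOn (kel σ l V) S :=
    (continuousOn_kel (σ := σ) hV.cont).comp (f := fun X : Pt n => (l, X))
      (Continuous.continuousOn (by fun_prop)) fun X hX => ⟨hl, hX.1, hSHB hX⟩
  have key := robin_min_principle (σ := σ) (w := fun X => V X - kel σ l V X) (φ := φ) hSc
    ((hV.cont.mono hSHB).sub hkc) hφc.continuousOn (fun X hX => ?_) ?_ Y ⟨hY1, hY2, hY3⟩
  · linarith
  · have h1 := hD X.2 hX.2.2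
    have h2 : 0 ≤ D / l * ((μ - l) ^ 2 - (nsq (X - 0) - l) ^ 2) :=
      mul_nonneg (by positivity) (sub_nonneg.2 (hsq X hX))
    simp only [hφ]
    linarith
  · intro X hX hneg
    have h1 : l < nsq X := by
      refine lt_of_le_of_ne hX.1 fun h => ?_
      rw [kel_of_nsq_eq hl h.symm, sub_self] at hneg
      exact lt_irrefl _ hneg
    have h2 : nsq X < μ := by
      refine lt_of_le_of_ne hX.2.1 fun h => ?_
      linarith [hout X h hX.2.2]
    refine ⟨mem_nhdsWithin_HS (O := {Y | l < nsq Y ∧ nsq Y < μ}) ?_ ⟨h1, h2⟩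
      fun Z hZ hZ0 => ⟨hZ.1.le, hZ.2.le, hZ0⟩, ?_⟩
    · exact (isOpen_lt continuous_const continuous_nsq).inter
        (isOpen_lt continuous_nsq continuous_const)
    have h3 : nsq X < Λ ^ 2 := h2.trans_le hμ
    rcases hX.2.2.eq_or_lt with ht | ht
    · have hf := hV.flux_sub_kel hn hσ hl hX.1 h3 ht.symm hΛ.le
      have hd : HasDerivAt (fun u : ℝ => D / l * ((μ - l) ^ 2 - (‖X.1‖ ^ 2 + u - l) ^ 2))
          (D / l * (- (2 * (‖X.1‖ ^ 2 - l)))) 0 := by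
        have h0 : HasDerivAt (fun u : ℝ => ‖X.1‖ ^ 2 + u - l) 1 0 :=
          ((hasDerivAt_id (0 : ℝ)).const_add _).sub_const _
        refine ((((h0.pow 2).const_sub ((μ - l) ^ 2))).const_mul (D / l)).congr_deriv ?_
        simp
      have hfq : Flux σ (fun Y : Pt n => D / l * ((μ - l) ^ 2 - (nsq (Y - 0) - l) ^ 2)) X.1 0 :=
        flux_of_sq hσ.2 hd (Eventually.of_forall fun t => by simp [nsq]) (by simp [nsq])
      have hfφ := (((flux_const 1 X.1).sub ((flux_rpow hσ0.ne' X.1).const_mul B)).add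
        ((flux_sq hσ.2 X.1).const_mul D)).add hfq
      refine Or.inr ⟨ht.symm, _, _, hf, hfφ, ?_⟩
      have hV0 := hV.nonneg X (hSHB hX)
      have hkA : kel σ l V X ≤ A := kel_le hn hσ hl hX.1 hA0
        (hA _ (inv_smul_mem_HB hl hX.1 (hSHB hX)))
      have hlip := rpow_sub_rpow_le (p := p) hp1.le hV0 (by linarith) hkA
      have hφX : φ X ≤ 2 := by
        simp only [hφ, ← ht]
        rw [Real.zero_rpow (by linarith)]
        have : D / l * ((μ - l) ^ 2 - (nsq (X - 0) - l) ^ 2) ≤ 1 := by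
          rw [div_mul_eq_mul_div, div_le_one hl]
          nlinarith [sq_nonneg (nsq (X - 0) - l)]
        linarith
      have hφX0 : 0 < φ X := by
        have h2 : 0 ≤ D / l * ((μ - l) ^ 2 - (nsq (X - 0) - l) ^ 2) :=
          mul_nonneg (by positivity) (sub_nonneg.2 (hsq X hX))
        have := hD X.2 hX.2.2
        simp only [hφ]
        linarith
      set W := kel σ l V X - V X with hW
      have hW0 : 0 < W := by linarith
      have e1 : -(V X - kel σ l V X) = W := by ring
      have e2 : 0 - B * -1 + D * 0 + 0 = B := by ring
      rw [e1, e2]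
      have e3 : -(b * W) ≤ (V X ^ p - kel σ l V X ^ p) / (2 * σ) := by
        rw [le_div_iff₀ (by positivity)]
        have : -(b * W) * (2 * σ) = -(p * A ^ (p - 1) * W) := by rw [hb]; field_simp
        rw [this]
        linarith
      have e4 : W / 2 ≤ W / φ X := by gcongr
      have e5 : W / 2 * B ≤ W / φ X * B := by gcongr
      nlinarith
    · refine Or.inl ⟨ht, _, _, hV.hasLL_sub_kel hl hX.1 h3 ht,
        (((hasLL_const 1 X).sub ((hasLL_rpow_snd ht).const_mul B)).add
          ((hasLL_sq_snd ht).const_mul D)).add (HasLL.const_mul (D / l)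
          ((hasLL_const ((μ - l) ^ 2) X).sub (hasLL_comp_qd (fun u => (u - l) ^ 2)
            (fun u => 2 * (u - l)) 2 0 X (by fun_prop) (Eventually.of_forall fun u => ?_) ?_))),
        le_rfl, ?_⟩
      · refine (((hasDerivAt_id u).sub_const l).pow 2).congr_deriv ?_
        simp
      · exact (((hasDerivAt_id _).sub_const l).const_mul 2).congr_deriv (by ring)
      · simp only [sub_zero, Prod.snd_zero, mul_zero, zero_sub, zero_add]
        have e1 : 2 * ((1 - 2 * σ) / X.2) * X.2 = 2 * (1 - 2 * σ) := by field_simp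
        rw [e1]
        have e2 : 8 * l ≤ 2 * (nsq X - l) * (2 * n + 2 + 2 * (1 - 2 * σ)) + 4 * nsq X * 2 := by
          have : (0 : ℝ) ≤ n := Nat.cast_nonneg n
          have : 0 ≤ 2 * (nsq X - l) * (2 * n + 2 + 2 * (1 - 2 * σ)) :=
            mul_nonneg (by linarith) (by linarith [hσ.2])
          linarith
        have e3 : D / l * (8 * l) ≤
            D / l * (2 * (nsq X - l) * (2 * n + 2 + 2 * (1 - 2 * σ)) + 4 * nsq X * 2) := by gcongr
        have e4 : D / l * (8 * l) = 8 * D := by field_simp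
        have : 0 < D * σ := by positivity
        linarith

end

section

variable {n : ℕ} {σ Λ : ℝ} {V : Pt n → ℝ}

theorem Sol.kel_lt_of_kel_le (hn : 2 ≤ n) (hσ : σ ∈ Set.Ioo (0 : ℝ) 1) (hΛ : 0 < Λ)
    (hV : Sol σ Λ (critData σ V) V) {l η : ℝ} (hl : 0 < l) (hη : 0 < η)
    (hle : ∀ Y : Pt n, l ≤ nsq Y → nsq Y ≤ Λ ^ 2 → 0 ≤ Y.2 → kel σ l V Y ≤ V Y)
    (hout : ∀ Y : Pt n, nsq Y = Λ ^ 2 → 0 ≤ Y.2 → kel σ l V Y + η ≤ V Y)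
    {Y : Pt n} (h1 : l < nsq Y) (h2 : nsq Y ≤ Λ ^ 2) (h3 : 0 ≤ Y.2) : kel σ l V Y < V Y := by
  set b : ℝ := ((n : ℝ) - 2 * σ) / 2 with hb
  have hb0 : 0 < b := by have := dim_sub_pos hn hσ; positivity
  set S : Set (Pt n) := {X | l ≤ nsq X ∧ nsq X ≤ Λ ^ 2 ∧ 0 ≤ X.2} with hS
  have hSHB : S ⊆ HB n Λ := fun X hX => hX.2
  have hSc : IsCompact S := by
    refine (isCompact_HB Λ).of_isClosed_subset ?_ hSHB
    exact (isClosed_le continuous_const continuous_nsq).inter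
      ((isClosed_le continuous_nsq continuous_const).inter isClosed_HS)
  have hkc : ContinuousOn (kel σ l V) S :=
    (continuousOn_kel (σ := σ) hV.cont).comp (f := fun X : Pt n => (l, X))
      (Continuous.continuousOn (by fun_prop)) fun X hX => ⟨hl, hX.1, hSHB hX⟩
  set c := η * l ^ b with hc
  have hc0 : 0 < c := by positivity
  have hfc : ContinuousOn (fun X : Pt n => c * (l ^ (-b) - nsq X ^ (-b))) S :=
    continuousOn_const.mul (continuousOn_const.sub (continuous_nsq.continuousOn.rpow_const
      fun X hX => Or.inl (hl.trans_le hX.1).ne'))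
  have key := weak_min_principle (by omega) hσ hSc
    (w := fun X => V X - kel σ l V X - c * (l ^ (-b) - nsq X ^ (-b)))
    (((hV.cont.mono hSHB).sub hkc).sub hfc) (fun X hX hneg => ?_) Y ⟨h1.le, h2, h3⟩
  · have : nsq Y ^ (-b) < l ^ (-b) := Real.rpow_lt_rpow_of_neg hl h1 (by linarith)
    have : 0 < c * (l ^ (-b) - nsq Y ^ (-b)) := mul_pos hc0 (sub_pos.2 this)
    linarith
  · have h1 : l < nsq X := by
      refine lt_of_le_of_ne hX.1 fun h => ?_
      rw [kel_of_nsq_eq hl h.symm, ← h] at hneg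
      simp at hneg
    have h2 : nsq X < Λ ^ 2 := by
      refine lt_of_le_of_ne hX.2.1 fun h => ?_
      have e1 := hout X h hX.2.2
      have e2 : 0 ≤ c * nsq X ^ (-b) := mul_nonneg hc0.le (Real.rpow_nonneg (nsq_nonneg X) _)
      have e3 : c * l ^ (-b) = η := by
        rw [hc, mul_assoc, ← Real.rpow_add hl]; simp
      linarith
    refine ⟨mem_nhdsWithin_HS (O := {Y | l < nsq Y ∧ nsq Y < Λ ^ 2}) ?_ ⟨h1, h2⟩
      fun Z hZ hZ0 => ⟨hZ.1.le, hZ.2.le, hZ0⟩, ?_⟩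
    · exact (isOpen_lt continuous_const continuous_nsq).inter
        (isOpen_lt continuous_nsq continuous_const)
    rcases hX.2.2.eq_or_lt with ht | ht
    · refine Or.inr ⟨ht.symm, _, (hV.flux_sub_kel hn hσ hl hX.1 h2 ht.symm hΛ.le).sub
        (Flux.const_mul c ((flux_const _ X.1).sub
          (flux_of_sq (F := fun u => (‖X.1‖ ^ 2 + u) ^ (-b)) hσ.2
            (b := -b * (‖X.1‖ ^ 2) ^ (-b - 1)) ?_
            (Eventually.of_forall fun t => by simp [nsq]) (by simp [nsq])))), ?_⟩
      · have hq : nsq X = ‖X.1‖ ^ 2 := by simp [nsq, ← ht]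
        have h0 : HasDerivAt (fun u : ℝ => ‖X.1‖ ^ 2 + u) 1 0 :=
          (hasDerivAt_id (0 : ℝ)).const_add _
        refine (h0.rpow_const (p := -b) (Or.inl ?_)).congr_deriv ?_
        · rw [add_zero, ← hq]; exact (hl.trans h1).ne'
        · simp
      · simp only [sub_zero, mul_zero]
        have hk : 0 ≤ kel σ l V X := kel_nonneg hl
          (hV.nonneg _ (inv_smul_mem_HB hl hX.1 (hSHB hX)))
        have := one_lt_critExp hn hσ
        have := hσ.1
        have : kel σ l V X ^ critExp n σ ≤ V X ^ critExp n σ :=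
          Real.rpow_le_rpow hk (hle X hX.1 hX.2.1 hX.2.2) (by linarith)
        exact div_nonneg (by linarith) (by linarith)
    · refine Or.inl ⟨ht, _, (hV.hasLL_sub_kel hl hX.1 h2 ht).sub
        (HasLL.const_mul c ((hasLL_const _ X).sub (hasLL_fund ht))), ?_⟩
      simp

/-- The set of radii for which the Kelvin comparison holds is closed. -/
theorem isClosed_kel_le (hV : ContinuousOn V (HB n Λ)) {l₁ l₀ : ℝ} (hl₁ : 0 < l₁) :
    IsClosed ({l | ∀ Y : Pt n, l ≤ nsq Y → nsq Y ≤ Λ ^ 2 → 0 ≤ Y.2 → kel σ l V Y ≤ V Y} ∩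
      Set.Icc l₁ l₀) := by
  have : ({l | ∀ Y : Pt n, l ≤ nsq Y → nsq Y ≤ Λ ^ 2 → 0 ≤ Y.2 → kel σ l V Y ≤ V Y} ∩
      Set.Icc l₁ l₀) = Set.Icc l₁ l₀ ∩ ⋂ Y ∈ HB n Λ, (Set.Ici (nsq Y) ∪
        {l | l ∈ Set.Icc l₁ (nsq Y) ∧ kel σ l V Y ≤ V Y}) := by
    ext l
    simp only [Set.mem_inter_iff, Set.mem_iInter, Set.mem_union, Set.mem_ofPred_eq, Set.mem_Ici,
      Set.mem_Icc]
    constructor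
    · rintro ⟨h, hl⟩
      refine ⟨hl, fun Y hY => ?_⟩
      rcases le_total (nsq Y) l with h1 | h1
      · exact Or.inl h1
      · exact Or.inr ⟨⟨hl.1, h1⟩, h Y h1 hY.1 hY.2⟩
    · rintro ⟨hl, h⟩
      refine ⟨fun Y h1 h2 h3 => ?_, hl⟩
      rcases h Y ⟨h2, h3⟩ with h4 | h4
      · exact (kel_of_nsq_eq (hl₁.trans_le hl.1) (le_antisymm h4 h1)).le
      · exact h4.2
  rw [this]
  refine isClosed_Icc.inter (isClosed_biInter fun Y hY => isClosed_Ici.union ?_)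
  have hc : ContinuousOn (fun l => kel σ l V Y) (Set.Icc l₁ (nsq Y)) :=
    (continuousOn_kel (σ := σ) hV).comp (f := fun l : ℝ => (l, Y))
      (Continuous.continuousOn (by fun_prop)) fun l hl => ⟨hl₁.trans_le hl.1, hl.2, hY⟩
  exact hc.preimage_isClosed_of_isClosed isClosed_Icc (isClosed_Iic (a := V Y))

theorem Sol.kel_le_nhdsGT (hn : 2 ≤ n) (hσ : σ ∈ Set.Ioo (0 : ℝ) 1) (hΛ : 0 < Λ)
    (hV : Sol σ Λ (critData σ V) V) {l : ℝ} (hl : 0 < l) (hlΛ : l < Λ ^ 2)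
    (hlt : ∀ Y : Pt n, l < nsq Y → nsq Y ≤ Λ ^ 2 → 0 ≤ Y.2 → kel σ l V Y < V Y) :
    {l | ∀ Y : Pt n, l ≤ nsq Y → nsq Y ≤ Λ ^ 2 → 0 ≤ Y.2 → kel σ l V Y ≤ V Y} ∈ 𝓝[>] l := by
  obtain ⟨D, hD0, hD⟩ := hV.exists_narrow_const hn hσ hΛ
  obtain ⟨δ, hδ0, hδΛ, hδ⟩ : ∃ δ : ℝ, 0 < δ ∧ δ ≤ Λ ^ 2 - l ∧ D * δ ^ 2 ≤ l := by
    refine ⟨min (Λ ^ 2 - l) (Real.sqrt (l / D)), lt_min (sub_pos.2 hlΛ) (by positivity),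
      min_le_left _ _, ?_⟩
    have h1 : 0 ≤ min (Λ ^ 2 - l) (Real.sqrt (l / D)) :=
      (lt_min (sub_pos.2 hlΛ) (by positivity)).le
    calc D * min (Λ ^ 2 - l) (Real.sqrt (l / D)) ^ 2 ≤ D * Real.sqrt (l / D) ^ 2 := by
          gcongr; exact min_le_right _ _
      _ = l := by rw [Real.sq_sqrt (by positivity)]; field_simp
  set K : Set (Pt n) := {X | l + δ ≤ nsq X ∧ nsq X ≤ Λ ^ 2 ∧ 0 ≤ X.2} with hK
  have hKHB : K ⊆ HB n Λ := fun X hX => hX.2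
  have hKc : IsCompact K := by
    refine (isCompact_HB Λ).of_isClosed_subset ?_ hKHB
    exact (isClosed_le continuous_const continuous_nsq).inter
      ((isClosed_le continuous_nsq continuous_const).inter isClosed_HS)
  have hev : ∀ᶠ l' in 𝓝 l, ∀ Y ∈ K, Y ∈ K → kel σ l' V Y < V Y := by
    refine hKc.eventually_forall_of_forall_eventually fun Y hY => ?_
    have hT : (l, Y) ∈ {z : ℝ × Pt n | 0 < z.1 ∧ z.1 ≤ nsq z.2 ∧ z.2 ∈ HB n Λ} :=
      ⟨hl, by linarith [hY.1], hKHB hY⟩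
    have h1 := continuousOn_kel (σ := σ) hV.cont (l, Y) hT
    have h2 : ContinuousWithinAt (fun z : ℝ × Pt n => V z.2)
        {z : ℝ × Pt n | 0 < z.1 ∧ z.1 ≤ nsq z.2 ∧ z.2 ∈ HB n Λ} (l, Y) :=
      (hV.cont.comp (f := fun z : ℝ × Pt n => z.2) continuousOn_snd fun z hz => hz.2.2) _ hT
    have h3 := h1.tendsto.eventually_lt h2.tendsto (hlt Y (by linarith [hY.1]) hY.2.1 hY.2.2)
    rw [eventually_nhdsWithin_iff] at h3
    have h4 : ∀ᶠ z : ℝ × Pt n in 𝓝 (l, Y), 0 < z.1 ∧ z.1 < l + δ :=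
      (continuous_fst.continuousAt.eventually (lt_mem_nhds hl)).and
        (continuous_fst.continuousAt.eventually (gt_mem_nhds (by simpa using hδ0)))
    filter_upwards [h3, h4] with z hz3 hz4 hzK
    exact hz3 ⟨hz4.1, by linarith [hzK.1], hKHB hzK⟩
  filter_upwards [nhdsWithin_le_nhds hev,
    nhdsWithin_le_nhds (gt_mem_nhds (show l < l + δ by linarith)), self_mem_nhdsWithin]
    with l' h1 h2 h3 Y hY1 hY2 hY3
  have h3 : l < l' := h3
  rcases le_total (l + δ) (nsq Y) with h | h
  · exact (h1 Y ⟨h, hY2, hY3⟩ ⟨h, hY2, hY3⟩).le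
  · refine hD l' (l + δ) (hl.trans h3) h2.le (by linarith) ?_ (fun Z hZ hZ0 => ?_) Y hY1 h hY3
    · have : (l + δ - l') ^ 2 ≤ δ ^ 2 := by
        have : 0 ≤ l + δ - l' := by linarith
        gcongr
        linarith
      nlinarith
    · have hZK : Z ∈ K := ⟨hZ.ge, by linarith, hZ0⟩
      exact (h1 Z hZK hZK).le

theorem Sol.exists_kel_le_start (hn : 2 ≤ n) (hσ : σ ∈ Set.Ioo (0 : ℝ) 1) (hΛ : 0 < Λ)
    (hV : Sol σ Λ (critData σ V) V) {m l₀ : ℝ} (hm : 0 < m) (hmV : ∀ X ∈ HB n Λ, m ≤ V X)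
    (hl₀ : 0 < l₀) :
    ∃ l, 0 < l ∧ l ≤ l₀ ∧
      ∀ Y : Pt n, l ≤ nsq Y → nsq Y ≤ Λ ^ 2 → 0 ≤ Y.2 → kel σ l V Y ≤ V Y := by
  set b : ℝ := ((n : ℝ) - 2 * σ) / 2 with hb
  have hb0 : 0 < b := by have := dim_sub_pos hn hσ; positivity
  obtain ⟨D, hD0, hD⟩ := hV.exists_narrow_const hn hσ hΛ
  obtain ⟨A, hA⟩ := (isCompact_HB Λ).bddAbove_image hV.cont
  have hA : ∀ X ∈ HB n Λ, V X ≤ A := fun X hX => hA ⟨X, hX, rfl⟩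
  have hA0 : 0 < A := (hm.trans_le (hmV 0 ⟨by simp [nsq, sq_nonneg], le_rfl⟩)).trans_le
    (hA 0 ⟨by simp [nsq, sq_nonneg], le_rfl⟩)
  have hmA : m ≤ A := (hmV 0 ⟨by simp [nsq, sq_nonneg], le_rfl⟩).trans
    (hA 0 ⟨by simp [nsq, sq_nonneg], le_rfl⟩)
  set k := (A / m) ^ (1 / b) with hk
  have hk1 : 1 ≤ k := Real.one_le_rpow ((one_le_div hm).2 hmA) (by positivity)
  have hkb : k ^ b = A / m := by
    rw [hk, ← Real.rpow_mul (by positivity), one_div_mul_cancel hb0.ne', Real.rpow_one]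
  set l := min l₀ (min (Λ ^ 2 / k) (1 / (D * k ^ 2))) with hl
  have hl0 : 0 < l := by positivity
  have hl1 : l ≤ l₀ := min_le_left _ _
  have hl2 : k * l ≤ Λ ^ 2 := by
    have : l ≤ Λ ^ 2 / k := (min_le_right _ _).trans (min_le_left _ _)
    rw [le_div_iff₀ (by positivity)] at this
    linarith
  have hl3 : D * k ^ 2 * l ≤ 1 := by
    have : l ≤ 1 / (D * k ^ 2) := (min_le_right _ _).trans (min_le_right _ _)
    rw [le_div_iff₀ (by positivity)] at this
    linarith
  have hlk : l ≤ k * l := by nlinarith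
  have hfar : ∀ Y : Pt n, k * l ≤ nsq Y → nsq Y ≤ Λ ^ 2 → 0 ≤ Y.2 → kel σ l V Y ≤ V Y := by
    intro Y h1 h2 h3
    have hq : 0 < nsq Y := by linarith
    have e1 : l / nsq Y ≤ 1 / k := by
      rw [div_le_div_iff₀ hq (by positivity)]; linarith
    have e2 : (l / nsq Y) ^ b ≤ m / A := by
      calc (l / nsq Y) ^ b ≤ (1 / k) ^ b := by gcongr
        _ = m / A := by
          rw [Real.div_rpow zero_le_one (by positivity), hkb, Real.one_rpow, one_div_div]
    calc kel σ l V Y ≤ m / A * A := by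
          unfold kel
          have e3 := inv_smul_mem_HB hl0 (hlk.trans h1) (⟨h2, h3⟩ : Y ∈ HB n Λ)
          have e4 := hV.nonneg _ e3
          have e5 := hA _ e3
          gcongr
      _ = m := by field_simp
      _ ≤ V Y := hmV Y ⟨h2, h3⟩
  refine ⟨l, hl0, hl1, fun Y h1 h2 h3 => ?_⟩
  rcases le_total (k * l) (nsq Y) with h | h
  · exact hfar Y h h2 h3
  · refine hD l (k * l) hl0 hlk hl2 ?_ (fun Z hZ hZ0 => hfar Z hZ.ge (by linarith) hZ0) Y h1 h h3
    have e1 : D * (k * l - l) ^ 2 = D * (k - 1) ^ 2 * l * l := by ring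
    have e2 : D * (k - 1) ^ 2 * l ≤ D * k ^ 2 * l := by
      have : 0 ≤ k - 1 := by linarith
      gcongr
      linarith
    rw [e1]
    nlinarith

/-- The method of moving spheres: the solution dominates its Kelvin transform. -/
theorem Sol.kel_le_self (hn : 2 ≤ n) (hσ : σ ∈ Set.Ioo (0 : ℝ) 1) (hΛ : 0 < Λ)
    (hV : Sol σ Λ (critData σ V) V) {m A l₀ : ℝ} (hm : 0 < m) (hmV : ∀ X ∈ HB n Λ, m ≤ V X)
    (hl₀ : 0 < l₀) (hlΛ : l₀ < Λ ^ 2)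
    (hA : ∀ X ∈ HB n (l₀ / Λ), V X ≤ A)
    (hAm : (l₀ / Λ ^ 2) ^ (((n : ℝ) - 2 * σ) / 2) * A < m) {Y : Pt n} (h1 : l₀ ≤ nsq Y)
    (h2 : nsq Y ≤ Λ ^ 2) (h3 : 0 ≤ Y.2) : kel σ l₀ V Y ≤ V Y := by
  have hb0 : 0 < ((n : ℝ) - 2 * σ) / 2 := by have := dim_sub_pos hn hσ; positivity
  obtain ⟨l₁, hl₁, hl₁₀, hst⟩ := hV.exists_kel_le_start hn hσ hΛ hm hmV hl₀
  have hA0 : 0 ≤ A := by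
    have h0 : (0 : Pt n) ∈ HB n (l₀ / Λ) := ⟨by simp [nsq]; positivity, le_rfl⟩
    have h0' : (0 : Pt n) ∈ HB n Λ := ⟨by simp [nsq]; positivity, le_rfl⟩
    exact (hV.nonneg 0 h0').trans (hA 0 h0)
  refine (isClosed_kel_le (σ := σ) (l₀ := l₀) hV.cont hl₁).Icc_subset_of_forall_mem_nhdsWithin
    hst (fun l hl => ?_) ⟨hl₁₀, le_rfl⟩ Y h1 h2 h3
  obtain ⟨hls, hl⟩ := hl
  have hl0 : 0 < l := hl₁.trans_le hl.1
  refine hV.kel_le_nhdsGT hn hσ hΛ hl0 (hl.2.trans hlΛ) fun Z hZ1 hZ2 hZ3 => ?_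
  refine hV.kel_lt_of_kel_le hn hσ hΛ hl0 (sub_pos.2 hAm) hls (fun X hX hX0 => ?_) hZ1 hZ2 hZ3
  have hXΛ : X ∈ HB n Λ := ⟨hX.le, hX0⟩
  have hq : 0 < nsq X := by rw [hX]; positivity
  have hr : V ((l / nsq X) • X) ≤ A := by
    refine hA _ ⟨?_, mul_nonneg (div_nonneg hl0.le hq.le) hX0⟩
    rw [nsq_inv_smul hq, hX, div_pow]
    have := hl.2.le
    gcongr
  have hk : kel σ l V X ≤ (l₀ / Λ ^ 2) ^ (((n : ℝ) - 2 * σ) / 2) * A := by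
    have e1 : l / nsq X ≤ l₀ / Λ ^ 2 := by rw [hX]; have := hl.2.le; gcongr
    calc kel σ l V X ≤ (l / nsq X) ^ (((n : ℝ) - 2 * σ) / 2) * A := by unfold kel; gcongr
      _ ≤ _ := by gcongr
  linarith [hmV X hXΛ]

end

section

variable {n : ℕ} {σ : ℝ}

set_option maxHeartbeats 1000000 in
/-- Near a normalized near-maximum point, moving spheres prevents the trace from becoming small. -/
theorem exists_trace_compare_const (hn : 2 ≤ n) (hσ : σ ∈ Set.Ioo (0 : ℝ) 1) :
    ∃ ε C : ℝ, 0 < ε ∧ ε ≤ 1 ∧ 1 ≤ C ∧ ∀ (R : ℝ) (U : Pt n → ℝ), 0 < R →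
      Sol σ (3 * R) (critData σ U) U → ∀ m : ℝ, 0 < m → (∀ x, ‖x‖ ≤ 2 * R → m ≤ U (x, 0)) →
      ∀ (z : EuclideanSpace ℝ (Fin n)) (A d s : ℝ), ‖z‖ ≤ 3 * R / 2 → 0 < A → d ≤ R / 2 →
      (∀ x, ‖x - z‖ ≤ d / 2 → U (x, 0) ≤ A) → 0 < s → s ≤ ε / 4 * d →
      (32 * s ^ 2 / (ε * R) ^ 2) ^ (((n : ℝ) - 2 * σ) / 2) * (C * A) < m / 4 →
      ∀ y, ‖y - z‖ ≤ s → (1 / 2) ^ (((n : ℝ) - 2 * σ) / 2) * U (z, 0) ≤ U (y, 0) := by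
  obtain ⟨ε, hε0, hε1, hε⟩ := exists_half_ball_lower_bound (n := n) (by omega) hσ
  obtain ⟨C, hC1, hC⟩ := exists_harnack_const_scaled (n := n) (by omega) hσ
  refine ⟨ε, C, hε0, hε1, hC1, ?_⟩
  intro R U hR hU m hm hmU z A d s hz hA hd hdA hs hsd hsm y hy
  have hb0 : 0 < ((n : ℝ) - 2 * σ) / 2 := by have := dim_sub_pos hn hσ; positivity
  set b : ℝ := ((n : ℝ) - 2 * σ) / 2 with hb
  have hσ0 := hσ.1
  have hd0 : 0 < d := by
    by_contra h
    have : ε / 4 * d ≤ 0 := mul_nonpos_of_nonneg_of_nonpos (by positivity) (not_lt.1 h)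
    linarith
  have hsd4 : s ≤ d / 4 := by nlinarith
  have hflat : ∀ x : EuclideanSpace ℝ (Fin n), ‖x‖ ≤ 3 * R → 0 ≤ U (x, 0) := fun x hx =>
    hU.nonneg _ ⟨by rw [nsq_le_sq_iff (by positivity), enorm'_flat]; exact hx, le_rfl⟩
  rcases eq_or_ne y z with rfl | hyz
  · have h1 : (1 / 2 : ℝ) ^ b ≤ 1 := Real.rpow_le_one (by norm_num) (by norm_num) hb0.le
    have h2 := hflat y (by linarith)
    nlinarith
  set w := y - z with hw
  have hw0 : 0 < ‖w‖ := norm_pos_iff.2 (sub_ne_zero.2 hyz)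
  set x := z - w with hx
  have hxn : ‖x‖ ≤ 3 * R / 2 + s := (norm_sub_le _ _).trans (by linarith)
  set L := ε * R / 4 with hL
  have hL0 : 0 < L := by positivity
  have hLR : L ≤ R / 4 := by rw [hL]; nlinarith
  set l := 2 * ‖w‖ ^ 2 with hl
  have hl0 : 0 < l := by positivity
  have hls : l ≤ 2 * s ^ 2 := by rw [hl]; gcongr
  have hsL : s ≤ L / 2 := by rw [hL]; nlinarith
  have hlL : l < L ^ 2 := by nlinarith
  have hlLd : l / L ≤ d / 4 := by
    rw [div_le_iff₀ hL0]
    have e1 : 2 * s ^ 2 ≤ 2 * (ε / 4 * d) * s := by nlinarith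
    have e2 : 2 * (ε / 4 * d) * s ≤ 2 * (ε / 4 * d) * (d / 4) := by gcongr
    have e3 : 2 * (ε / 4 * d) * (d / 4) = d / 4 * (ε * (d / 2)) := by ring
    have e4 : d / 4 * (ε * (d / 2)) ≤ d / 4 * (ε * (R / 4)) := by
      have : d / 2 ≤ R / 4 := by linarith
      gcongr
    rw [hL]
    linarith
  have hW := hU.affine one_pos (r' := L) hL0.le (x0 := x) (by linarith)
  set W : Pt n → ℝ := fun Y => U ((1 : ℝ) • Y + (x, 0)) with hWdef
  have hWeq : ∀ Y, W Y = U (Y + (x, 0)) := fun Y => by simp [hWdef]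
  have hW' : Sol σ L (critData σ W) W := by
    convert hW using 2 with q
    simp [critData, hWdef]
  have hmW : ∀ X ∈ HB n L, m / 4 ≤ W X := fun X hX => by
    rw [hWeq]
    refine hε (3 * R) _ U hU x (R / 4) m (by positivity) hm.le (by linarith) (fun q hq => hmU q ?_)
      X (hX.1.trans_eq (by rw [hL]; ring)) hX.2
    have : ‖q‖ ≤ ‖q - x‖ + ‖x‖ := by simpa using norm_add_le (q - x) x
    linarith
  have hAW : ∀ X ∈ HB n (l / L), W X ≤ C * A := fun X hX => by
    rw [hWeq]
    have h1 : ‖X.1‖ ≤ l / L :=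
      (norm_fst_le_enorm' X).trans ((nsq_le_sq_iff (by positivity)).1 hX.1)
    have h2 : X.2 ≤ l / L := by
      have := (sq_le_nsq X).trans hX.1
      exact (sq_le_sq₀ hX.2 (by positivity)).1 this
    have h3 : X + (x, 0) = (X.1 + x, X.2) := by ext <;> simp
    have h4 : ‖X.1 + x‖ ≤ ‖X.1‖ + ‖x‖ := norm_add_le _ _
    rw [h3]
    refine (hC (3 * R) _ U hU (fun q hq => ?_) (X.1 + x) X.2 hX.2 (by linarith)).trans ?_
    · have := hflat q hq.le
      unfold critData
      positivity
    · have : U (X.1 + x, 0) ≤ A := by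
        refine hdA _ ?_
        have h5 : X.1 + x - z = X.1 - w := by rw [hx]; abel
        rw [h5]
        exact (norm_sub_le _ _).trans (by linarith)
      gcongr
  have hcond : (l / L ^ 2) ^ b * (C * A) < m / 4 := by
    refine lt_of_le_of_lt ?_ hsm
    have : l / L ^ 2 ≤ 32 * s ^ 2 / (ε * R) ^ 2 := by
      rw [hL, div_le_div_iff₀ (by positivity) (by positivity)]
      have : 0 ≤ (ε * R) ^ 2 := by positivity
      nlinarith
    gcongr
  have hq : nsq (((2 : ℝ) • w, 0) : Pt n) = 4 * ‖w‖ ^ 2 := by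
    simp [nsq, norm_smul, mul_pow]; norm_num
  have hs2 : ‖w‖ ^ 2 ≤ s ^ 2 := by gcongr
  have key := hW'.kel_le_self hn hσ hL0 (m := m / 4) (by positivity) hmW hl0 hlL hAW hcond
    (Y := ((2 : ℝ) • w, 0)) (by rw [hq]; nlinarith) (by rw [hq]; nlinarith) le_rfl
  have e1 : l / (4 * ‖w‖ ^ 2) = 1 / 2 := by rw [hl]; field_simp; norm_num
  rw [kel, hq, e1, hWeq, hWeq] at key
  have e2 : (1 / 2 : ℝ) • (((2 : ℝ) • w, 0) : Pt n) + (x, 0) = (z, 0) := by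
    ext1
    · simp [hx, smul_smul]
    · simp
  have e3 : (((2 : ℝ) • w, 0) : Pt n) + (x, 0) = (y, 0) := by
    ext1
    · simp only [Prod.fst_add, hx, hw, two_smul]; abel
    · simp
  rwa [e2, e3] at key

end

section

variable {n : ℕ} {σ : ℝ}

theorem contDiffAt_of_contDiffOn {R : ℝ} {U : Pt n → ℝ}
    (h : ContDiffOn ℝ 2 U {X : Pt n | enorm' X < R ∧ 0 < X.2}) {X : Pt n} (hX : enorm' X < R)
    (ht : 0 < X.2) : ContDiffAt ℝ 2 U X := by
  refine h.contDiffAt (IsOpen.mem_nhds ?_ ⟨hX, ht⟩)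
  exact (isOpen_lt continuous_enorm' continuous_const).inter
    (isOpen_lt continuous_const continuous_snd)

theorem flux_of_tendsto {R : ℝ} {U : Pt n → ℝ} (hσ : σ ∈ Set.Ioo (0 : ℝ) 1)
    (hc : ContinuousOn U {X : Pt n | enorm' X ≤ R ∧ 0 ≤ X.2})
    (h : ContDiffOn ℝ 2 U {X : Pt n | enorm' X < R ∧ 0 < X.2})
    {x : EuclideanSpace ℝ (Fin n)} (hx : ‖x‖ < R) {g : ℝ}
    (hg : Tendsto (fun t : ℝ => t ^ (1 - 2 * σ) * dt U (x, t)) (𝓝[>] 0) (𝓝 (-g))) :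
    Flux σ U x (g / (2 * σ)) := by
  have hσ0 := hσ.1
  have hl : Continuous fun t : ℝ => ((x, t) : Pt n) := by fun_prop
  have hev : ∀ᶠ t : ℝ in 𝓝[>] 0, enorm' ((x, t) : Pt n) < R :=
    nhdsWithin_le_nhds (((continuous_enorm'.comp hl).continuousAt (x := 0)).eventually
      (gt_mem_nhds (by simpa [enorm'_flat] using hx)))
  refine HasDerivAt.lhopital_zero_nhdsGT (f' := fun t => dt U (x, t))
    (g' := fun t => 2 * σ * t ^ (2 * σ - 1)) ?_ ?_ ?_ ?_ ?_ ?_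
  · filter_upwards [hev, self_mem_nhdsWithin] with t ht ht0
    have h1 := (contDiffAt_of_contDiffOn h ht ht0).differentiableAt (by norm_num)
    have h2 : HasDerivAt (fun s : ℝ => ((x, s) : Pt n)) (0, 1) t :=
      (hasDerivAt_const t x).prodMk (hasDerivAt_id t)
    exact (h1.hasFDerivAt.comp_hasDerivAt t h2).sub_const _
  · filter_upwards [self_mem_nhdsWithin] with t ht
    exact Real.hasDerivAt_rpow_const (Or.inl (ne_of_gt ht))
  · filter_upwards [self_mem_nhdsWithin] with t ht
    have ht : (0 : ℝ) < t := ht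
    positivity
  · have h1 : Tendsto (fun t : ℝ => ((x, t) : Pt n)) (𝓝[>] 0)
        (𝓝[{X : Pt n | enorm' X ≤ R ∧ 0 ≤ X.2}] (x, 0)) := by
      refine tendsto_nhdsWithin_iff.2 ⟨(hl.tendsto 0).mono_left nhdsWithin_le_nhds, ?_⟩
      filter_upwards [hev, self_mem_nhdsWithin] with t ht ht0
      exact ⟨ht.le, le_of_lt ht0⟩
    have h2 := (hc (x, 0) ⟨by rw [enorm'_flat]; exact hx.le, le_rfl⟩).tendsto.comp h1
    simpa using h2.sub_const (U (x, 0))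
  · have : ContinuousAt (fun t : ℝ => t ^ (2 * σ)) 0 :=
      Real.continuousAt_rpow_const _ _ (Or.inr (by linarith))
    have := this.tendsto.mono_left (nhdsWithin_le_nhds (s := Set.Ioi 0))
    rwa [Real.zero_rpow (by positivity)] at this
  · have := hg.div_const (2 * σ)
    rw [← neg_div]
    refine this.congr' ?_
    filter_upwards [self_mem_nhdsWithin] with t ht
    have ht : (0 : ℝ) < t := ht
    have e1 : t ^ (2 * σ - 1) = (t ^ (1 - 2 * σ))⁻¹ := by
      rw [← Real.rpow_neg ht.le]; congr 1; ring
    have : 0 < t ^ (1 - 2 * σ) := by positivity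
    rw [e1]
    field_simp

/-- The trace of a solution on a disc has a weighted maximum point. -/
theorem exists_doubling_point {u : EuclideanSpace ℝ (Fin n) → ℝ} {b r : ℝ} (hb : 0 < b)
    (hr : 0 < r) {x₀ : EuclideanSpace ℝ (Fin n)} (hu : ContinuousOn u (Metric.closedBall x₀ r))
    (hu0 : ∀ x ∈ Metric.closedBall x₀ r, 0 ≤ u x) (hpos : 0 < u x₀) :
    ∃ z d, ‖z - x₀‖ ≤ r ∧ 0 < d ∧ d ≤ r ∧ u x₀ ≤ u z ∧
      (∀ x, ‖x - z‖ ≤ d / 2 → u x ≤ 2 ^ b * u z) ∧ u x₀ * r ^ b ≤ u z * d ^ b := by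
  set f : EuclideanSpace ℝ (Fin n) → ℝ := fun x => u x * (r - ‖x - x₀‖) ^ b with hf
  have hfc : ContinuousOn f (Metric.closedBall x₀ r) :=
    hu.mul (ContinuousOn.rpow_const (Continuous.continuousOn (by fun_prop))
      fun x _ => Or.inr hb.le)
  obtain ⟨z, hz, hmax⟩ := (isCompact_closedBall x₀ r).exists_isMaxOn
    ⟨x₀, Metric.mem_closedBall_self hr.le⟩ hfc
  have hz' : ‖z - x₀‖ ≤ r := by rwa [mem_closedBall_iff_norm] at hz
  have h0 : u x₀ * r ^ b ≤ u z * (r - ‖z - x₀‖) ^ b := by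
    have := hmax (Metric.mem_closedBall_self hr.le)
    simpa [hf] using this
  have hd0 : 0 < r - ‖z - x₀‖ := by
    refine lt_of_le_of_ne (sub_nonneg.2 hz') fun h => ?_
    rw [← h, Real.zero_rpow hb.ne', mul_zero] at h0
    have : 0 < u x₀ * r ^ b := by positivity
    linarith
  have hdr : r - ‖z - x₀‖ ≤ r := by linarith [norm_nonneg (z - x₀)]
  refine ⟨z, r - ‖z - x₀‖, hz', hd0, hdr, ?_, fun x hx => ?_, h0⟩
  · have h1 : u z * (r - ‖z - x₀‖) ^ b ≤ u z * r ^ b := by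
      have := hu0 z hz
      gcongr
    exact le_of_mul_le_mul_right (h0.trans h1) (by positivity)
  · set d := r - ‖z - x₀‖ with hd
    have h1 : ‖x - x₀‖ ≤ ‖x - z‖ + ‖z - x₀‖ := norm_sub_le_norm_sub_add_norm_sub x z x₀
    have h2 : d / 2 ≤ r - ‖x - x₀‖ := by linarith
    have h3 : x ∈ Metric.closedBall x₀ r := by rw [mem_closedBall_iff_norm]; linarith
    have h4 : u x * (r - ‖x - x₀‖) ^ b ≤ u z * d ^ b := hmax h3
    have h5 : u x * (d / 2) ^ b ≤ u x * (r - ‖x - x₀‖) ^ b := by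
      have := hu0 x h3
      gcongr
    have h6 : (d / 2) ^ b * 2 ^ b = d ^ b := by
      rw [← Real.mul_rpow (by positivity) (by positivity), div_mul_cancel₀ _ two_ne_zero]
    refine le_of_mul_le_mul_right (h5.trans (h4.trans_eq ?_)) (by positivity : 0 < (d / 2) ^ b)
    rw [← h6]; ring

set_option maxHeartbeats 1000000 in
theorem exists_trace_product_const (hn : 2 ≤ n) (hσ : σ ∈ Set.Ioo (0 : ℝ) 1) :
    ∃ C : ℝ, 0 < C ∧ ∀ (R : ℝ) (U : Pt n → ℝ), 0 < R →
      Sol σ (3 * R) (critData σ U) U → ∀ m : ℝ, (∀ x, ‖x‖ ≤ 2 * R → m ≤ U (x, 0)) →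
      ∀ x₀ : EuclideanSpace ℝ (Fin n), ‖x₀‖ ≤ R → U (x₀, 0) * m ≤ C * R ^ (2 * σ - (n : ℝ)) := by
  obtain ⟨ε, K, hε0, hε1, hK1, hcomp⟩ := exists_trace_compare_const hn hσ
  have hb0 : 0 < ((n : ℝ) - 2 * σ) / 2 := by have := dim_sub_pos hn hσ; positivity
  have hRb : 2 * σ - (n : ℝ) = -(2 * (((n : ℝ) - 2 * σ) / 2)) := by ring
  rw [hRb]
  have hpb := critExp_mul hn hσ
  set b : ℝ := ((n : ℝ) - 2 * σ) / 2 with hb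
  set p := critExp n σ with hp
  have hσ0 := hσ.1
  have hB0 := cylB_pos (n := n) hσ
  set B := cylB n σ with hB
  set ρ : ℝ := (4 * σ * B * 2 ^ (b * p)) ^ (1 / (2 * σ)) with hρ
  have hρ0 : 0 < ρ := by positivity
  have hρσ : ρ ^ (2 * σ) = 4 * σ * B * 2 ^ (b * p) := by
    rw [hρ, ← Real.rpow_mul (by positivity), one_div_mul_cancel (by positivity), Real.rpow_one]
  set C₁ : ℝ := (4 * ρ / ε * 2) ^ (2 * b) with hC₁
  set C₂ : ℝ := 4 * (32 * ρ ^ 2 / ε ^ 2) ^ b * (K * 2 ^ b) with hC₂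
  have hK0 : 0 < K := by linarith
  have hC₁0 : 0 < C₁ := by positivity
  have hC₂0 : 0 < C₂ := by positivity
  refine ⟨C₁ + C₂, by positivity, fun R U hR hU m hm x₀ hx₀ => ?_⟩
  have hR0 : 0 < R ^ (-(2 * b)) := by positivity
  by_contra! hcon
  have hcon1 : C₁ * R ^ (-(2 * b)) < U (x₀, 0) * m := by nlinarith
  have hcon2 : C₂ * R ^ (-(2 * b)) < U (x₀, 0) * m := by nlinarith
  have hU0 : 0 ≤ U (x₀, 0) := hU.nonneg _
    ⟨by rw [nsq_le_sq_iff (by positivity), enorm'_flat]; linarith, le_rfl⟩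
  have hmul : 0 < U (x₀, 0) * m := lt_trans (by positivity) hcon1
  have hU0 : 0 < U (x₀, 0) := by
    refine lt_of_le_of_ne hU0 fun h => ?_
    rw [← h, zero_mul] at hmul
    exact lt_irrefl _ hmul
  have hm0 : 0 < m := pos_of_mul_pos_right hmul hU0.le
  have hmU : m ≤ U (x₀, 0) := hm x₀ (by linarith)
  have hball : ∀ x ∈ Metric.closedBall x₀ (R / 2), ‖x‖ ≤ 3 * R / 2 := fun x hx => by
    rw [mem_closedBall_iff_norm] at hx
    have : ‖x‖ ≤ ‖x - x₀‖ + ‖x₀‖ := by simpa using norm_add_le (x - x₀) x₀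
    linarith
  obtain ⟨z, d, hz, hd0, hdR, hxz, hdoub, hdb⟩ := exists_doubling_point
    (u := fun x => U (x, 0)) hb0 (half_pos hR) (x₀ := x₀)
    (fun x hx => (ContinuousOn.continuousAt_flat hU.cont
      (by linarith [hball x hx])).continuousWithinAt)
    (fun x hx => hU.nonneg _ ⟨by
      rw [nsq_le_sq_iff (by positivity), enorm'_flat]; linarith [hball x hx], le_rfl⟩) hU0
  have hzR : ‖z‖ ≤ 3 * R / 2 := hball z (by rwa [mem_closedBall_iff_norm])
  set N := U (z, 0) with hN
  have hN0 : 0 < N := hU0.trans_le hxz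
  set s := ρ * N ^ (-(1 / b)) with hs
  have hs0 : 0 < s := by positivity
  have hNb : (N ^ (-(1 / b))) ^ b = N⁻¹ := by
    rw [← Real.rpow_mul hN0.le, neg_mul, one_div_mul_cancel hb0.ne', Real.rpow_neg_one]
  -- the rescaled neighbourhood of `z` has to fit into the disc
  have hsd : s ≤ ε / 4 * d := by
    by_contra! hlt
    have h1 : d < 4 * ρ / ε * N ^ (-(1 / b)) := by
      have e : 4 * ρ / ε * N ^ (-(1 / b)) = 4 / ε * s := by rw [hs]; ring
      rw [e]
      calc d = 4 / ε * (ε / 4 * d) := by field_simp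
        _ < 4 / ε * s := by gcongr
    have h2 : d ^ b ≤ (4 * ρ / ε) ^ b * N⁻¹ := by
      rw [← hNb, ← Real.mul_rpow (by positivity) (by positivity)]
      gcongr
    have h3 : U (x₀, 0) * (R / 2) ^ b ≤ (4 * ρ / ε) ^ b := by
      refine hdb.trans ?_
      calc N * d ^ b ≤ N * ((4 * ρ / ε) ^ b * N⁻¹) := by gcongr
        _ = (4 * ρ / ε) ^ b := by field_simp
    have h4 : U (x₀, 0) ≤ (4 * ρ / ε * 2) ^ b * R ^ (-b) := by
      rw [Real.div_rpow hR.le zero_le_two] at h3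
      rw [Real.mul_rpow (by positivity) zero_le_two, Real.rpow_neg hR.le, ← div_eq_mul_inv,
        le_div_iff₀ (by positivity)]
      rw [← mul_div_assoc, div_le_iff₀ (by positivity)] at h3
      exact h3
    have h5 : U (x₀, 0) * m ≤ ((4 * ρ / ε * 2) ^ b * R ^ (-b)) * ((4 * ρ / ε * 2) ^ b * R ^ (-b)) :=
      mul_le_mul h4 (hmU.trans h4) hm0.le (by positivity)
    have h6 : ((4 * ρ / ε * 2) ^ b * R ^ (-b)) * ((4 * ρ / ε * 2) ^ b * R ^ (-b)) =
        C₁ * R ^ (-(2 * b)) := by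
      rw [hC₁, two_mul b, neg_add, Real.rpow_add (by positivity), Real.rpow_add hR]; ring
    linarith
  have hcond : (32 * s ^ 2 / (ε * R) ^ 2) ^ b * (K * (2 ^ b * N)) < m / 4 := by
    have e1 : 32 * s ^ 2 / (ε * R) ^ 2 = 32 * ρ ^ 2 / ε ^ 2 * ((N ^ (-(1 / b))) ^ 2 * (R⁻¹) ^ 2) := by
      rw [hs]; field_simp
    have e2 : ((N ^ (-(1 / b))) ^ 2) ^ b = (N⁻¹) ^ 2 := by
      rw [← hNb, Real.rpow_pow_comm (Real.rpow_nonneg hN0.le _) b 2]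
    have e3 : ((R⁻¹) ^ 2) ^ b = R ^ (-(2 * b)) := by
      rw [← Real.rpow_natCast, ← Real.rpow_mul (by positivity), Real.inv_rpow hR.le,
        Real.rpow_neg hR.le]
      norm_num
    rw [e1, Real.mul_rpow (by positivity) (by positivity),
      Real.mul_rpow (by positivity) (by positivity), e2, e3]
    have h1 : C₂ * R ^ (-(2 * b)) < N * m := hcon2.trans_le (by gcongr)
    have h2 : (32 * ρ ^ 2 / ε ^ 2) ^ b * (N⁻¹ ^ 2 * R ^ (-(2 * b))) * (K * (2 ^ b * N)) =
        C₂ * R ^ (-(2 * b)) / (4 * N) := by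
      rw [hC₂]; field_simp
    rw [h2, div_lt_iff₀ (by positivity)]
    linarith
  have hlow := hcomp R U hR hU m hm0 hm z (2 ^ b * N) d s hzR (by positivity) hdR hdoub hs0 hsd hcond
  have hfin := hU.le_of_flux_ge (by omega) hσ hs0 (x0 := z)
    (c := ((1 / 2) ^ b * N) ^ p / (2 * σ)) (by positivity) (by nlinarith)
    (fun x hx => by
      have h1 := hlow x hx.le
      have := one_lt_critExp hn hσ
      unfold critData
      gcongr)
  have e1 : s ^ (2 * σ) * N ^ p = ρ ^ (2 * σ) * N := by
    have h1 : p = 1 + 2 * σ / b := by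
      rw [← mul_right_inj' hb0.ne', hpb]; field_simp
    rw [hs, Real.mul_rpow hρ0.le (by positivity), ← Real.rpow_mul hN0.le, mul_assoc,
      ← Real.rpow_add hN0, h1]
    have : -(1 / b) * (2 * σ) + (1 + 2 * σ / b) = 1 := by ring
    rw [this, Real.rpow_one]
  have e2 : ((1 / 2 : ℝ) ^ b) ^ p * 2 ^ (b * p) = 1 := by
    rw [← Real.rpow_mul (by norm_num), ← Real.mul_rpow (by norm_num) (by norm_num)]
    norm_num
  have e3 : s ^ (2 * σ) * (((1 / 2) ^ b * N) ^ p / (2 * σ)) / B = 2 * N := by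
    rw [Real.mul_rpow (by positivity) hN0.le]
    calc s ^ (2 * σ) * (((1 / 2 : ℝ) ^ b) ^ p * N ^ p / (2 * σ)) / B
        = (s ^ (2 * σ) * N ^ p) * ((1 / 2 : ℝ) ^ b) ^ p / (2 * σ) / B := by ring
      _ = 2 * N * (((1 / 2 : ℝ) ^ b) ^ p * 2 ^ (b * p)) := by rw [e1, hρσ]; field_simp; ring
      _ = 2 * N := by rw [e2, mul_one]
  rw [e3] at hfin
  linarith

end

end HarnackExt

open HarnackExt
/-- Harnack-type inequality: there is `C = C(n,σ) > 0` such that for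
every `R > 0` and every nonnegative solution `U` on `𝔅_{3R}^+` (with Neumann condition
on all of `B_{3R}`, no singularity), one has
`(max_{|x| ≤ R} u) · (min_{|x| ≤ 2R} u) ≤ C R^{2σ-n}`. -/
theorem stmt_4 (n : ℕ) (hn : 2 ≤ n) (σ : ℝ) (hσ : σ ∈ Set.Ioo (0 : ℝ) 1) :
    ∃ C : ℝ, 0 < C ∧
      ∀ R : ℝ, 0 < R → ∀ U : Pt n → ℝ,
        (∀ X : Pt n, enorm' X ≤ 3 * R → 0 ≤ X.2 → 0 ≤ U X) →
        ContinuousOn U {X : Pt n | enorm' X ≤ 3 * R ∧ 0 ≤ X.2} →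
        ContDiffOn ℝ 2 U {X : Pt n | enorm' X < 3 * R ∧ 0 < X.2} →
        (∀ X : Pt n, enorm' X < 3 * R → 0 < X.2 →
          lapl U X + ((1 - 2 * σ) / X.2) * dt U X = 0) →
        (∀ x : EuclideanSpace ℝ (Fin n), ‖x‖ < 3 * R →
          Tendsto (fun t : ℝ => t ^ (1 - 2 * σ) * dt U (x, t)) (𝓝[>] 0)
            (𝓝 (-(U (x, 0) ^ (((n : ℝ) + 2 * σ) / ((n : ℝ) - 2 * σ)))))) →
        sSup ((fun x : EuclideanSpace ℝ (Fin n) => U (x, 0)) '' {x | ‖x‖ ≤ R}) *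
            sInf ((fun x : EuclideanSpace ℝ (Fin n) => U (x, 0)) '' {x | ‖x‖ ≤ 2 * R}) ≤
          C * R ^ (2 * σ - (n : ℝ)) := by
  obtain ⟨C, hC, h⟩ := exists_trace_product_const hn hσ
  refine ⟨C, hC, fun R hR U hU0 hUc hU2 hUe hUf => ?_⟩
  have hHB : HB n (3 * R) = {X : Pt n | enorm' X ≤ 3 * R ∧ 0 ≤ X.2} := by
    ext X
    exact and_congr_left' (nsq_le_sq_iff (by positivity))
  have hSol : Sol σ (3 * R) (critData σ U) U := by
    refine ⟨fun X hX => ?_, hHB ▸ hUc, fun X hX ht => ?_, fun x hx => ?_⟩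
    · rw [hHB] at hX
      exact hU0 X hX.1 hX.2
    · rw [nsq_lt_sq_iff (by positivity)] at hX
      exact ⟨contDiffAt_of_contDiffOn hU2 hX ht, hUe X hX ht⟩
    · exact flux_of_tendsto hσ hUc hU2 hx (hUf x hx)
  have hbb : BddBelow ((fun x : EuclideanSpace ℝ (Fin n) => U (x, 0)) '' {x | ‖x‖ ≤ 2 * R}) := by
    refine ⟨0, ?_⟩
    rintro _ ⟨x, hx, rfl⟩
    have hx : ‖x‖ ≤ 2 * R := hx
    exact hU0 _ (by rw [enorm'_flat]; linarith) le_rfl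
  have hK : IsCompact {x : EuclideanSpace ℝ (Fin n) | ‖x‖ ≤ R} := by
    simpa [Metric.closedBall, dist_zero_right] using
      isCompact_closedBall (0 : EuclideanSpace ℝ (Fin n)) R
  have hc : ContinuousOn (fun x : EuclideanSpace ℝ (Fin n) => U (x, 0)) {x | ‖x‖ ≤ R} :=
    fun x hx => (ContinuousOn.continuousAt_flat hSol.cont
      (lt_of_le_of_lt hx (by linarith))).continuousWithinAt
  obtain ⟨x₀, hx₀, hsup⟩ := (hK.image_of_continuousOn hc).sSup_mem
    ⟨_, 0, by simpa using hR.le, rfl⟩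
  rw [← hsup]
  exact h R U hR hSol _ (fun x hx => csInf_le hbb ⟨x, hx, rfl⟩) x₀ hx₀
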